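/- arXiv:2206.10115 — 9 statements merged into one kernel-verified Lean document; each statement's English description precedes it below -/
import Mathlib

section
/- Let H and D be monoids and let φ : H → D be a monoid homomorphism such that φ⁻¹(D^×) = H^×. If D is a BF-monoid, then H is a BF-monoid. -/
/-- An element `c` of a monoid is *cancellative* if it can be cancelled on both sides. -/
def IsCancellative {R : Type*} [Monoid R] (c : R) : Prop :=
  (∀ x y : R, c * x = c * y → x = y) ∧ (∀ x y : R, x * c = y * c → x = y)

/-- The submonoid of cancellative elements of a monoid. -/
def cancellativeSubmonoid (R : Type*) [Monoid R] : Submonoid R where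
  carrier := {c | IsCancellative c}
  one_mem' := ⟨fun x y h => by simpa using h, fun x y h => by simpa using h⟩
  mul_mem' := by
    rintro a b ⟨hal, har⟩ ⟨hbl, hbr⟩
    constructor
    · intro x y h
      exact hbl x y (hal (b * x) (b * y) (by rw [← mul_assoc, ← mul_assoc]; exact h))
    · intro x y h
      exact har x y (hbr (x * a) (y * a) (by rw [mul_assoc, mul_assoc]; exact h))

/-- The set of lengths of factorizations of `a` into atoms (irreducible elements). -/
def mulLengthSet {H : Type*} [Monoid H] (a : H) : Set ℕ :=
  {k | ∃ l : List H, (∀ x ∈ l, Irreducible x) ∧ l.prod = a ∧ l.length = k}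

/-- A monoid is *atomic* if every nonunit is a finite product of atoms. -/
def IsAtomicMonoid (H : Type*) [Monoid H] : Prop :=
  ∀ a : H, ¬ IsUnit a → ∃ l : List H, (∀ x ∈ l, Irreducible x) ∧ l.prod = a

/-- A monoid is a *BF-monoid* if it is atomic and all length sets are finite. -/
def IsBFMonoid (H : Type*) [Monoid H] : Prop :=
  IsAtomicMonoid H ∧ ∀ a : H, (mulLengthSet a).Finite

/-- A ring is a *BF-ring* if its monoid of cancellative elements is a BF-monoid. -/
def IsBFRing (R : Type*) [Ring R] : Prop :=
  IsBFMonoid (cancellativeSubmonoid R)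

theorem exists_atom_list_aux {D : Type*} [Monoid D] (hA : IsAtomicMonoid D) (l : List D)
    (hl : ∀ x ∈ l, ¬ IsUnit x) :
    ∃ m : List D, (∀ x ∈ m, Irreducible x) ∧ m.prod = l.prod ∧ l.length ≤ m.length := by
  induction l with
  | nil => exact ⟨[], by simp, rfl, le_rfl⟩
  | cons x t ih =>
    obtain ⟨m, hm, hp, hlen⟩ := ih (fun y hy => hl y (List.mem_cons_of_mem _ hy))
    have hx : ¬ IsUnit x := hl x List.mem_cons_self
    obtain ⟨n, hn, hnp⟩ := hA x hx
    have hn0 : 0 < n.length := by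
      rcases n with _ | ⟨y, n⟩
      · exact absurd (by rw [← hnp]; simp) hx
      · simp
    refine ⟨n ++ m, ?_, ?_, ?_⟩
    · intro y hy
      rcases List.mem_append.1 hy with h | h
      · exact hn y h
      · exact hm y h
    · simp [hnp, hp]
    · simp only [List.length_cons, List.length_append]
      omega

/-- If `φ : H →* D` is a monoid homomorphism with
`φ⁻¹(D^×) = H^×` and `D` is a BF-monoid, then `H` is a BF-monoid. -/
theorem isBFMonoid_of_monoidHom {H D : Type*} [Monoid H] [Monoid D] (φ : H →* D)
    (hφ : ∀ a : H, IsUnit (φ a) ↔ IsUnit a) (hD : IsBFMonoid D) :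
    IsBFMonoid H := by
  have key : ∀ a : H, ∃ N : ℕ, ∀ l : List H, (∀ x ∈ l, ¬ IsUnit x) → l.prod = a →
      l.length ≤ N := by
    intro a
    obtain ⟨N, hN⟩ := (hD.2 (φ a)).bddAbove
    refine ⟨N, fun l hl hp => ?_⟩
    obtain ⟨m, hm, hmp, hlen⟩ := exists_atom_list_aux hD.1 (l.map φ) (by
      intro y hy
      obtain ⟨x, hx, rfl⟩ := List.mem_map.1 hy
      rw [hφ]
      exact hl x hx)
    have h1 : m.length ≤ N := hN ⟨m, hm, by rw [hmp, ← map_list_prod, hp], rfl⟩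
    rw [List.length_map] at hlen
    exact hlen.trans h1
  refine ⟨fun a ha => ?_, fun a => ?_⟩
  · obtain ⟨N, hN⟩ := key a
    by_contra hcon
    have step : ∀ n : ℕ, ∃ l : List H, (∀ x ∈ l, ¬ IsUnit x) ∧ l.prod = a ∧ n ≤ l.length := by
      intro n
      induction n with
      | zero => exact ⟨[a], by simpa using ha, by simp, by simp⟩
      | succ n ih =>
        obtain ⟨l, hl, hp, hn⟩ := ih
        have hex : ∃ x ∈ l, ¬ Irreducible x := by
          by_contra h
          push Not at h
          exact hcon ⟨l, h, hp⟩
        obtain ⟨x, hx, hirr⟩ := hex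
        have hbc : ∃ b c : H, x = b * c ∧ ¬ IsUnit b ∧ ¬ IsUnit c := by
          by_contra h
          push Not at h
          refine hirr ⟨hl x hx, fun b c hbc => ?_⟩
          by_cases hb : IsUnit b
          · exact Or.inl hb
          · exact Or.inr (h b c hbc hb)
        obtain ⟨b, c, rfl, hb, hc⟩ := hbc
        obtain ⟨s, t, rfl⟩ := List.append_of_mem hx
        refine ⟨s ++ b :: c :: t, ?_, ?_, ?_⟩
        · intro y hy
          simp only [List.mem_append, List.mem_cons] at hy hl
          rcases hy with h | rfl | rfl | h
          · exact hl y (Or.inl h)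
          · exact hb
          · exact hc
          · exact hl y (Or.inr (Or.inr h))
        · rw [← hp]
          simp [mul_assoc]
        · simp only [List.length_append, List.length_cons] at hn ⊢
          omega
    obtain ⟨l, hl, hp, hn⟩ := step (N + 1)
    have := hN l hl hp
    omega
  · obtain ⟨N, hN⟩ := key a
    refine (Set.finite_Iic N).subset ?_
    rintro k ⟨l, hl, hp, rfl⟩
    exact hN l (fun x hx => (hl x hx).not_isUnit) hp
end

section
/- Let H be a monoid and let H^• be its submonoid of cancellative elements. If H^• is a right Ore set in H (i.e., for all a ∈ H and b ∈ H^• one has aH^• ∩ bH ≠ ∅), then H^• is right saturated in H, i.e., whenever a, b ∈ H^• and c ∈ H satisfy a = bc, it follows that c ∈ H^•. -/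
/-- If the cancellative elements `H^•` of a monoid `H` form a right
Ore set (for all `a ∈ H`, `b ∈ H^•` one has `aH^• ∩ bH ≠ ∅`), then `H^•` is right
saturated in `H`: whenever `a, b ∈ H^•` and `c ∈ H` satisfy `a = b * c`, one has
`c ∈ H^•`. -/
theorem cancellative_rightSaturated_of_ore {H : Type*} [Monoid H]
    (hOre : ∀ a b : H, IsCancellative b → ∃ s c : H, IsCancellative s ∧ a * s = b * c) :
    ∀ a b c : H, IsCancellative a → IsCancellative b → a = b * c → IsCancellative c := by
  intro a b c ha hb h
  obtain ⟨s, d, hs, e⟩ := hOre b a ha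
  have hsd : s = c * d := hb.1 _ _ (by rw [e, h, mul_assoc])
  refine ⟨fun x y hxy => ha.1 _ _ ?_, fun x y hxy => hs.2 _ _ ?_⟩
  · rw [h, mul_assoc, mul_assoc, hxy]
  · rw [hsd, ← mul_assoc, ← mul_assoc, hxy]
end

section
/- Let R be a ring equipped with an ascending chain R_0 ⊆ R_1 ⊆ R_2 ⊆ ⋯ of additive subgroups with 1 ∈ R_0, R_i · R_j ⊆ R_{i+j} for all i, j ≥ 0, and ⋃_{i≥0} R_i = R. Assume that every nonzero element of R_0 is a unit of R, and that the associated graded ring is a domain, i.e. (setting R_{-1} := {0}) for all i, j ≥ 0, a ∈ R_i \ R_{i-1} and b ∈ R_j \ R_{j-1} one has ab ∈ R_{i+j} \ R_{i+j-1}. Then R is a BF-domain. -/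
theorem isBFMonoid_of_degree {H : Type*} [Monoid H] (d : H → ℕ)
    (hd : ∀ a b, d (a * b) = d a + d b) (h0 : ∀ a, d a = 0 → IsUnit a) : IsBFMonoid H := by
  constructor
  · have key : ∀ n : ℕ, ∀ a : H, d a = n → ¬ IsUnit a →
        ∃ l : List H, (∀ x ∈ l, Irreducible x) ∧ l.prod = a := by
      intro n
      induction n using Nat.strong_induction_on with
      | _ n ih =>
        intro a ha hu
        by_cases hirr : Irreducible a
        · exact ⟨[a], by simpa using hirr, by simp⟩
        · have : ∃ b c, a = b * c ∧ ¬ IsUnit b ∧ ¬ IsUnit c := by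
            by_contra hcon
            apply hirr
            refine ⟨hu, fun b c hbc => ?_⟩
            by_contra h
            rw [not_or] at h
            exact hcon ⟨b, c, hbc, h.1, h.2⟩
          obtain ⟨b, c, rfl, hb, hc⟩ := this
          have hb' : d b ≠ 0 := fun h => hb (h0 b h)
          have hc' : d c ≠ 0 := fun h => hc (h0 c h)
          rw [hd] at ha
          obtain ⟨l₁, h1, e1⟩ := ih (d b) (by omega) b rfl hb
          obtain ⟨l₂, h2, e2⟩ := ih (d c) (by omega) c rfl hc
          refine ⟨l₁ ++ l₂, ?_, by rw [List.prod_append, e1, e2]⟩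
          intro x hx
          rcases List.mem_append.1 hx with h | h
          · exact h1 x h
          · exact h2 x h
    exact fun a => key _ a rfl
  · have key : ∀ l : List H, (∀ x ∈ l, Irreducible x) → l.length ≤ d l.prod := by
      intro l
      induction l with
      | nil => intro _; simp
      | cons x l ih =>
        intro h
        have h1 := ih (fun y hy => h y (List.mem_cons_of_mem _ hy))
        have h2 : d x ≠ 0 := fun h' => (h x List.mem_cons_self).not_isUnit (h0 x h')
        rw [List.prod_cons, hd, List.length_cons]
        omega
    intro a
    refine (Set.finite_Iic (d a)).subset ?_
    rintro k ⟨l, hl, rfl, rfl⟩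
    exact key l hl

/-- Let `R` be a ring with a filtration `R₀ ⊆ R₁ ⊆ ⋯` by additive
subgroups with `1 ∈ R₀`, `Rᵢ·Rⱼ ⊆ R_{i+j}` and `⋃ᵢ Rᵢ = R`, such that every nonzero
element of `R₀` is a unit of `R` and the associated graded ring is a domain (with
`R₋₁ := {0}`: for `a ∈ Rᵢ \ R_{i-1}` and `b ∈ Rⱼ \ R_{j-1}` one has
`ab ∈ R_{i+j} \ R_{i+j-1}`).  Then `R` is a BF-domain. -/
theorem isBFDomain_of_filtration {R : Type*} [Ring R] [Nontrivial R]
    (F : ℕ → AddSubgroup R) (hmono : Monotone F) (hone : (1 : R) ∈ F 0)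
    (hmul : ∀ i j : ℕ, ∀ a ∈ F i, ∀ b ∈ F j, a * b ∈ F (i + j))
    (hunion : ∀ r : R, ∃ i, r ∈ F i)
    (hF0 : ∀ a ∈ F 0, a ≠ 0 → IsUnit a)
    (hgr : ∀ i j : ℕ, ∀ a ∈ F i, ∀ b ∈ F j,
      (0 < i → a ∉ F (i - 1)) → (i = 0 → a ≠ 0) →
      (0 < j → b ∉ F (j - 1)) → (j = 0 → b ≠ 0) →
      a * b ∈ F (i + j) ∧ (0 < i + j → a * b ∉ F (i + j - 1)) ∧
        (i + j = 0 → a * b ≠ 0)) :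
    IsDomain R ∧ IsBFRing R := by
  classical
  let d : R → ℕ := fun r => Nat.find (hunion r)
  have hdm : ∀ r, r ∈ F (d r) := fun r => Nat.find_spec (hunion r)
  have hdn : ∀ r, 0 < d r → r ∉ F (d r - 1) := fun r hr =>
    Nat.find_min (hunion r) (show d r - 1 < d r by omega)
  have hg : ∀ a b : R, a ≠ 0 → b ≠ 0 → a * b ≠ 0 ∧ d (a * b) = d a + d b := by
    intro a b ha hb
    obtain ⟨h1, h2, h3⟩ := hgr (d a) (d b) a (hdm a) b (hdm b) (hdn a) (fun _ => ha)
      (hdn b) (fun _ => hb)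
    constructor
    · intro h
      rcases Nat.eq_zero_or_pos (d a + d b) with h' | h'
      · exact h3 h' h
      · exact h2 h' (h ▸ zero_mem _)
    · apply le_antisymm
      · exact Nat.find_min' (hunion (a * b)) h1
      · by_contra hlt
        have hlt' : d (a * b) ≤ d a + d b - 1 := by omega
        exact h2 (by omega) (hmono hlt' (hdm (a * b)))
  have hnzd : NoZeroDivisors R := ⟨fun {a b} h => by
    by_contra hcon
    rw [not_or] at hcon
    exact (hg a b hcon.1 hcon.2).1 h⟩
  have hne : ∀ c : cancellativeSubmonoid R, (c : R) ≠ 0 := by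
    intro c hc
    have h : IsCancellative (c : R) := c.2
    exact zero_ne_one (h.1 0 1 (by simp [hc]))
  refine ⟨NoZeroDivisors.to_isDomain R, ?_⟩
  refine isBFMonoid_of_degree (fun c : cancellativeSubmonoid R => d (c : R)) ?_ ?_
  · intro a b
    exact (hg a b (hne a) (hne b)).2
  · intro a ha
    have ha' : d (a : R) = 0 := ha
    obtain ⟨u, hu⟩ := hF0 a (ha' ▸ hdm (a : R)) (hne a)
    have hc : IsCancellative ((u⁻¹ : Rˣ) : R) :=
      ⟨fun x y h => by simpa using h, fun x y h => by simpa using h⟩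
    let v : cancellativeSubmonoid R := ⟨((u⁻¹ : Rˣ) : R), hc⟩
    exact ⟨⟨a, v, Subtype.ext (by simp [v, ← hu]), Subtype.ext (by simp [v, ← hu])⟩, rfl⟩
end

section
/- Let K be a field and L a Lie algebra over K. Then the universal enveloping algebra U(L) is a BF-domain. -/
namespace PBW

open MvPolynomial

variable {K L ι : Type*} [Field K] [LieRing L] [LieAlgebra K L] [LinearOrder ι]

/-- Polynomials of total degree `< n`. -/
noncomputable def W (K ι : Type*) [Field K] (n : ℕ) : Submodule K (MvPolynomial ι K) :=
  restrictSupport K {s | s.degree < n}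

/-- The monomial with exponent `s`. -/
noncomputable def mono (K : Type*) {ι : Type*} [Field K] (s : ι →₀ ℕ) : MvPolynomial ι K :=
  monomial s 1

omit [LinearOrder ι] in
lemma mono_mem {s : ι →₀ ℕ} {n : ℕ} (h : s.degree < n) : mono K s ∈ W K ι n := by
  simp [W, mono, h]

omit [LinearOrder ι] in
lemma W_mono {m n : ℕ} (h : m ≤ n) : W K ι m ≤ W K ι n :=
  restrictSupport_mono _ fun _ hs => lt_of_lt_of_le hs h

omit [LinearOrder ι] in
lemma W_map {M : Type*} [AddCommGroup M] [Module K M] (f : MvPolynomial ι K →ₗ[K] M)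
    (N : Submodule K M) (n : ℕ) (h : ∀ s : ι →₀ ℕ, s.degree < n → f (mono K s) ∈ N)
    {p : MvPolynomial ι K} (hp : p ∈ W K ι n) : f p ∈ N := by
  rw [W, restrictSupport_eq_span] at hp
  have : Submodule.span K ((fun s => monomial s (1 : K)) '' {s : ι →₀ ℕ | s.degree < n})
      ≤ N.comap f := by
    rw [Submodule.span_le]
    rintro _ ⟨s, hs, rfl⟩
    exact h s hs
  exact this hp

omit [LinearOrder ι] in
lemma W_ext {M : Type*} [AddCommGroup M] [Module K M] (f g : MvPolynomial ι K →ₗ[K] M)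
    (n : ℕ) (h : ∀ s : ι →₀ ℕ, s.degree < n → f (mono K s) = g (mono K s))
    {p : MvPolynomial ι K} (hp : p ∈ W K ι n) : f p = g p := by
  have := W_map (f - g) ⊥ n (fun s hs => by simp [h s hs]) hp
  simpa [sub_eq_zero] using this

omit [LieRing L] [LieAlgebra K L] [LinearOrder ι] in
lemma b_map [AddCommGroup L] [Module K L] (b : Module.Basis ι K L)
    {M : Type*} [AddCommGroup M] [Module K M] (f : L →ₗ[K] M)
    (N : Submodule K M) (h : ∀ i, f (b i) ∈ N) (x : L) : f x ∈ N := by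
  have : Submodule.span K (Set.range b) ≤ N.comap f := by
    rw [Submodule.span_le]
    rintro _ ⟨s, rfl⟩
    exact h s
  exact this (by rw [b.span_eq]; trivial)

/-- `i` is at most every index in the support of `s`. -/
def Le (i : ι) (s : ι →₀ ℕ) : Prop := ∀ j ∈ s.support, i ≤ j

lemma Le.cons {i j : ι} {s : ι →₀ ℕ} (h : i ≤ j) (hs : Le i s) :
    Le i (Finsupp.single j 1 + s) := by
  intro k hk
  by_cases hkj : k = j
  · exact hkj ▸ h
  · apply hs k
    simpa [Finsupp.single_apply, Ne.symm hkj] using hk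

lemma exists_cons (s : ι →₀ ℕ) (hs : s ≠ 0) :
    ∃ j T, s = Finsupp.single j 1 + T ∧ Le j T := by
  have hne : s.support.Nonempty := Finsupp.support_nonempty_iff.2 hs
  have hj := s.support.min'_mem hne
  refine ⟨s.support.min' hne, s - Finsupp.single (s.support.min' hne) 1, ?_, ?_⟩
  · rw [add_tsub_cancel_of_le]
    rw [Finsupp.single_le_iff]
    exact Nat.one_le_iff_ne_zero.2 (Finsupp.mem_support_iff.1 hj)
  · intro k hk
    apply Finset.min'_le
    rw [Finsupp.mem_support_iff] at hk ⊢
    intro h0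
    apply hk
    simp [h0]

lemma cons_unique {j j' : ι} {T T' : ι →₀ ℕ} (hT : Le j T) (hT' : Le j' T')
    (h : Finsupp.single j 1 + T = Finsupp.single j' 1 + T') : j = j' ∧ T = T' := by
  have h1 : j ≤ j' := Le.cons le_rfl hT j' (by rw [h]; simp)
  have h2 : j' ≤ j := Le.cons le_rfl hT' j (by rw [← h]; simp)
  obtain rfl := le_antisymm h1 h2
  exact ⟨rfl, add_left_cancel h⟩

lemma cons_induction {P : (ι →₀ ℕ) → Prop} (h0 : P 0)
    (h1 : ∀ j T, Le j T → P T → P (Finsupp.single j 1 + T)) (s : ι →₀ ℕ) : P s := by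
  induction hn : s.degree using Nat.strong_induction_on generalizing s with
  | _ n ih =>
    by_cases hs : s = 0
    · exact hs ▸ h0
    · obtain ⟨j, T, rfl, hT⟩ := exists_cons s hs
      refine h1 j T hT (ih T.degree ?_ T rfl)
      rw [← hn]; simp

omit [LinearOrder ι] in
lemma degree_cons (j : ι) (T : ι →₀ ℕ) : (Finsupp.single j 1 + T).degree = T.degree + 1 := by
  simp [add_comm]

/-- The multiplication operators on the symmetric algebra. -/
noncomputable def mulX (b : Module.Basis ι K L) :
    L →ₗ[K] MvPolynomial ι K →ₗ[K] MvPolynomial ι K :=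
  (LinearMap.mul K (MvPolynomial ι K)) ∘ₗ (b.constr K (fun i => (X i : MvPolynomial ι K)))

omit [LinearOrder ι] in
lemma mulX_basis (b : Module.Basis ι K L) (i : ι) (s : ι →₀ ℕ) :
    mulX b (b i) (mono K s) = mono K (Finsupp.single i 1 + s) := by
  simp [mulX, mono, X, monomial_mul]

omit [LinearOrder ι] in
lemma mulX_mul (b : Module.Basis ι K L) (x : L) (p q : MvPolynomial ι K) :
    mulX b x p * q = mulX b x (p * q) := by
  simp [mulX, mul_assoc]

omit [LinearOrder ι] in
lemma mulX_mem (b : Module.Basis ι K L) (x : L) {n : ℕ} {p : MvPolynomial ι K}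
    (hp : p ∈ W K ι n) : mulX b x p ∈ W K ι (n + 1) := by
  refine W_map (mulX b x) _ n (fun s hs => ?_) hp
  refine b_map b ((mulX b).flip (mono K s)) _ (fun i => ?_) x
  rw [LinearMap.flip_apply, mulX_basis]
  exact mono_mem (by rw [degree_cons]; omega)

open Classical in
/-- One step of the recursion. -/
noncomputable def step (b : Module.Basis ι K L)
    (F : L →ₗ[K] MvPolynomial ι K →ₗ[K] MvPolynomial ι K) (i : ι) (s : ι →₀ ℕ) :
    MvPolynomial ι K :=
  if h : ∃ q : ι × (ι →₀ ℕ), s = Finsupp.single q.1 1 + q.2 ∧ Le q.1 q.2 ∧ q.1 < i then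
    mulX b (b i) (mono K s)
      + F (b h.choose.1) (F (b i) (mono K h.choose.2) - mulX b (b i) (mono K h.choose.2))
      + F ⁅b i, b h.choose.1⁆ (mono K h.choose.2)
  else mulX b (b i) (mono K s)

lemma step_of_le (b : Module.Basis ι K L)
    (F : L →ₗ[K] MvPolynomial ι K →ₗ[K] MvPolynomial ι K) {i : ι} {s : ι →₀ ℕ} (h : Le i s) :
    step b F i s = mulX b (b i) (mono K s) := by
  rw [step, dif_neg]
  rintro ⟨⟨j, T⟩, rfl, -, h3⟩
  exact absurd (h j (by simp)) (not_le.2 h3)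

lemma step_of_lt (b : Module.Basis ι K L)
    (F : L →ₗ[K] MvPolynomial ι K →ₗ[K] MvPolynomial ι K) {i j : ι} {T : ι →₀ ℕ} (h : Le j T)
    (hji : j < i) :
    step b F i (Finsupp.single j 1 + T) = mulX b (b i) (mono K (Finsupp.single j 1 + T))
      + F (b j) (F (b i) (mono K T) - mulX b (b i) (mono K T)) + F ⁅b i, b j⁆ (mono K T) := by
  have H : ∃ q : ι × (ι →₀ ℕ), Finsupp.single j 1 + T = Finsupp.single q.1 1 + q.2 ∧
      Le q.1 q.2 ∧ q.1 < i := ⟨(j, T), rfl, h, hji⟩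
  rw [step, dif_pos H]
  obtain ⟨h1, h2, h3⟩ := H.choose_spec
  obtain ⟨e1, e2⟩ := cons_unique h h2 h1
  rw [← e1, ← e2]

lemma le_or_cons (i : ι) (s : ι →₀ ℕ) :
    Le i s ∨ ∃ j T, s = Finsupp.single j 1 + T ∧ Le j T ∧ j < i := by
  by_cases hs : s = 0
  · left; subst hs; intro j hj; simp at hj
  · obtain ⟨j, T, rfl, hT⟩ := exists_cons s hs
    rcases le_or_gt i j with h | h
    · left; exact Le.cons h fun k hk => h.trans (hT k hk)
    · right; exact ⟨j, T, rfl, hT, h⟩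

/-- Approximations to the action. -/
noncomputable def F (b : Module.Basis ι K L) :
    ℕ → (L →ₗ[K] MvPolynomial ι K →ₗ[K] MvPolynomial ι K)
  | 0 => mulX b
  | m + 1 => b.constr K (fun i => (basisMonomials ι K).constr K (step b (F b m) i))

lemma F_succ (b : Module.Basis ι K L) (m : ℕ) (i : ι) (s : ι →₀ ℕ) :
    F b (m + 1) (b i) (mono K s) = step b (F b m) i s := by
  rw [F, Module.Basis.constr_basis]
  exact Module.Basis.constr_basis _ _ _ s

lemma F_sub_mem (b : Module.Basis ι K L) (m : ℕ) (x : L) {n : ℕ} {p : MvPolynomial ι K}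
    (hp : p ∈ W K ι n) : F b m x p - mulX b x p ∈ W K ι n := by
  induction m generalizing x n p with
  | zero => simp [F]
  | succ m ih =>
    have ih' : ∀ (x : L) {n : ℕ} {p : MvPolynomial ι K}, p ∈ W K ι n →
        F b m x p ∈ W K ι (n + 1) := by
      intro x n p hp
      have := (W K ι (n + 1)).add_mem (W_mono (Nat.le_succ n) (ih x hp)) (mulX_mem b x hp)
      simpa using this
    refine W_map (F b (m + 1) x - mulX b x) _ n (fun s hs => ?_) hp
    refine b_map b ((F b (m + 1) - mulX b).flip (mono K s)) _ (fun i => ?_) x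
    rw [LinearMap.flip_apply, LinearMap.sub_apply, LinearMap.sub_apply, F_succ]
    rcases le_or_cons i s with h | ⟨j, T, rfl, hT, hji⟩
    · rw [step_of_le b _ h, sub_self]; exact zero_mem _
    · rw [step_of_lt b _ hT hji, add_assoc, add_sub_cancel_left]
      rw [degree_cons] at hs
      have hT' : mono K T ∈ W K ι (T.degree + 1) := mono_mem (Nat.lt_succ_self _)
      refine W_mono (show T.degree + 1 + 1 ≤ n by omega) (add_mem ?_ ?_)
      · exact ih' _ (ih _ hT')
      · exact ih' _ hT'

lemma F_stable_succ (b : Module.Basis ι K L) (m : ℕ) (x : L) {p : MvPolynomial ι K}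
    (hp : p ∈ W K ι (m + 1)) : F b (m + 1) x p = F b m x p := by
  induction m generalizing x p with
  | zero =>
    refine W_ext _ _ _ (fun s hs => ?_) hp
    suffices H : (F b (0 + 1)).flip (mono K s) = (F b 0).flip (mono K s) from
      LinearMap.congr_fun H x
    refine b.ext fun i => ?_
    rw [LinearMap.flip_apply, LinearMap.flip_apply, F_succ]
    rcases le_or_cons i s with h | ⟨j, T, rfl, hT, hji⟩
    · rw [step_of_le b _ h]; rfl
    · rw [degree_cons] at hs; omega
  | succ m ih =>
    refine W_ext _ _ _ (fun s hs => ?_) hp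
    suffices H : (F b (m + 1 + 1)).flip (mono K s) = (F b (m + 1)).flip (mono K s) from
      LinearMap.congr_fun H x
    refine b.ext fun i => ?_
    rw [LinearMap.flip_apply, LinearMap.flip_apply, F_succ, F_succ]
    rcases le_or_cons i s with h | ⟨j, T, rfl, hT, hji⟩
    · rw [step_of_le b _ h, step_of_le b _ h]
    · rw [step_of_lt b _ hT hji, step_of_lt b _ hT hji]
      rw [degree_cons] at hs
      have hT' : mono K T ∈ W K ι (m + 1) := mono_mem (by omega)
      rw [ih _ hT', ih _ hT', ih _ (F_sub_mem b m _ hT')]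

lemma F_stable (b : Module.Basis ι K L) (m k : ℕ) (x : L) {p : MvPolynomial ι K}
    (hp : p ∈ W K ι (m + 1)) : F b (m + k) x p = F b m x p := by
  induction k with
  | zero => rfl
  | succ k ih =>
    rw [← ih, ← add_assoc]
    exact F_stable_succ b _ x (W_mono (by omega) hp)

/-- The action of `L` on the symmetric algebra. -/
noncomputable def act (b : Module.Basis ι K L) :
    L →ₗ[K] MvPolynomial ι K →ₗ[K] MvPolynomial ι K :=
  ((basisMonomials ι K).constr K (fun s => (F b s.degree).flip (mono K s))).flip

lemma act_eq (b : Module.Basis ι K L) (m : ℕ) (x : L) {p : MvPolynomial ι K}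
    (hp : p ∈ W K ι (m + 1)) : act b x p = F b m x p := by
  refine W_ext _ _ _ (fun s hs => ?_) hp
  have h1 : act b x (mono K s) = F b s.degree x (mono K s) := by
    rw [act, LinearMap.flip_apply]
    exact LinearMap.congr_fun (Module.Basis.constr_basis (basisMonomials ι K) K
      (fun s => (F b s.degree).flip (mono K s)) s) x
  rw [h1]
  obtain ⟨k, rfl⟩ := Nat.exists_eq_add_of_le (Nat.le_of_lt_succ hs)
  exact (F_stable b _ k x (mono_mem (Nat.lt_succ_self _))).symm

lemma act_sub_mem (b : Module.Basis ι K L) (x : L) {n : ℕ} {p : MvPolynomial ι K}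
    (hp : p ∈ W K ι n) : act b x p - mulX b x p ∈ W K ι n := by
  rw [act_eq b n x (W_mono (Nat.le_succ n) hp)]
  exact F_sub_mem b n x hp

lemma act_mem (b : Module.Basis ι K L) (x : L) {n : ℕ} {p : MvPolynomial ι K}
    (hp : p ∈ W K ι n) : act b x p ∈ W K ι (n + 1) := by
  have := (W K ι (n + 1)).add_mem (W_mono (Nat.le_succ n) (act_sub_mem b x hp)) (mulX_mem b x hp)
  simpa using this

lemma act_of_le (b : Module.Basis ι K L) {i : ι} {s : ι →₀ ℕ} (h : Le i s) :
    act b (b i) (mono K s) = mono K (Finsupp.single i 1 + s) := by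
  rw [act_eq b (s.degree + 1) _ (mono_mem (by omega)), F_succ, step_of_le b _ h, mulX_basis]

lemma act_of_lt (b : Module.Basis ι K L) {i j : ι} {T : ι →₀ ℕ} (h : Le j T) (hji : j < i) :
    act b (b i) (mono K (Finsupp.single j 1 + T)) =
      mono K (Finsupp.single i 1 + (Finsupp.single j 1 + T))
      + act b (b j) (act b (b i) (mono K T) - mulX b (b i) (mono K T))
      + act b ⁅b i, b j⁆ (mono K T) := by
  have hT' : mono K T ∈ W K ι (T.degree + 1) := mono_mem (by omega)
  rw [act_eq b (T.degree + 1) _ (mono_mem (by rw [degree_cons]; omega)), F_succ,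
    step_of_lt b _ h hji, mulX_basis, act_eq b _ (b j) (act_sub_mem b _ hT'),
    act_eq b _ (b i) hT', act_eq b _ _ hT']

/-- The commutator defect. -/
noncomputable def comm (b : Module.Basis ι K L) (x y : L) :
    MvPolynomial ι K →ₗ[K] MvPolynomial ι K :=
  act b x ∘ₗ act b y - act b y ∘ₗ act b x - act b ⁅x, y⁆

lemma comm_iff (b : Module.Basis ι K L) (x y : L) (p : MvPolynomial ι K) :
    comm b x y p = 0 ↔ act b x (act b y p) = act b y (act b x p) + act b ⁅x, y⁆ p := by
  simp only [comm, LinearMap.sub_apply, LinearMap.comp_apply]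
  rw [sub_sub, sub_eq_zero]

lemma comm_swap (b : Module.Basis ι K L) (x y : L) (p : MvPolynomial ι K)
    (h : comm b x y p = 0) : comm b y x p = 0 := by
  rw [comm_iff] at h ⊢
  rw [h, ← lie_skew x y, map_neg, LinearMap.neg_apply]
  abel

lemma comm_case1 (b : Module.Basis ι K L) {i j : ι} {T : ι →₀ ℕ} (hT : Le j T) (hji : j < i) :
    comm b (b i) (b j) (mono K T) = 0 := by
  rw [comm_iff, act_of_le b hT, act_of_lt b hT hji, map_sub, mulX_basis,
    act_of_le b (Le.cons hji.le hT), add_left_comm (Finsupp.single i 1)]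
  abel

lemma comm_ext (b : Module.Basis ι K L) (p : MvPolynomial ι K)
    (h : ∀ i j, comm b (b i) (b j) p = 0) (x y : L) : comm b x y p = 0 := by
  have h1 : ∀ i y, comm b (b i) y p = 0 := by
    intro i y
    let f : L →ₗ[K] MvPolynomial ι K :=
      { toFun := fun y => comm b (b i) y p
        map_add' := fun u v => by simp [comm]; abel
        map_smul' := fun c u => by simp [comm, smul_sub] }
    exact b_map b f ⊥ (fun j => h i j) y
  let f : L →ₗ[K] MvPolynomial ι K :=
    { toFun := fun x => comm b x y p
      map_add' := fun u v => by simp [comm]; abel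
      map_smul' := fun c u => by simp [comm, smul_sub] }
  exact b_map b f ⊥ (fun i => h1 i y) x

lemma comm_W (b : Module.Basis ι K L) (n : ℕ) (x y : L) {p : MvPolynomial ι K}
    (hp : p ∈ W K ι n) : comm b x y p = 0 := by
  induction n generalizing x y p with
  | zero => exact W_ext (comm b x y) 0 0 (fun s hs => by omega) hp
  | succ n ih =>
    refine W_ext (comm b x y) 0 _ (fun s hs => ?_) hp
    rw [LinearMap.zero_apply]
    refine comm_ext b _ (fun i j => ?_) x y
    rcases le_or_cons i s with hi | ⟨k, S, rfl, hS, hki⟩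
    · rcases lt_trichotomy i j with hij | rfl | hij
      · exact comm_swap _ _ _ _ (comm_case1 b hi hij)
      · simp [comm]
      · rcases le_or_cons j s with hj | ⟨k, S, rfl, hS, hki⟩
        · exact comm_case1 b hj hij
        · exact absurd (hi k (by simp)) (not_le.2 (hki.trans hij))
    rcases le_or_cons j (Finsupp.single k 1 + S) with hj | ⟨k', S', e, hS', hkj⟩
    · exact comm_case1 b hj (lt_of_le_of_lt (hj k (by simp)) hki)
    obtain ⟨rfl, rfl⟩ := cons_unique hS hS' e
    rw [degree_cons] at hs
    have hSn : mono K S ∈ W K ι n := mono_mem (by omega)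
    have key : ∀ i j, k < i → k < j →
        act b (b i) (act b (b k) (act b (b j) (mono K S))) =
        act b (b k) (act b (b i) (act b (b j) (mono K S))) +
          act b ⁅b i, b k⁆ (act b (b j) (mono K S)) := by
      intro i j hi hj
      rw [← comm_iff]
      have e : act b (b j) (mono K S) = mono K (Finsupp.single j 1 + S) +
          (act b (b j) (mono K S) - mulX b (b j) (mono K S)) := by
        rw [mulX_basis]; abel
      rw [e, map_add, comm_case1 b (Le.cons hj.le hS) hi, zero_add]
      exact ih _ _ (act_sub_mem b _ hSn)
    have C : ∀ x y, act b x (act b y (mono K S)) =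
        act b y (act b x (mono K S)) + act b ⁅x, y⁆ (mono K S) :=
      fun x y => (comm_iff _ _ _ _).1 (ih x y hSn)
    rw [comm_iff, ← act_of_le b hS, C (b j) (b k), C (b i) (b k), map_add, map_add,
      key i j hki hkj, key j i hkj hki, C (b i) ⁅b j, b k⁆, C (b j) ⁅b i, b k⁆, C ⁅b i, b j⁆ (b k),
      C (b i) (b j), map_add]
    have J : ⁅⁅b i, b j⁆, b k⁆ = ⁅b i, ⁅b j, b k⁆⁆ - ⁅b j, ⁅b i, b k⁆⁆ := lie_lie _ _ _
    rw [J, map_sub, LinearMap.sub_apply]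
    abel

omit [LinearOrder ι] in
lemma mem_W (p : MvPolynomial ι K) : p ∈ W K ι (p.totalDegree + 1) := by
  rw [W, mem_restrictSupport_iff]
  intro s hs
  exact Nat.lt_succ_of_le (le_totalDegree hs)

lemma comm_all (b : Module.Basis ι K L) (x y : L) (p : MvPolynomial ι K) :
    act b x (act b y p) = act b y (act b x p) + act b ⁅x, y⁆ p :=
  (comm_iff _ _ _ _).1 (comm_W b _ x y (mem_W p))

attribute [local instance 100] LieRing.ofAssociativeRing

/-- The action as a Lie algebra homomorphism. -/
noncomputable def actLie (b : Module.Basis ι K L) :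
    L →ₗ⁅K⁆ Module.End K (MvPolynomial ι K) :=
  { act b with
    map_lie' := by
      intro x y
      refine LinearMap.ext fun p => ?_
      rw [LieRing.of_associative_ring_bracket]
      simp [comm_all b x y p] }

/-- The action of the enveloping algebra. -/
noncomputable def rep (b : Module.Basis ι K L) :
    UniversalEnvelopingAlgebra K L →ₐ[K] Module.End K (MvPolynomial ι K) :=
  UniversalEnvelopingAlgebra.lift K (actLie b)

lemma rep_ι (b : Module.Basis ι K L) (x : L) :
    rep b (UniversalEnvelopingAlgebra.ι K x) = act b x :=
  UniversalEnvelopingAlgebra.lift_ι_apply K (actLie b) x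

/-- Ordered monomials in the enveloping algebra. -/
noncomputable def ord (b : Module.Basis ι K L) (s : ι →₀ ℕ) : UniversalEnvelopingAlgebra K L :=
  (((Finsupp.toMultiset s).sort (· ≤ ·)).map (fun i => UniversalEnvelopingAlgebra.ι K (b i))).prod

lemma ord_cons (b : Module.Basis ι K L) {j : ι} {T : ι →₀ ℕ} (h : Le j T) :
    ord b (Finsupp.single j 1 + T) = UniversalEnvelopingAlgebra.ι K (b j) * ord b T := by
  have : Finsupp.toMultiset (Finsupp.single j 1 + T) = j ::ₘ Finsupp.toMultiset T := by
    rw [map_add, Finsupp.toMultiset_single, one_smul, Multiset.singleton_add]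
  rw [ord, ord, this, Multiset.sort_cons, List.map_cons, List.prod_cons]
  intro k hk
  exact h k (by simpa [Finsupp.mem_toMultiset] using hk)

/-- The PBW map. -/
noncomputable def psi (b : Module.Basis ι K L) :
    MvPolynomial ι K →ₗ[K] UniversalEnvelopingAlgebra K L :=
  (basisMonomials ι K).constr K (ord b)

lemma psi_mono (b : Module.Basis ι K L) (s : ι →₀ ℕ) : psi b (mono K s) = ord b s :=
  Module.Basis.constr_basis _ _ _ s

lemma psi_one (b : Module.Basis ι K L) : psi b 1 = 1 := by
  have : (1 : MvPolynomial ι K) = mono K 0 := rfl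
  rw [this, psi_mono]
  simp [ord]

lemma psi_act (b : Module.Basis ι K L) (n : ℕ) (x : L) {p : MvPolynomial ι K}
    (hp : p ∈ W K ι n) : psi b (act b x p) = UniversalEnvelopingAlgebra.ι K x * psi b p := by
  induction n generalizing x p with
  | zero =>
    have : p = 0 := W_ext (LinearMap.id) 0 0 (fun s hs => by omega) hp
    simp [this]
  | succ n ih =>
    refine W_ext (psi b ∘ₗ act b x)
      (LinearMap.mulLeft K (UniversalEnvelopingAlgebra.ι K x) ∘ₗ psi b) _ (fun s hs => ?_) hp
    let f : L →ₗ[K] UniversalEnvelopingAlgebra K L := psi b ∘ₗ (act b).flip (mono K s)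
    let g : L →ₗ[K] UniversalEnvelopingAlgebra K L :=
      LinearMap.mulRight K (psi b (mono K s)) ∘ₗ
        (UniversalEnvelopingAlgebra.ι K : L →ₗ⁅K⁆ UniversalEnvelopingAlgebra K L).toLinearMap
    suffices H : f = g from LinearMap.congr_fun H x
    refine b.ext fun i => ?_
    change psi b (act b (b i) (mono K s)) =
      UniversalEnvelopingAlgebra.ι K (b i) * psi b (mono K s)
    rcases le_or_cons i s with h | ⟨j, T, rfl, hT, hji⟩
    · rw [act_of_le b h, psi_mono, psi_mono, ord_cons b h]
    · rw [degree_cons] at hs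
      have hTn : mono K T ∈ W K ι n := mono_mem (by omega)
      have e : UniversalEnvelopingAlgebra.ι K (b i) * UniversalEnvelopingAlgebra.ι K (b j) =
          UniversalEnvelopingAlgebra.ι K (b j) * UniversalEnvelopingAlgebra.ι K (b i) +
          UniversalEnvelopingAlgebra.ι K ⁅b i, b j⁆ := by
        rw [LieHom.map_lie, LieRing.of_associative_ring_bracket]; abel
      rw [act_of_lt b hT hji, map_add, map_add, ih _ (act_sub_mem b _ hTn), map_sub, ih _ hTn,
        ih _ hTn, psi_mono b (_ + _), psi_mono b (_ + _), ord_cons b hT, mulX_basis, psi_mono,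
        psi_mono, ← mul_assoc, e, add_left_comm (Finsupp.single i 1),
        ord_cons b (Le.cons hji.le hT)]
      noncomm_ring

lemma psi_rep (b : Module.Basis ι K L) (u : UniversalEnvelopingAlgebra K L)
    (p : MvPolynomial ι K) : psi b (rep b u p) = u * psi b p := by
  have hsurj : Function.Surjective (UniversalEnvelopingAlgebra.mkAlgHom K L) := by
    intro u
    induction u using Quotient.inductionOn' with
    | h t => exact ⟨t, rfl⟩
  obtain ⟨t, rfl⟩ := hsurj u
  induction t using TensorAlgebra.induction generalizing p with
  | algebraMap r => simp [Algebra.algebraMap_eq_smul_one]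
  | ι x =>
    have := psi_act b _ x (mem_W p)
    rw [← rep_ι, UniversalEnvelopingAlgebra.ι_apply] at this
    exact this
  | mul a c ha hc => rw [map_mul, map_mul, Module.End.mul_apply, ha, hc, mul_assoc]
  | add a c ha hc => rw [map_add, map_add, LinearMap.add_apply, map_add, ha, hc, add_mul]

/-- The symbol-like linear map. -/
noncomputable def phi (b : Module.Basis ι K L) (u : UniversalEnvelopingAlgebra K L) :
    MvPolynomial ι K := rep b u 1

lemma psi_phi (b : Module.Basis ι K L) (u : UniversalEnvelopingAlgebra K L) :
    psi b (phi b u) = u := by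
  rw [phi, psi_rep, psi_one, mul_one]

lemma rep_psi_mono (b : Module.Basis ι K L) (s : ι →₀ ℕ) {n : ℕ} {f : MvPolynomial ι K}
    (hf : f ∈ W K ι (n + 1)) :
    rep b (psi b (mono K s)) f - mono K s * f ∈ W K ι (s.degree + n) := by
  induction s using cons_induction with
  | h0 =>
    have : (1 : MvPolynomial ι K) = mono K 0 := rfl
    rw [← this, psi_one]
    simp
  | h1 j T hT ih =>
    rw [psi_mono] at ih
    rw [psi_mono, ord_cons b hT, map_mul, rep_ι, degree_cons, ← mulX_basis b, mulX_mul]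
    have h1 : mono K T * f ∈ W K ι (T.degree + n + 1) := by
      refine W_map (LinearMap.mulLeft K (mono K T)) _ (n + 1) (fun s hs => ?_) hf
      have : mono K T * mono K s = mono K (T + s) := by simp [mono, monomial_mul]
      rw [LinearMap.mulLeft_apply, this]
      exact mono_mem (by rw [map_add]; omega)
    have h2 := add_mem (act_mem b (b j) ih) (act_sub_mem b (b j) h1)
    rw [map_sub] at h2
    rw [show T.degree + 1 + n = T.degree + n + 1 by omega]
    simpa using h2

lemma rep_psi (b : Module.Basis ι K L) {m n : ℕ} {g f : MvPolynomial ι K}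
    (hg : g ∈ W K ι (m + 1)) (hf : f ∈ W K ι (n + 1)) :
    rep b (psi b g) f - g * f ∈ W K ι (m + n) := by
  let Φ : MvPolynomial ι K →ₗ[K] MvPolynomial ι K :=
    (LinearMap.applyₗ f) ∘ₗ (rep b).toLinearMap ∘ₗ psi b - LinearMap.mulRight K f
  refine W_map Φ _ (m + 1) (fun s hs => ?_) hg
  exact W_mono (by omega) (rep_psi_mono b s hf)

lemma phi_mul (b : Module.Basis ι K L) (u v : UniversalEnvelopingAlgebra K L) :
    phi b (u * v) - phi b u * phi b v ∈
      W K ι ((phi b u).totalDegree + (phi b v).totalDegree) := by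
  have := rep_psi b (mem_W (phi b u)) (mem_W (phi b v))
  rw [psi_phi] at this
  have e : phi b (u * v) = rep b u (phi b v) := by
    simp only [phi, map_mul, Module.End.mul_apply]
  rwa [e]

lemma phi_ne_zero (b : Module.Basis ι K L) {u : UniversalEnvelopingAlgebra K L} (hu : u ≠ 0) :
    phi b u ≠ 0 := by
  intro h
  apply hu
  rw [← psi_phi b u, h, map_zero]

omit [LinearOrder ι] in
lemma totalDegree_of_W {g p : MvPolynomial ι K} (hg : g ≠ 0) 
    (h : p - g ∈ W K ι g.totalDegree) : p ≠ 0 ∧ p.totalDegree = g.totalDegree := by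
  obtain ⟨s, hs, hsd⟩ : ∃ s ∈ g.support, g.totalDegree = s.degree :=
    Finset.exists_mem_eq_sup _ (support_nonempty.2 hg) _
  have hc : p.coeff s = g.coeff s := by
    have : (p - g).coeff s = 0 := by
      by_contra hne
      have := ((mem_restrictSupport_iff K).1 h) (mem_support_iff.2 hne)
      exact absurd this (by simp [hsd])
    rw [coeff_sub, sub_eq_zero] at this
    exact this
  have hsp : s ∈ p.support := by rw [mem_support_iff, hc]; exact mem_support_iff.1 hs
  refine ⟨support_nonempty.1 ⟨s, hsp⟩, le_antisymm ?_ ?_⟩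
  · refine Finset.sup_le fun t ht => ?_
    change t.degree ≤ _
    by_contra hlt
    rw [mem_support_iff] at ht
    have h1 : g.coeff t = 0 := by
      by_contra h2
      exact hlt (le_totalDegree (mem_support_iff.2 h2))
    have : (p - g).coeff t ≠ 0 := by rwa [coeff_sub, h1, sub_zero]
    have := ((mem_restrictSupport_iff K).1 h) (mem_support_iff.2 this)
    exact hlt (le_of_lt this)
  · rw [hsd]; exact le_totalDegree hsp

lemma deg_mul (b : Module.Basis ι K L) {u v : UniversalEnvelopingAlgebra K L}
    (hu : u ≠ 0) (hv : v ≠ 0) : u * v ≠ 0 ∧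
    (phi b (u * v)).totalDegree = (phi b u).totalDegree + (phi b v).totalDegree := by
  have hu' := phi_ne_zero b hu
  have hv' := phi_ne_zero b hv
  have e := totalDegree_mul_of_isDomain hu' hv'
  have h := phi_mul b u v
  rw [← e] at h ⊢
  obtain ⟨h1, h2⟩ := totalDegree_of_W (mul_ne_zero hu' hv') h
  refine ⟨fun h0 => h1 ?_, h2⟩
  rw [h0, phi, map_zero, LinearMap.zero_apply]

lemma isUnit_of_deg (b : Module.Basis ι K L) {u : UniversalEnvelopingAlgebra K L}
    (hu : u ≠ 0) (h : (phi b u).totalDegree = 0) : IsUnit u := by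
  have h1 := totalDegree_eq_zero_iff_eq_C.1 h
  set c := coeff 0 (phi b u)
  have h2 : u = algebraMap K _ c := by
    rw [← psi_phi b u, h1, ← mul_one (C c), ← smul_eq_C_mul, map_smul, psi_one,
      Algebra.algebraMap_eq_smul_one]
  have hc : c ≠ 0 := by
    rintro h0
    rw [h0, map_zero] at h2
    exact hu h2
  rw [h2]
  exact (IsUnit.mk0 c hc).map _

lemma bf_of_length {H : Type*} [Monoid H] (d : H → ℕ) (hd : ∀ a b, d (a * b) = d a + d b)
    (h0 : ∀ a, d a = 0 → IsUnit a) : IsBFMonoid H := by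
  constructor
  · intro a ha
    induction hn : d a using Nat.strong_induction_on generalizing a with
    | _ n ih =>
      by_cases hirr : Irreducible a
      · exact ⟨[a], by simpa using hirr, by simp⟩
      · rw [irreducible_iff] at hirr
        push Not at hirr
        obtain ⟨x, y, rfl, hx, hy⟩ := hirr ha
        have hx0 : d x ≠ 0 := fun h => hx (h0 x h)
        have hy0 : d y ≠ 0 := fun h => hy (h0 y h)
        rw [hd] at hn
        obtain ⟨l, hl, rfl⟩ := ih (d x) (by omega) x hx rfl
        obtain ⟨l', hl', rfl⟩ := ih (d y) (by omega) y hy rfl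
        refine ⟨l ++ l', ?_, by simp⟩
        intro z hz
        rcases List.mem_append.1 hz with h | h
        · exact hl z h
        · exact hl' z h
  · intro a
    refine (Set.finite_Iic (d a)).subset ?_
    rintro _ ⟨l, hl, rfl, rfl⟩
    rw [Set.mem_Iic]
    induction l with
    | nil => simp
    | cons x l ih =>
      have hx0 : d x ≠ 0 := fun h => (hl x (by simp)).not_isUnit (h0 x h)
      have := ih fun z hz => hl z (by simp [hz])
      rw [List.prod_cons, hd, List.length_cons]
      omega

end PBW

/-- The universal enveloping algebra of a Lie algebra over a field
is a BF-domain. -/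
theorem universalEnvelopingAlgebra_isBFDomain (K L : Type*) [Field K] [LieRing L]
    [LieAlgebra K L] :
    IsDomain (UniversalEnvelopingAlgebra K L) ∧
      IsBFRing (UniversalEnvelopingAlgebra K L) := by
  classical
  let b := Module.Basis.ofVectorSpace K L
  let : LinearOrder (Module.Basis.ofVectorSpaceIndex K L) :=
    linearOrderOfSTO WellOrderingRel
  have hnt : Nontrivial (UniversalEnvelopingAlgebra K L) := by
    refine ⟨⟨1, 0, fun h => ?_⟩⟩
    have h2 : PBW.rep b 1 1 = PBW.rep b 0 1 := by rw [h]
    simp at h2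
  have hnz : NoZeroDivisors (UniversalEnvelopingAlgebra K L) :=
    ⟨fun {u v} h => by
      by_contra hne
      push Not at hne
      exact (PBW.deg_mul b hne.1 hne.2).1 h⟩
  have hdom : IsDomain (UniversalEnvelopingAlgebra K L) := NoZeroDivisors.to_isDomain _
  refine ⟨hdom, ?_⟩
  have hne : ∀ a : cancellativeSubmonoid (UniversalEnvelopingAlgebra K L), a.1 ≠ 0 := by
    intro a ha
    exact one_ne_zero (a.2.1 1 0 (by rw [ha]; simp))
  refine PBW.bf_of_length (fun a => (PBW.phi b a.1).totalDegree)
    (fun x y => (PBW.deg_mul b (hne x) (hne y)).2) (fun a ha => ?_)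
  obtain ⟨u, hu⟩ := PBW.isUnit_of_deg b (hne a) ha
  have hinv : ∀ w : (UniversalEnvelopingAlgebra K L)ˣ,
      w.1 ∈ cancellativeSubmonoid (UniversalEnvelopingAlgebra K L) := fun w =>
    ⟨fun x y h => w.mul_right_inj.1 h, fun x y h => w.mul_left_inj.1 h⟩
  refine ⟨⟨a, ⟨_, hinv u⁻¹⟩, Subtype.ext ?_, Subtype.ext ?_⟩, rfl⟩
  · simp [← hu]
  · simp [← hu]
end

section
/- Let R be a ring. Suppose there exist a cancellative nonunit a ∈ R, a cancellative element x ∈ R, and a unit ε ∈ R^× such that ax = xε. Then R does not satisfy the ascending chain condition on principal left ideals: the chain Rx ⊊ Rxε^{-1} ⊊ Rxε^{-2} ⊊ ⋯ is strictly ascending. In particular, R is not left noetherian. -/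
/-- Let `R` be a ring containing a cancellative nonunit `a`, a
cancellative element `x` and a unit `ε` with `a * x = x * ε`.  Then the chain of
principal left ideals `Rx ⊊ Rxε⁻¹ ⊊ Rxε⁻² ⊊ ⋯` is strictly ascending, so `R` does
not satisfy the ACC on principal left ideals; in particular `R` is not left
noetherian. -/
theorem not_leftNoetherian_of_conjugate_unit {R : Type*} [Ring R] (a x : R) (ε : Rˣ)
    (ha : IsCancellative a) (hna : ¬ IsUnit a) (hx : IsCancellative x)
    (h : a * x = x * (ε : R)) :
    (∀ n : ℕ, Submodule.span R {x * (((ε⁻¹ : Rˣ) : R)) ^ n} <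
      Submodule.span R {x * (((ε⁻¹ : Rˣ) : R)) ^ (n + 1)}) ∧
    ¬ IsNoetherian R R := by
  have key : ∀ n : ℕ, Submodule.span R {x * (((ε⁻¹ : Rˣ) : R)) ^ n} <
      Submodule.span R {x * (((ε⁻¹ : Rˣ) : R)) ^ (n + 1)} := by
    intro n
    have e : x * (((ε⁻¹ : Rˣ) : R)) ^ n = a * (x * (((ε⁻¹ : Rˣ) : R)) ^ (n + 1)) := by
      rw [← mul_assoc, h, pow_succ', mul_assoc, Units.mul_inv_cancel_left]
    refine lt_of_le_not_ge ?_ ?_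
    · rw [Submodule.span_singleton_le_iff_mem, Submodule.mem_span_singleton]
      exact ⟨a, e.symm⟩
    · intro hle
      rw [Submodule.span_singleton_le_iff_mem, Submodule.mem_span_singleton] at hle
      obtain ⟨r, hr⟩ := hle
      rw [e, smul_eq_mul, ← mul_assoc, ← mul_assoc] at hr
      have hu : IsUnit ((((ε⁻¹ : Rˣ) : R)) ^ (n + 1)) := (Units.isUnit _).pow _
      have h1 : r * a * x = x := hu.mul_right_cancel hr
      have h2 : r * a = 1 := hx.2 _ _ (by rw [h1, one_mul])
      have h3 : a * r = 1 := ha.2 _ _ (by rw [mul_assoc, h2, mul_one, one_mul])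
      exact hna ⟨⟨a, r, h3, h2⟩, rfl⟩
  refine ⟨key, fun hN => ?_⟩
  have hm := strictMono_nat_of_lt_succ key
  obtain ⟨n, hn⟩ := monotone_stabilizes_iff_noetherian.mpr hN ⟨_, hm.monotone⟩
  exact (key n).ne (hn (n + 1) (Nat.le_succ n))
end

section
/- Let S be a BF-domain, let R be a ring containing S as a subring, and let x ∈ R be such that every element of R has a unique representation of the form Σ_{i=0}^{n} x^i a_i with a_i ∈ S (that is, the powers x^i form a basis of R as a right S-module), and such that there are maps σ, δ : S → S with σ a ring endomorphism of S, satisfying a·x = x·σ(a) + δ(a) for all a ∈ S (so R is the skew polynomial ring S[x;σ,δ]). Assume σ is injective and that σ(a) ∈ S^× implies a ∈ S^× for all a ∈ S. Then R is a BF-domain. -/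
theorem IsBFMonoid.of_length {H : Type*} [Monoid H] (L : H → ℕ)
    (hmul : ∀ a b, L a + L b ≤ L (a * b)) (hu : ∀ a, L a = 0 → IsUnit a) : IsBFMonoid H := by
  constructor
  · have key : ∀ n : ℕ, ∀ a : H, L a ≤ n → ¬ IsUnit a →
        ∃ l : List H, (∀ x ∈ l, Irreducible x) ∧ l.prod = a := by
      intro n
      induction n with
      | zero => intro a ha hn; exact absurd (hu a (by omega)) hn
      | succ n ih =>
        intro a ha hn
        by_cases hi : Irreducible a
        · exact ⟨[a], by simpa using hi, by simp⟩
        · rw [irreducible_iff] at hi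
          push Not at hi
          obtain ⟨b, c, rfl, hb, hc⟩ := hi hn
          have h1 := hmul b c
          have h2 : L b ≠ 0 := fun h => hb (hu b h)
          have h3 : L c ≠ 0 := fun h => hc (hu c h)
          obtain ⟨l1, h11, h12⟩ := ih b (by omega) hb
          obtain ⟨l2, h21, h22⟩ := ih c (by omega) hc
          refine ⟨l1 ++ l2, ?_, by simp [h12, h22]⟩
          intro y hy
          rcases List.mem_append.1 hy with h | h
          · exact h11 y h
          · exact h21 y h
    intro a ha
    exact key _ a le_rfl ha
  · intro a
    refine (Set.finite_Iic (L a)).subset ?_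
    rintro k ⟨l, hl, rfl, rfl⟩
    simp only [Set.mem_Iic]
    induction l with
    | nil => simp
    | cons y l ih =>
      have h1 := hmul y l.prod
      have h2 : L y ≠ 0 := fun h => (hl y (by simp)).not_isUnit (hu y h)
      have h3 := ih (fun z hz => hl z (by simp [hz]))
      simp only [List.prod_cons, List.length_cons]
      omega

theorem IsBFMonoid.exists_length {H : Type*} [Monoid H] (hH : IsBFMonoid H) :
    ∃ L : H → ℕ, (∀ a b, L a + L b ≤ L (a * b)) ∧ (∀ a, L a = 0 → IsUnit a) ∧
      ∀ g : H →* H, (∀ a, IsUnit (g a) → IsUnit a) → ∀ a, L a ≤ L (g a) := by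
  obtain ⟨hat, hfin⟩ := hH
  have hle : ∀ (l : List H), (∀ y ∈ l, Irreducible y) → l.length ≤ sSup (mulLengthSet l.prod) :=
    fun l hl => le_csSup (hfin _).bddAbove ⟨l, hl, rfl, rfl⟩
  have hex : ∀ a : H, sSup (mulLengthSet a) = 0 ∨ ∃ l : List H, (∀ y ∈ l, Irreducible y) ∧
      l.prod = a ∧ l.length = sSup (mulLengthSet a) := by
    intro a
    rcases (mulLengthSet a).eq_empty_or_nonempty with h | h
    · left; rw [h]; simp
    · right; exact Nat.sSup_mem h (hfin a).bddAbove
  have hu : ∀ a : H, sSup (mulLengthSet a) = 0 → IsUnit a := by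
    intro a h0
    by_contra hn
    obtain ⟨l, hl, rfl⟩ := hat a hn
    have := hle l hl
    have : l = [] := List.length_eq_zero_iff.1 (by omega)
    subst this
    simp at hn
  have hul : ∀ (a b : H), IsUnit a → sSup (mulLengthSet b) ≤ sSup (mulLengthSet (a * b)) := by
    rintro a b ⟨u, rfl⟩
    rcases hex b with h | ⟨l, hl, rfl, h⟩
    · omega
    · rw [← h]
      cases l with
      | nil => simp
      | cons y l =>
        have := hle ((u * y) :: l) (by
          intro z hz
          rcases List.mem_cons.1 hz with rfl | hz
          · exact (irreducible_units_mul u).2 (hl y (by simp))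
          · exact hl z (by simp [hz]))
        simpa [mul_assoc] using this
  have hur : ∀ (a b : H), IsUnit b → sSup (mulLengthSet a) ≤ sSup (mulLengthSet (a * b)) := by
    rintro a b ⟨u, rfl⟩
    rcases hex a with h | ⟨l, hl, rfl, h⟩
    · omega
    · rw [← h]
      rcases List.eq_nil_or_concat l with rfl | ⟨l, y, rfl⟩
      · simp
      · have := hle (l ++ [y * u]) (by
          intro z hz
          rcases List.mem_append.1 hz with hz | hz
          · exact hl z (by simp [hz])
          · rw [List.mem_singleton.1 hz]
            exact (irreducible_mul_units u).2 (hl y (by simp)))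
        simpa [mul_assoc] using this
  have hmul : ∀ a b : H, sSup (mulLengthSet a) + sSup (mulLengthSet b) ≤
      sSup (mulLengthSet (a * b)) := by
    intro a b
    rcases hex a with h | ⟨l, hl, hla, h⟩
    · have := hul a b (hu a h); omega
    · rcases hex b with h' | ⟨l', hl', hla', h'⟩
      · have := hur a b (hu b h'); omega
      · have := hle (l ++ l') (by
          intro z hz
          rcases List.mem_append.1 hz with hz | hz
          · exact hl z hz
          · exact hl' z hz)
        rw [List.prod_append, hla, hla', List.length_append] at this
        omega
  refine ⟨fun a => sSup (mulLengthSet a), hmul, hu, ?_⟩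
  intro g hg a
  rcases hex a with h | ⟨l, hl, hla, h⟩
  · simp [h]
  · show sSup (mulLengthSet a) ≤ sSup (mulLengthSet (g a))
    rw [← h, ← hla]
    clear h hla
    induction l with
    | nil => simp
    | cons y l ih =>
      have h1 := hmul (g y) (g l.prod)
      have h2 : sSup (mulLengthSet (g y)) ≠ 0 :=
        fun h => (hl y (by simp)).not_isUnit (hg y (hu _ h))
      have h3 := ih (fun z hz => hl z (by simp [hz]))
      rw [List.prod_cons, List.length_cons, map_mul]
      omega

theorem isCancellative_iff_ne_zero {S : Type*} [Ring S] [IsDomain S] (a : S) :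
    a ∈ cancellativeSubmonoid S ↔ a ≠ 0 := by
  constructor
  · rintro ⟨h, -⟩ rfl
    exact zero_ne_one (h 0 1 (by simp))
  · intro h
    exact ⟨fun y z => mul_left_cancel₀ h, fun y z => mul_right_cancel₀ h⟩

theorem isUnit_cancellative_iff {S : Type*} [Ring S] [IsDomain S] (a : cancellativeSubmonoid S) :
    IsUnit a ↔ IsUnit (a : S) := by
  constructor
  · intro h; exact h.map (cancellativeSubmonoid S).subtype
  · rintro ⟨u, hu⟩
    refine ⟨⟨a, ⟨(↑u⁻¹ : S), (isCancellative_iff_ne_zero _).2 u⁻¹.ne_zero⟩, ?_, ?_⟩, rfl⟩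
    · ext; simp [← hu]
    · ext; simp [← hu]

theorem exists_domain_length {S : Type*} [Ring S] [IsDomain S] (hS : IsBFRing S) (σ : S →+* S)
    (hσinj : Function.Injective σ) (hσu : ∀ a : S, IsUnit (σ a) → IsUnit a) :
    ∃ L : S → ℕ, (∀ a b, a ≠ 0 → b ≠ 0 → L a + L b ≤ L (a * b)) ∧
      (∀ a, a ≠ 0 → L a = 0 → IsUnit a) ∧ ∀ a, a ≠ 0 → L a ≤ L (σ a) := by
  classical
  obtain ⟨L, h1, h2, h3⟩ := IsBFMonoid.exists_length hS
  have hσ0 : ∀ a, a ≠ 0 → σ a ≠ 0 := fun a ha h => ha (hσinj (by simpa using h))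
  let g : cancellativeSubmonoid S →* cancellativeSubmonoid S :=
    { toFun := fun a => ⟨σ a, (isCancellative_iff_ne_zero _).2
        (hσ0 _ ((isCancellative_iff_ne_zero _).1 a.2))⟩
      map_one' := by ext; simp
      map_mul' := by intro a b; ext; simp }
  have h3 := h3 g (by
    intro a ha
    rw [isUnit_cancellative_iff] at ha ⊢
    exact hσu _ ha)
  refine ⟨fun a => if h : a ≠ 0 then L ⟨a, (isCancellative_iff_ne_zero _).2 h⟩ else 0, ?_, ?_, ?_⟩
  · intro a b ha hb
    simp only [dif_pos ha, dif_pos hb, dif_pos (mul_ne_zero ha hb)]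
    exact h1 _ _
  · intro a ha h
    simp only [dif_pos ha] at h
    exact (isUnit_cancellative_iff _).1 (h2 _ h)
  · intro a ha
    simp only [dif_pos ha, dif_pos (hσ0 a ha)]
    exact h3 _

/-- Span of the low-degree monomials. -/
def skewLow {S R : Type*} [Ring S] [Ring R] (f : S →+* R) (x : R) (n : ℕ) : AddSubgroup R :=
  AddSubgroup.closure {r | ∃ i a, i < n ∧ r = x ^ i * f a}

section skew
variable {S R : Type*} [Ring S] [Ring R] (f : S →+* R) (x : R) (σ : S →+* S) (δ : S → S)

theorem skewLow_mono {n m : ℕ} (h : n ≤ m) : skewLow f x n ≤ skewLow f x m := by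
  apply AddSubgroup.closure_mono
  rintro r ⟨i, a, hi, rfl⟩
  exact ⟨i, a, by omega, rfl⟩

theorem mem_skewLow {n i : ℕ} (h : i < n) (a : S) : x ^ i * f a ∈ skewLow f x n :=
  AddSubgroup.subset_closure ⟨i, a, h, rfl⟩

theorem skewLow_induct {n : ℕ} {K : AddSubgroup R} (g : R →+ R)
    (h : ∀ i a, i < n → g (x ^ i * f a) ∈ K) {v : R} (hv : v ∈ skewLow f x n) : g v ∈ K := by
  have : skewLow f x n ≤ K.comap g := by
    apply (AddSubgroup.closure_le _).2
    rintro r ⟨i, a, hi, rfl⟩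
    exact h i a hi
  exact this hv

theorem skewLow_mul_f {n : ℕ} (b : S) {v : R} (hv : v ∈ skewLow f x n) :
    v * f b ∈ skewLow f x n :=
  skewLow_induct f x (AddMonoidHom.mulRight (f b)) (by
    intro i a hi
    simp only [AddMonoidHom.mulRight_apply, mul_assoc, ← map_mul]
    exact mem_skewLow f x hi _) hv

theorem skewLow_pow_mul {n : ℕ} (k : ℕ) {v : R} (hv : v ∈ skewLow f x n) :
    x ^ k * v ∈ skewLow f x (k + n) :=
  skewLow_induct f x (AddMonoidHom.mulLeft (x ^ k)) (by
    intro i a hi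
    simp only [AddMonoidHom.coe_mulLeft, ← mul_assoc, ← pow_add]
    exact mem_skewLow f x (by omega) _) hv

variable (hcomm : ∀ a : S, f a * x = x * f (σ a) + f (δ a))
include hcomm

theorem skewLow_mul_x {n : ℕ} {v : R} (hv : v ∈ skewLow f x n) :
    v * x ∈ skewLow f x (n + 1) :=
  skewLow_induct f x (AddMonoidHom.mulRight x) (by
    intro i a hi
    simp only [AddMonoidHom.mulRight_apply, mul_assoc, hcomm, mul_add]
    rw [← mul_assoc, ← pow_succ]
    exact add_mem (mem_skewLow f x (by omega) _) (mem_skewLow f x (by omega) _)) hv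

theorem skew_f_mul_pow (a : S) (m : ℕ) :
    f a * x ^ m - x ^ m * f (σ^[m] a) ∈ skewLow f x m := by
  induction m with
  | zero => simp
  | succ m ih =>
    have h1 := skewLow_mul_x f x σ δ hcomm ih
    have h2 := mem_skewLow f x (Nat.lt_succ_self m) (δ (σ^[m] a))
    have := add_mem h1 h2
    convert this using 1
    rw [Function.iterate_succ_apply', sub_mul, mul_assoc (x ^ m), hcomm, pow_succ]
    noncomm_ring

theorem skew_mono_mul (i j : ℕ) (c d : S) :
    (x ^ i * f c) * (x ^ j * f d) - x ^ (i + j) * f (σ^[j] c * d) ∈ skewLow f x (i + j) := by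
  have := skewLow_pow_mul f x i (skewLow_mul_f f x d (skew_f_mul_pow f x σ δ hcomm c j))
  convert this using 1
  rw [pow_add, map_mul]
  noncomm_ring

theorem skew_mono_mul_mem {i j k : ℕ} (c d : S) (h : i + j < k) :
    (x ^ i * f c) * (x ^ j * f d) ∈ skewLow f x k := by
  have h1 := skewLow_mono f x h.le (skew_mono_mul f x σ δ hcomm i j c d)
  have h2 := add_mem h1 (mem_skewLow f x h (σ^[j] c * d))
  simpa using h2

theorem skew_mono_mul_low {i m k : ℕ} (c : S) (h : i + m ≤ k) {w : R} (hw : w ∈ skewLow f x m) :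
    (x ^ i * f c) * w ∈ skewLow f x k :=
  skewLow_induct f x (AddMonoidHom.mulLeft (x ^ i * f c)) (by
    intro j a hj
    exact skew_mono_mul_mem f x σ δ hcomm _ _ (by omega)) hw

theorem skew_low_mul_mono {j n k : ℕ} (d : S) (h : n + j ≤ k) {v : R} (hv : v ∈ skewLow f x n) :
    v * (x ^ j * f d) ∈ skewLow f x k :=
  skewLow_induct f x (AddMonoidHom.mulRight (x ^ j * f d)) (by
    intro i a hi
    exact skew_mono_mul_mem f x σ δ hcomm _ _ (by omega)) hv

theorem skew_low_mul_low {n m : ℕ} {v w : R} (hv : v ∈ skewLow f x n) (hw : w ∈ skewLow f x m) :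
    v * w ∈ skewLow f x (n + m) :=
  skewLow_induct f x (AddMonoidHom.mulRight w) (by
    intro i a hi
    exact skew_mono_mul_low f x σ δ hcomm _ (by omega) hw) hv

theorem skew_lead_mul {n m : ℕ} {a b : S} {r s : R} (hr : r - x ^ n * f a ∈ skewLow f x n)
    (hs : s - x ^ m * f b ∈ skewLow f x m) :
    r * s - x ^ (n + m) * f (σ^[m] a * b) ∈ skewLow f x (n + m) := by
  have h1 := skew_mono_mul f x σ δ hcomm n m a b
  have h2 := skew_low_mul_mono f x σ δ hcomm (j := m) b le_rfl hr
  have h3 := skew_mono_mul_low f x σ δ hcomm (i := n) a le_rfl hs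
  have h4 := skew_low_mul_low f x σ δ hcomm hr hs
  convert add_mem (add_mem h1 h2) (add_mem h3 h4) using 1
  noncomm_ring

omit hcomm

open Polynomial in
/-- Evaluation of coefficients on the right. -/
def skewEval : S[X] →+ R where
  toFun p := p.sum fun i a => x ^ i * f a
  map_zero' := by simp
  map_add' p q := by
    apply Polynomial.sum_add_index
    · simp
    · simp [mul_add]

open Polynomial in
theorem skewEval_monomial (n : ℕ) (a : S) : skewEval f x (monomial n a) = x ^ n * f a := by
  show (monomial n a).sum (fun i a => x ^ i * f a) = _
  rw [sum_monomial_index]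
  simp

open Polynomial in
theorem skewEval_lead (p : S[X]) :
    skewEval f x p - x ^ p.natDegree * f p.leadingCoeff ∈ skewLow f x p.natDegree := by
  have h : skewEval f x p = skewEval f x p.eraseLead + x ^ p.natDegree * f p.leadingCoeff := by
    rw [← skewEval_monomial, ← map_add, eraseLead_add_monomial_natDegree_leadingCoeff]
  rw [h, add_sub_cancel_right]
  show p.eraseLead.sum (fun i a => x ^ i * f a) ∈ _
  rw [Polynomial.sum_def]
  apply sum_mem
  intro i hi
  exact mem_skewLow f x (lt_natDegree_of_mem_eraseLead_support hi) _

open Polynomial in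
theorem exists_of_mem_skewLow {n : ℕ} {v : R} (hv : v ∈ skewLow f x n) :
    ∃ p : S[X], p.degree < n ∧ skewEval f x p = v := by
  have : skewLow f x n ≤ (degreeLT S n).toAddSubgroup.map (skewEval f x) := by
    apply (AddSubgroup.closure_le _).2
    rintro r ⟨i, a, hi, rfl⟩
    refine ⟨monomial i a, ?_, skewEval_monomial f x i a⟩
    show monomial i a ∈ degreeLT S n
    rw [mem_degreeLT]
    exact (degree_monomial_le i a).trans_lt (by exact_mod_cast hi)
  obtain ⟨p, hp, rfl⟩ := this hv
  exact ⟨p, mem_degreeLT.1 hp, rfl⟩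

open Polynomial in
theorem exists_of_lead {n : ℕ} {a : S} (ha : a ≠ 0) {r : R}
    (hr : r - x ^ n * f a ∈ skewLow f x n) :
    ∃ p : S[X], skewEval f x p = r ∧ p ≠ 0 ∧ p.natDegree = n ∧ p.leadingCoeff = a := by
  obtain ⟨q, hq, h⟩ := exists_of_mem_skewLow f x hr
  have hd : q.degree < (monomial n a).degree := by rwa [degree_monomial n ha]
  have hl : (q + monomial n a).leadingCoeff = a := by
    rw [leadingCoeff_add_of_degree_lt hd, leadingCoeff_monomial]
  refine ⟨q + monomial n a, ?_, ?_, ?_, hl⟩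
  · rw [map_add, h, skewEval_monomial]; simp
  · intro h0; rw [h0] at hl; exact ha (by simpa using hl.symm)
  · rw [natDegree_eq_of_degree_eq (degree_add_eq_right_of_degree_lt hd),
      natDegree_monomial_eq n ha]

end skew

/-- Let `S` be a BF-domain and let `R ⊇ S` be a skew polynomial ring
`S[x; σ, δ]`: every element of `R` is uniquely of the form `Σ xⁱ aᵢ` with `aᵢ ∈ S`,
and `a · x = x · σ(a) + δ(a)` for all `a ∈ S`, where `σ` is an injective ring
endomorphism of `S` such that `σ(a) ∈ S^×` implies `a ∈ S^×`.  Then `R` is a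
BF-domain. -/
theorem skewPolynomialRing_isBFDomain {S R : Type*} [Ring S] [Ring R]
    (f : S →+* R) (hf : Function.Injective f) (x : R) (σ : S →+* S) (δ : S → S)
    (hrep : ∀ r : R, ∃! p : ℕ →₀ S, r = p.sum fun i a => x ^ i * f a)
    (hcomm : ∀ a : S, f a * x = x * f (σ a) + f (δ a))
    (hσinj : Function.Injective σ)
    (hσu : ∀ a : S, IsUnit (σ a) → IsUnit a)
    (hSdom : IsDomain S) (hSBF : IsBFRing S) :
    IsDomain R ∧ IsBFRing R := by
  classical
  have hbij : Function.Bijective (skewEval f x) := by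
    constructor
    · intro p q h
      obtain ⟨t, -, ht⟩ := hrep (skewEval f x p)
      have hp := ht p.toFinsupp.coeff rfl
      have hq := ht q.toFinsupp.coeff h
      exact Polynomial.toFinsupp_injective (AddMonoidAlgebra.coeff_injective (hp.trans hq.symm))
    · intro r
      obtain ⟨t, ht, -⟩ := hrep r
      exact ⟨⟨.ofCoeff t⟩, ht.symm⟩
  obtain ⟨L, hL1, hL2, hL3⟩ := exists_domain_length hSBF σ hσinj hσu
  have hσ0 : ∀ a, a ≠ 0 → ∀ m, σ^[m] a ≠ 0 := by
    intro a ha m h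
    exact ha (hσinj.iterate m (by rw [h, iterate_map_zero]))
  have hL4 : ∀ a, a ≠ 0 → ∀ m, L a ≤ L (σ^[m] a) := by
    intro a ha m
    induction m with
    | zero => simp
    | succ m ih =>
      rw [Function.iterate_succ_apply']
      exact ih.trans (hL3 _ (hσ0 a ha m))
  have key : ∀ p q : Polynomial S, p ≠ 0 → q ≠ 0 → ∃ t : Polynomial S,
      skewEval f x t = skewEval f x p * skewEval f x q ∧ t ≠ 0 ∧
      t.natDegree = p.natDegree + q.natDegree ∧
      t.leadingCoeff = σ^[q.natDegree] p.leadingCoeff * q.leadingCoeff := by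
    intro p q hp hq
    refine exists_of_lead f x ?_
      (skew_lead_mul f x σ δ hcomm (skewEval_lead f x p) (skewEval_lead f x q))
    exact mul_ne_zero (hσ0 _ (by simpa using hp) _) (by simpa using hq)
  have hne : Nontrivial R := hf.nontrivial
  have hnz : NoZeroDivisors R := by
    constructor
    intro a b hab
    obtain ⟨p, rfl⟩ := hbij.2 a
    obtain ⟨q, rfl⟩ := hbij.2 b
    by_contra! hcon
    obtain ⟨t, ht, ht0, -⟩ := key p q (by rintro rfl; simp at hcon) (by rintro rfl; simp at hcon)
    rw [hab] at ht
    exact ht0 (hbij.1 (by rw [ht, map_zero]))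
  have hdom : IsDomain R := NoZeroDivisors.to_isDomain R
  refine ⟨hdom, ?_⟩
  choose g hg using hbij.2
  have hgi : ∀ p, g (skewEval f x p) = p := fun p => hbij.1 (hg _)
  have hg0 : ∀ r : cancellativeSubmonoid R, g r ≠ 0 := by
    intro r h
    have := hg r
    rw [h, map_zero] at this
    exact (isCancellative_iff_ne_zero _).1 r.2 this.symm
  refine IsBFMonoid.of_length (fun r => (g r).natDegree + L (g r).leadingCoeff) ?_ ?_
  · intro a b
    obtain ⟨t, ht, ht0, h1, h2⟩ := key _ _ (hg0 a) (hg0 b)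
    have h3 : g ((a * b : cancellativeSubmonoid R) : R) = t := by
      rw [hg, hg] at ht
      rw [Submonoid.coe_mul, ← ht, hgi]
    have ha : (g a).leadingCoeff ≠ 0 := by simpa using hg0 a
    have hb : (g b).leadingCoeff ≠ 0 := by simpa using hg0 b
    have h4 := hL1 _ _ (hσ0 _ ha (g b).natDegree) hb
    have h5 := hL4 _ ha (g b).natDegree
    simp only [h3, h1, h2]
    omega
  · intro a h
    have h1 : (g a).natDegree = 0 := by omega
    have ha : (g a).leadingCoeff ≠ 0 := by simpa using hg0 a
    have h2 := hL2 _ ha (by omega)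
    rw [isUnit_cancellative_iff]
    have h3 : (a : R) = f (g a).leadingCoeff := by
      conv_lhs => rw [← hg a, Polynomial.eq_C_of_natDegree_eq_zero h1,
        ← Polynomial.monomial_zero_left, skewEval_monomial]
      rw [Polynomial.leadingCoeff, h1]; simp
    rw [h3]
    exact h2.map f
end

section
/- Let R be a prime FBN ring such that every nonzero two-sided ideal of R contains a nonzero central element. Then for every cancellative nonunit a ∈ R there exists a prime two-sided ideal P of R of height one (i.e., P ≠ 0 and every prime two-sided ideal strictly contained in P is 0) such that the annihilator {r ∈ R : sr ∈ aR for all s ∈ R} of the right R-module R/aR is contained in P. -/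
/-- `I` is a right ideal of `R` (as a set). -/
def IsRightIdealSet (R : Type*) [Ring R] (I : Set R) : Prop :=
  (0 : R) ∈ I ∧ (∀ x ∈ I, ∀ y ∈ I, x + y ∈ I) ∧ (∀ x ∈ I, -x ∈ I) ∧
    ∀ x ∈ I, ∀ r : R, x * r ∈ I

/-- `I` is a left ideal of `R` (as a set). -/
def IsLeftIdealSet (R : Type*) [Ring R] (I : Set R) : Prop :=
  (0 : R) ∈ I ∧ (∀ x ∈ I, ∀ y ∈ I, x + y ∈ I) ∧ (∀ x ∈ I, -x ∈ I) ∧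
    ∀ x ∈ I, ∀ r : R, r * x ∈ I

/-- `I` is a two-sided ideal of `R` (as a set). -/
def IsIdealSet (R : Type*) [Ring R] (I : Set R) : Prop :=
  IsRightIdealSet R I ∧ IsLeftIdealSet R I

/-- `P` is a prime two-sided ideal of `R`: a proper two-sided ideal such that
`a R b ⊆ P` implies `a ∈ P` or `b ∈ P`. -/
def IsPrimeIdealSet (R : Type*) [Ring R] (P : Set R) : Prop :=
  IsIdealSet R P ∧ P ≠ Set.univ ∧ ∀ a b : R, (∀ r : R, a * r * b ∈ P) → a ∈ P ∨ b ∈ P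

/-- A ring is *prime* if its zero ideal is prime. -/
def IsPrimeRing (R : Type*) [Ring R] : Prop :=
  IsPrimeIdealSet R {0}

/-- The factor ring `R/P` is right bounded: every essential right ideal of `R/P`
(described via right ideals of `R` containing `P`) contains a nonzero two-sided
ideal of `R/P`. -/
def IsRightBoundedMod (R : Type*) [Ring R] (P : Set R) : Prop :=
  ∀ I : Set R, IsRightIdealSet R I → P ⊆ I →
    (∀ J : Set R, IsRightIdealSet R J → P ⊆ J → (∃ y ∈ J, y ∉ P) →
      ∃ x, x ∈ I ∧ x ∈ J ∧ x ∉ P) →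
    ∃ T : Set R, IsIdealSet R T ∧ P ⊆ T ∧ (∃ t ∈ T, t ∉ P) ∧ T ⊆ I

/-- The factor ring `R/P` is left bounded. -/
def IsLeftBoundedMod (R : Type*) [Ring R] (P : Set R) : Prop :=
  ∀ I : Set R, IsLeftIdealSet R I → P ⊆ I →
    (∀ J : Set R, IsLeftIdealSet R J → P ⊆ J → (∃ y ∈ J, y ∉ P) →
      ∃ x, x ∈ I ∧ x ∈ J ∧ x ∉ P) →
    ∃ T : Set R, IsIdealSet R T ∧ P ⊆ T ∧ (∃ t ∈ T, t ∉ P) ∧ T ⊆ I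

/-- `R` is fully bounded: for every prime two-sided ideal `P`, the factor ring
`R/P` is bounded (right and left). -/
def IsFullyBounded (R : Type*) [Ring R] : Prop :=
  ∀ P : Set R, IsPrimeIdealSet R P → IsRightBoundedMod R P ∧ IsLeftBoundedMod R P

/-- `R` is fully bounded noetherian: fully bounded and left and right noetherian. -/
def IsFBN (R : Type*) [Ring R] : Prop :=
  IsFullyBounded R ∧ IsNoetherian R R ∧ IsNoetherian Rᵐᵒᵖ R


set_option linter.unusedSectionVars false
set_option linter.unusedVariables false

section AbstractPart
variable {Λ : Type*} [CompleteLattice Λ] [IsModularLattice Λ]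

/-- right ideals -/
def RI (m : Λ → Λ → Λ) (x : Λ) : Prop := m x ⊤ ≤ x
/-- two-sided ideals -/
def TI (m : Λ → Λ → Λ) (x : Λ) : Prop := m x ⊤ ≤ x ∧ m ⊤ x ≤ x
def PrI (m : Λ → Λ → Λ) (V : Λ) : Prop :=
  TI m V ∧ V ≠ ⊤ ∧ ∀ A B, TI m A → TI m B → m A B ≤ V → A ≤ V ∨ B ≤ V
def fl (m : Λ → Λ → Λ) : Λ → Λ → Λ := fun x y => m y x
def res (m : Λ → Λ → Λ) (p G : Λ) : Λ := sSup {x | m p x ≤ G}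

/-- one-sided part of the axioms -/
structure IQ1 (m : Λ → Λ → Λ) (pt : Set Λ) : Prop where
  mul_sup : ∀ a b c, m a (b ⊔ c) ≤ m a b ⊔ m a c
  le_top : ∀ x, x ≤ m x ⊤
  res_le : ∀ p G, m p (res m p G) ≤ G
  ptr : ∀ p ∈ pt, ∀ y D, y ≤ m p D → ∃ x ≤ D, y = m p x
  ptb : ∀ p ∈ pt, ∀ Z X G, m p Z ≤ m p X ⊔ G → Z ≤ X ⊔ res m p G
  acc : ∀ s : Set Λ, s.Nonempty → (∀ x ∈ s, RI m x) → ∃ x ∈ s, ∀ y ∈ s, x ≤ y → y ≤ x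
  bdd : ∀ V, PrI m V → ∀ K, RI m K → V ≤ K →
    (∀ D, RI m D → V ≤ D → ¬ D ≤ V → ¬ (K ⊓ D ≤ V)) → ∃ T, TI m T ∧ ¬ T ≤ V ∧ T ≤ K

structure IQ (m : Λ → Λ → Λ) (pt : Set Λ) : Prop where
  assoc : ∀ a b c, m (m a b) c = m a (m b c)
  mono : ∀ {a b c d}, a ≤ b → c ≤ d → m a c ≤ m b d
  pt_ex : ∀ x y, ¬ x ≤ y → ∃ p ∈ pt, p ≤ x ∧ ¬ p ≤ y
  r : IQ1 m pt
  l : IQ1 (fl m) pt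

structure SC (m : Λ → Λ → Λ) (C : Set Λ) : Prop where
  ideal : ∀ J ∈ C, TI m J
  top : ⊤ ∈ C
  mul : ∀ J ∈ C, ∀ K ∈ C, m J K ∈ C
  up : ∀ J ∈ C, ∀ K, TI m K → J ≤ K → K ∈ C
  symr : ∀ A, TI m A → ∀ J ∈ C, ∃ J' ∈ C, m A J' ≤ m J A
  syml : ∀ A, TI m A → ∀ J ∈ C, ∃ J' ∈ C, m J' A ≤ m A J

def rl (m : Λ → Λ → Λ) (C : Set Λ) (N' N : Λ) : Prop := ∃ J ∈ C, m N' J ≤ N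

def DCb (m : Λ → Λ → Λ) (C : Set Λ) (A' A : Λ) : Prop :=
  ¬ ∃ H : ℕ → Λ, ∀ i, TI m (H i) ∧ A' ≤ H i ∧ H i ≤ A ∧ H (i+1) ≤ H i ∧ ¬ rl m C (H i) (H (i+1))

inductive HC (m : Λ → Λ → Λ) (C : Set Λ) (A : Λ) : Λ → ℕ → Prop
  | base : HC m C A A 0
  | mono {B D n} : HC m C A B n → B ≤ D → RI m D → HC m C A D n
  | step {B D n} : HC m C A B n → B ≤ D → RI m D → ¬ rl m C D B → HC m C A D (n+1)

def Fn (m : Λ → Λ → Λ) (C : Set Λ) (A B : Λ) : Prop := ∃ N, ∀ n, HC m C A B n → n ≤ N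
def IsLen (m : Λ → Λ → Λ) (C : Set Λ) (A B : Λ) (n : ℕ) : Prop :=
  HC m C A B n ∧ ∀ k, HC m C A B k → k ≤ n

variable {m : Λ → Λ → Λ} {pt : Set Λ} {C : Set Λ}

lemma TI.ri {x : Λ} (h : TI m x) : RI m x := h.1
lemma TI.fl {x : Λ} (h : TI m x) : TI (fl m) x := ⟨h.2, h.1⟩
lemma TI.unfl {x : Λ} (h : TI (_root_.fl m) x) : TI m x := ⟨h.2, h.1⟩

lemma IQ.flip (q : IQ m pt) : IQ (fl m) pt where
  assoc a b c := (q.assoc c b a).symm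
  mono h1 h2 := q.mono h2 h1
  pt_ex := q.pt_ex
  r := q.l
  l := q.r

lemma SC.flip (s : SC m C) : SC (fl m) C where
  ideal J h := (s.ideal J h).fl
  top := s.top
  mul J hJ K hK := s.mul K hK J hJ
  up J hJ K hK h := s.up J hJ K hK.unfl h
  symr A hA J hJ := s.syml A hA.unfl J hJ
  syml A hA J hJ := s.symr A hA.unfl J hJ

lemma rl_flip (q : IQ m pt) (s : SC m C) {N' N : Λ} (hN' : TI m N') (h : rl m C N' N) : rl (fl m) C N' N := by
  obtain ⟨J, hJ, h⟩ := h
  obtain ⟨J', hJ', h'⟩ := s.syml N' hN' J hJ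
  exact ⟨J', hJ', h'.trans h⟩

lemma DCb_flip (q : IQ m pt) (s : SC m C) {A' A : Λ} (h : DCb m C A' A) : DCb (fl m) C A' A := by
  rintro ⟨H, hH⟩
  refine h ⟨H, fun i => ?_⟩
  obtain ⟨h1, h2, h3, h4, h5⟩ := hH i
  exact ⟨h1.unfl, h2, h3, h4, fun h => h5 (rl_flip q s h1.unfl h)⟩

namespace IQ
variable (q : IQ m pt)
include q

lemma le_top_l (x : Λ) : x ≤ m ⊤ x := q.l.le_top x
lemma mul_sup (a b c : Λ) : m a (b ⊔ c) ≤ m a b ⊔ m a c := q.r.mul_sup a b c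
lemma sup_mul (a b c : Λ) : m (b ⊔ c) a ≤ m b a ⊔ m c a := q.l.mul_sup a b c

lemma le_res {p x G : Λ} : x ≤ res m p G ↔ m p x ≤ G :=
  ⟨fun h => (q.mono le_rfl h).trans (q.r.res_le p G), fun h => le_sSup h⟩

lemma RI_mul {x : Λ} (h : RI m x) (y : Λ) : m x y ≤ x := (q.mono le_rfl le_top).trans h
lemma LI_mul {x : Λ} (h : TI m x) (y : Λ) : m y x ≤ x := (q.mono le_top le_rfl).trans h.2

lemma RI_sup {x y : Λ} (hx : RI m x) (hy : RI m y) : RI m (x ⊔ y) :=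
  (q.sup_mul _ _ _).trans (sup_le_sup hx hy)
lemma RI_inf {x y : Λ} (hx : RI m x) (hy : RI m y) : RI m (x ⊓ y) :=
  le_inf ((q.mono inf_le_left le_rfl).trans hx) ((q.mono inf_le_right le_rfl).trans hy)
lemma RI_top : RI m (⊤ : Λ) := le_top
lemma TI_top : TI m (⊤ : Λ) := ⟨le_top, le_top⟩
lemma RI_mul' (x : Λ) {y : Λ} (hy : RI m y) : RI m (m x y) := by
  unfold RI; rw [q.assoc]; exact q.mono le_rfl hy
lemma TI_sup {x y : Λ} (hx : TI m x) (hy : TI m y) : TI m (x ⊔ y) :=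
  ⟨q.RI_sup hx.1 hy.1, (q.mul_sup _ _ _).trans (sup_le_sup hx.2 hy.2)⟩
lemma TI_mul {x y : Λ} (hx : TI m x) (hy : TI m y) : TI m (m x y) :=
  ⟨q.RI_mul' x hy.1, by rw [← q.assoc]; exact q.mono hx.2 le_rfl⟩
lemma RI_res {p G : Λ} (hG : RI m G) : RI m (res m p G) := by
  unfold RI; rw [q.le_res, ← q.assoc]; exact (q.mono (q.r.res_le p G) le_rfl).trans hG
lemma TI_res {p G : Λ} (hp : RI m p) (hG : RI m G) : TI m (res m p G) := by
  refine ⟨q.RI_res hG, ?_⟩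
  rw [q.le_res, ← q.assoc]; exact (q.mono hp le_rfl).trans (q.r.res_le p G)

variable (s : SC m C)
include s

lemma rl_of_le {x y : Λ} (hx : RI m x) (h : x ≤ y) : rl m C x y := ⟨⊤, s.top, hx.trans h⟩
omit s in
lemma rl_mono {x y x' y' : Λ} (h : rl m C x y) (h1 : x' ≤ x) (h2 : y ≤ y') : rl m C x' y' := by
  obtain ⟨J, hJ, h⟩ := h
  exact ⟨J, hJ, (q.mono h1 le_rfl).trans (h.trans h2)⟩

omit s q in
lemma _root_.HC.ri {A B : Λ} {n} (hA : RI m A) (h : HC m C A B n) : RI m B := by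
  induction h <;> assumption
omit s q in
lemma _root_.HC.le {A B : Λ} {n} (h : HC m C A B n) : A ≤ B := by
  induction h with
  | base => exact le_rfl
  | mono _ h _ ih => exact ih.trans h
  | step _ h _ _ ih => exact ih.trans h

omit s q in
lemma _root_.HC.trans {A B D : Λ} {p n} (h : HC m C A B p) (h' : HC m C B D n) : HC m C A D (p + n) := by
  induction h' with
  | base => exact h
  | mono _ h1 h2 ih => exact ih.mono h1 h2
  | step _ h1 h2 h3 ih => exact ih.step h1 h2 h3

lemma HC_split {A B D : Λ} {n} (hA : RI m A) (hB : RI m B) (hAB : A ≤ B) (h : HC m C A D n) :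
    ∃ p k, n ≤ p + k ∧ HC m C A (D ⊓ B) p ∧ HC m C B (D ⊔ B) k := by
  induction h with
  | base => exact ⟨0, 0, le_rfl, by rw [inf_eq_left.2 hAB]; exact .base, by rw [sup_eq_right.2 hAB]; exact .base⟩
  | mono h1 h2 h3 ih =>
    obtain ⟨p, k, h, hp, hk⟩ := ih
    exact ⟨p, k, h, hp.mono (inf_le_inf_right _ h2) (q.RI_inf h3 hB), hk.mono (sup_le_sup_right h2 _) (q.RI_sup h3 hB)⟩
  | @step D D' n h1 h2 h3 h4 ih =>
    obtain ⟨p, k, h, hp, hk⟩ := ih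
    by_cases c1 : rl m C (D' ⊓ B) (D ⊓ B)
    · have c2 : ¬ rl m C (D' ⊔ B) (D ⊔ B) := by
        rintro ⟨J, hJ, c2⟩
        obtain ⟨J', hJ', c1⟩ := c1
        refine h4 ⟨m J J', s.mul _ hJ _ hJ', ?_⟩
        have e1 : m D' J ≤ D ⊔ (B ⊓ D') := by
          rw [← sup_inf_assoc_of_le B h2]
          exact le_inf ((q.mono le_sup_left le_rfl).trans c2) (q.RI_mul h3 _)
        rw [← q.assoc]
        refine (q.mono e1 le_rfl).trans ((q.sup_mul _ _ _).trans (sup_le (q.RI_mul (h1.ri hA) _) ?_))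
        rw [inf_comm]
        exact c1.trans inf_le_left
      exact ⟨p, k+1, by omega, hp.mono (inf_le_inf_right _ h2) (q.RI_inf h3 hB),
        hk.step (sup_le_sup_right h2 _) (q.RI_sup h3 hB) c2⟩
    · exact ⟨p+1, k, by omega, hp.step (inf_le_inf_right _ h2) (q.RI_inf h3 hB) c1,
        hk.mono (sup_le_sup_right h2 _) (q.RI_sup h3 hB)⟩

lemma HC_split' {A B D : Λ} {n} (hA : RI m A) (hB : RI m B) (hAB : A ≤ B) (hBD : B ≤ D) (h : HC m C A D n) :
    ∃ p k, n ≤ p + k ∧ HC m C A B p ∧ HC m C B D k := by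
  have := q.HC_split s hA hB hAB h
  rwa [inf_eq_right.2 hBD, sup_eq_left.2 hBD] at this

lemma Fn_trans {A B D : Λ} (hA : RI m A) (hB : RI m B) (hAB : A ≤ B) (hBD : B ≤ D)
    (h1 : Fn m C A B) (h2 : Fn m C B D) : Fn m C A D := by
  obtain ⟨N, h1⟩ := h1
  obtain ⟨M, h2⟩ := h2
  refine ⟨N + M, fun n h => ?_⟩
  obtain ⟨p, k, h, hp, hk⟩ := q.HC_split' s hA hB hAB hBD h
  have := h1 _ hp
  have := h2 _ hk
  omega

omit s q in
lemma Fn_left {A B D : Λ} (hD : RI m D) (hBD : B ≤ D) (h : Fn m C A D) : Fn m C A B := by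
  obtain ⟨N, h⟩ := h
  exact ⟨N, fun n hn => h n (hn.mono hBD hD)⟩
omit s q in
lemma Fn_right {A B D : Λ} (hB : RI m B) (hAB : A ≤ B) (h : Fn m C A D) : Fn m C B D := by
  obtain ⟨N, h⟩ := h
  refine ⟨N, fun n hn => h n ?_⟩
  have := (HC.base.mono hAB hB : HC m C A B 0).trans hn
  simpa using this

lemma Fn_of_rl {A B : Λ} (h : rl m C B A) : Fn m C A B := by
  refine ⟨0, ?_⟩
  suffices ∀ D n, HC m C A D n → D ≤ B → n ≤ 0 from fun n hn => this _ n hn le_rfl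
  intro D n hn
  induction hn with
  | base => intro _; exact le_rfl
  | mono _ h1 _ ih => intro h2; exact ih (h1.trans h2)
  | step h1 _ _ h3 ih => intro h2; exact absurd (q.rl_mono h h2 h1.le) h3

omit s q in
lemma HC_map {A B A' : Λ} {n} (φ : Λ → Λ) (hA : RI m A) (h : HC m C A B n)
    (hφ : ∀ X, RI m X → A ≤ X → X ≤ B → RI m (φ X))
    (hm : ∀ X Y, RI m X → RI m Y → A ≤ X → X ≤ Y → Y ≤ B → φ X ≤ φ Y)
    (hr : ∀ X Y, RI m X → RI m Y → A ≤ X → X ≤ Y → Y ≤ B → rl m C (φ Y) (φ X) → rl m C Y X)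
    (hA' : A' ≤ φ A) : HC m C A' (φ B) n := by
  induction h with
  | base => exact HC.base.mono hA' (hφ A hA le_rfl le_rfl)
  | mono h h1 h2 ih =>
    exact (ih (fun X a b c => hφ X a b (c.trans h1)) (fun X Y a b c d e => hm X Y a b c d (e.trans h1))
      (fun X Y a b c d e => hr X Y a b c d (e.trans h1))).mono (hm _ _ (h.ri hA) h2 h.le h1 le_rfl)
        (hφ _ h2 (h.le.trans h1) le_rfl)
  | step h h1 h2 h3 ih =>
    exact (ih (fun X a b c => hφ X a b (c.trans h1)) (fun X Y a b c d e => hm X Y a b c d (e.trans h1))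
      (fun X Y a b c d e => hr X Y a b c d (e.trans h1))).step (hm _ _ (h.ri hA) h2 h.le h1 le_rfl)
        (hφ _ h2 (h.le.trans h1) le_rfl) (fun h' => h3 (hr _ _ (h.ri hA) h2 h.le h1 le_rfl h'))

omit s in
lemma essential_bound {G H V K A : Λ} (hG : TI m G) (hH : TI m H) (hV : PrI m V) (hHV : m H V ≤ G)
    (hA : RI m A) (hGA : G ≤ A) (hK : RI m K) (hAK : A ≤ K) (hAH : A ≤ H)
    (he : ∀ B, RI m B → A ≤ B → B ≤ H → ¬ B ≤ A → ¬ K ⊓ B ≤ A) :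
    ∃ E, TI m E ∧ ¬ E ≤ V ∧ m H E ≤ K := by
  obtain ⟨B, ⟨hB, hBH, E, hE, hEV, hBE⟩, hmax⟩ := q.r.acc {B | RI m B ∧ B ≤ H ∧ ∃ E, TI m E ∧ ¬ E ≤ V ∧ m B E ≤ K}
    ⟨A, hA, hAH, ⊤, q.TI_top, fun h => hV.2.1 (top_le_iff.1 h), hA.trans hAK⟩ (fun x hx => hx.1)
  by_cases hHB : H ≤ B
  · exact ⟨E, hE, hEV, (q.mono hHB le_rfl).trans hBE⟩
  exfalso
  obtain ⟨p, hp, hpH, hpB⟩ := q.pt_ex _ _ hHB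
  have hpV : m p V ≤ A := ((q.mono hpH le_rfl).trans hHV).trans hGA
  obtain ⟨T, hT, hTV, hTW⟩ := q.r.bdd V hV (res m p K) (q.RI_res hK) (q.le_res.2 (hpV.trans hAK)) (by
    intro D hD hVD hDV hW
    by_cases hpD : m p D ≤ A
    · have : D ≤ res m p K := q.le_res.2 (hpD.trans hAK)
      exact hDV ((le_inf this le_rfl).trans hW)
    · have hpDH : m p D ≤ H := (q.mono hpH le_rfl).trans (q.RI_mul hH.1 _)
      refine he (A ⊔ m p D) (q.RI_sup hA (q.RI_mul' _ hD)) le_sup_left (sup_le hAH hpDH)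
        (fun h => hpD (le_sup_right.trans h)) ?_
      rw [inf_comm, sup_inf_assoc_of_le _ hAK]
      refine sup_le le_rfl ?_
      obtain ⟨x, hx, hxe⟩ := q.r.ptr p hp (m p D ⊓ K) D inf_le_left
      have hxW : x ≤ res m p K := q.le_res.2 (hxe ▸ inf_le_right)
      rw [hxe]
      exact (q.mono le_rfl ((le_inf hxW hx).trans hW)).trans hpV)
  have hpT : m p T ≤ K := q.le_res.1 hTW
  have := hmax (B ⊔ m p ⊤) ⟨q.RI_sup hB (q.RI_mul' _ q.RI_top), sup_le hBH ((q.mono hpH le_rfl).trans hH.1),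
    m T E, q.TI_mul hT hE, fun h => (hV.2.2 T E hT hE h).elim hTV hEV, by
      refine (q.sup_mul _ _ _).trans (sup_le ?_ ?_)
      · rw [← q.assoc]; exact (q.mono (q.RI_mul hB _) le_rfl).trans hBE
      · rw [q.assoc]
        refine (q.mono le_rfl ((q.LI_mul (q.TI_mul hT hE) _).trans (q.RI_mul hT.1 _))).trans hpT⟩ le_sup_left
  exact hpB ((q.r.le_top p).trans (le_sup_right.trans this))

lemma Fn_prime {G H V : Λ} (hG : TI m G) (hH : TI m H) (hGH : G ≤ H) (hV : PrI m V) (hHV : m H V ≤ G)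
    (hE : ∀ E, TI m E → ¬ E ≤ V → rl m C H (G ⊔ m H E)) : Fn m C G H := by
  by_contra hcon
  obtain ⟨A, ⟨hA, hGA, hAH, hAF⟩, hmax⟩ := q.r.acc {A | RI m A ∧ G ≤ A ∧ A ≤ H ∧ ¬ Fn m C A H}
    ⟨G, hG.1, le_rfl, hGH, hcon⟩ (fun x hx => hx.1)
  have hnot : ¬ H ≤ A := fun h => hAF (q.Fn_of_rl s (q.rl_of_le s hH.1 h))
  have key : ∀ B, RI m B → A ≤ B → B ≤ H → ¬ B ≤ A → ¬ Fn m C A B := by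
    intro B hB hAB hBH hBA hf
    refine hAF (q.Fn_trans s hA hB hAB hBH hf ?_)
    by_contra h
    exact hBA (hmax B ⟨hB, hGA.trans hAB, hBH, h⟩ hAB)
  obtain ⟨K, ⟨hK, hAK, hKH, B, hB, hAB, hBH, hBA, hKB⟩, hKmax⟩ := q.r.acc
    {K | RI m K ∧ A ≤ K ∧ K ≤ H ∧ ∃ B, RI m B ∧ A ≤ B ∧ B ≤ H ∧ ¬ B ≤ A ∧ K ⊓ B ≤ A}
    ⟨A, hA, le_rfl, hAH, H, hH.1, hAH, le_rfl, hnot, inf_le_left⟩ (fun x hx => hx.1)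
  refine key B hB hAB hBH hBA ⟨1, ?_⟩
  suffices ∀ D n, HC m C A D n → D ≤ B → n = 0 ∨ (n = 1 ∧ ¬ D ≤ A) by
    intro n hn
    have := this _ _ hn le_rfl
    omega
  intro D n h
  induction h with
  | base => intro _; exact .inl rfl
  | mono h1 h2 h3 ih =>
    intro h4
    rcases ih (h2.trans h4) with h | ⟨h, h'⟩
    · exact .inl h
    · exact .inr ⟨h, fun h5 => h' (h2.trans h5)⟩
  | @step D D' n h1 h2 h3 h4 ih =>
    intro h5
    rcases ih (h2.trans h5) with h | ⟨h, h'⟩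
    · exact .inr ⟨by omega, fun h6 => h4 (q.rl_of_le s h3 (h6.trans h1.le))⟩
    · exfalso
      have hD := h1.ri hA
      obtain ⟨E, hE1, hE2, hE3⟩ := q.essential_bound hG hH hV hHV hA hGA (q.RI_sup hK hD)
        (hAK.trans le_sup_left) hAH (by
          intro B2 hB2 hAB2 hB2H hB2A hc
          have := hKmax (K ⊔ D) ⟨q.RI_sup hK hD, hAK.trans le_sup_left, sup_le hKH ((h2.trans h5).trans hBH),
            B2, hB2, hAB2, hB2H, hB2A, hc⟩ le_sup_left
          exact h' ((le_inf (le_sup_right.trans this) (h2.trans h5)).trans hKB))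
      obtain ⟨J, hJ, hHJ⟩ := hE E hE1 hE2
      have hHJ' : m H J ≤ D ⊔ K := by
        refine hHJ.trans (sup_le ((hGA.trans hAK).trans le_sup_right) ?_)
        rw [sup_comm]; exact hE3
      refine h4 ⟨J, hJ, ?_⟩
      have : m D' J ≤ (D ⊔ K) ⊓ B := le_inf ((q.mono (h5.trans hBH) le_rfl).trans hHJ')
        ((q.mono h5 le_rfl).trans (q.RI_mul hB _))
      rw [sup_inf_assoc_of_le _ (h2.trans h5)] at this
      exact this.trans (sup_le le_rfl (hKB.trans h1.le))

lemma Fn_of_DCb {G₀ A : Λ} (hG₀ : TI m G₀) (hA : TI m A) (hle : G₀ ≤ A) (hd : DCb m C G₀ A) : Fn m C G₀ A := by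
  by_contra hcon
  obtain ⟨G, ⟨hG, hG₀G, hGA, hGF⟩, hmax⟩ := q.r.acc {G | TI m G ∧ G₀ ≤ G ∧ G ≤ A ∧ ¬ Fn m C G A}
    ⟨G₀, hG₀, le_rfl, hle, hcon⟩ (fun x hx => hx.1.1)
  have hnot : ¬ A ≤ G := fun h => hGF (q.Fn_of_rl s (q.rl_of_le s hA.1 h))
  have key : ∀ B, TI m B → G ≤ B → B ≤ A → ¬ B ≤ G → ¬ Fn m C G B := by
    intro B hB hAB hBH hBA hf
    refine hGF (q.Fn_trans s hG.1 hB.1 hAB hBH hf ?_)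
    by_contra h
    exact hBA (hmax B ⟨hB, hG₀G.trans hAB, hBH, h⟩ hAB)
  obtain ⟨G1, hG1, hGG1, hG1A, hG1G, hG1m⟩ : ∃ G1, TI m G1 ∧ G ≤ G1 ∧ G1 ≤ A ∧ ¬ G1 ≤ G ∧
      ∀ H, TI m H → G ≤ H → H ≤ G1 → ¬ H ≤ G → rl m C G1 H := by
    by_contra hno
    push Not at hno
    let S := {G1 // TI m G1 ∧ G ≤ G1 ∧ G1 ≤ A ∧ ¬ G1 ≤ G}
    have hn : ∀ x : S, ∃ y : S, y.1 ≤ x.1 ∧ ¬ rl m C x.1 y.1 := by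
      rintro ⟨x, h1, h2, h3, h4⟩
      obtain ⟨H, a, b, c, d, e⟩ := hno x h1 h2 h3 h4
      exact ⟨⟨H, a, b, c.trans h3, d⟩, c, e⟩
    choose f hf1 hf2 using hn
    let x0 : S := ⟨A, hA, hGA, le_rfl, hnot⟩
    refine hd ⟨fun i => (f^[i] x0).1, fun i => ?_⟩
    obtain ⟨h1, h2, h3, h4⟩ := (f^[i] x0).2
    simp only [Function.iterate_succ', Function.comp]
    exact ⟨h1, hG₀G.trans h2, h3, hf1 _, hf2 _⟩
  obtain ⟨V, ⟨H, hH, hGH, hHG1, hHG, rfl⟩, hVmax⟩ := q.r.acc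
    {V | ∃ H, TI m H ∧ G ≤ H ∧ H ≤ G1 ∧ ¬ H ≤ G ∧ V = res m H G}
    ⟨_, G1, hG1, hGG1, le_rfl, hG1G, rfl⟩ (by rintro _ ⟨H, hH, -, -, -, rfl⟩; exact q.RI_res hG.1)
  have hHV := q.r.res_le H G
  have hV : PrI m (res m H G) := by
    refine ⟨q.TI_res hH.1 hG.1, ?_, ?_⟩
    · intro h
      rw [h] at hHV
      exact hHG ((q.r.le_top H).trans hHV)
    · intro A1 B1 hA1 hB1 hAB
      by_contra! hc
      obtain ⟨hc1, hc2⟩ := hc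
      rw [q.le_res] at hc1
      rw [q.le_res, ← q.assoc] at hAB
      have hHA : m H A1 ≤ H := q.RI_mul hH.1 _
      have := hVmax (res m (G ⊔ m H A1) G) ⟨_, q.TI_sup hG (q.TI_mul hH hA1), le_sup_left,
        (sup_le hGH hHA).trans hHG1, fun h => hc1 (le_sup_right.trans h), rfl⟩ (by
          rw [q.le_res]
          exact (q.mono (sup_le hGH hHA) le_rfl).trans hHV)
      refine hc2 (le_trans ?_ this)
      rw [q.le_res]
      exact (q.sup_mul _ _ _).trans (sup_le (q.RI_mul hG.1 _) hAB)
  refine key H hH hGH (hHG1.trans hG1A) hHG (q.Fn_prime s hG hH hGH hV hHV ?_)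
  intro E hE hEV
  rw [q.le_res] at hEV
  exact q.rl_mono (hG1m (G ⊔ m H E) (q.TI_sup hG (q.TI_mul hH hE)) le_sup_left
    ((sup_le hGH (q.RI_mul hH.1 _)).trans hHG1) (fun h => hEV (le_sup_right.trans h))) hHG1 le_rfl

omit s q in
lemma DCb_of_Fn {A' A : Λ} (hA : RI m A) (hf : Fn m C A' A) : DCb m C A' A := by
  rintro ⟨H, hH⟩
  have hc : ∀ n, HC m C (H n) (H 0) n := by
    intro n
    induction n with
    | zero => exact .base
    | succ n ih =>
      have h1 : HC m C (H (n+1)) (H n) 1 := HC.base.step (hH n).2.2.2.1 (hH n).1.1 (hH n).2.2.2.2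
      have := h1.trans ih
      rwa [add_comm 1 n] at this
  obtain ⟨N, hN⟩ := hf
  have h1 : HC m C A' (H (N+1)) 0 := HC.base.mono (hH _).2.1 (hH _).1.1
  have h2 := (h1.trans (hc (N+1))).mono (hH 0).2.2.1 hA
  have := hN _ h2
  omega

lemma Fn_res {D K p : Λ} (hp : p ∈ pt) (hD : RI m D) (hK : RI m K) (hpD : m p D ≤ K) (hf : Fn m C D ⊤) :
    Fn m C K (K ⊔ m p ⊤) := by
  obtain ⟨N, hf⟩ := hf
  refine ⟨N, fun n hn => hf n ?_⟩
  refine (HC_map (A' := D) (res m p) hK hn (fun X hX _ _ => q.RI_res hX) ?_ ?_ (q.le_res.2 hpD)).mono le_top q.RI_top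
  · intro X Y _ _ _ h _
    rw [q.le_res]
    exact (q.r.res_le p X).trans h
  · rintro X Y hX hY hKX hXY hYt ⟨J, hJ, h⟩
    refine ⟨J, hJ, ?_⟩
    obtain ⟨x, hx, hxe⟩ := q.r.ptr p hp (m p ⊤ ⊓ Y) ⊤ inf_le_left
    have hYe : Y ≤ K ⊔ m p x := by
      rw [← hxe, ← sup_inf_assoc_of_le _ (hKX.trans hXY)]
      exact le_inf hYt le_rfl
    have hx' : x ≤ res m p Y := q.le_res.2 (hxe ▸ inf_le_right)
    refine (q.mono hYe le_rfl).trans ((q.sup_mul _ _ _).trans (sup_le ((q.RI_mul hK _).trans hKX) ?_))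
    rw [q.assoc, ← q.le_res]
    exact (q.mono hx' le_rfl).trans h

lemma Fn_res' {G A p : Λ} (hp : p ∈ pt) (hA : RI m A) (hG : RI m G) (hGA : G ≤ A) (hpA : p ≤ A) (hf : Fn m C G A) :
    Fn m C (res m p G) ⊤ := by
  obtain ⟨N, hf⟩ := hf
  refine ⟨N, fun n hn => hf n ?_⟩
  refine (HC_map (A' := G) (fun X => G ⊔ m p X) (q.RI_res hG) hn (fun X hX _ _ => q.RI_sup hG (q.RI_mul' _ hX)) ?_ ?_ le_sup_left).mono
    (sup_le hGA ((q.mono hpA le_rfl).trans hA)) hA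
  · intro X Y _ _ _ h _
    exact sup_le_sup_left (q.mono le_rfl h) _
  · rintro X Y hX hY hKX hXY hYt ⟨J, hJ, h⟩
    refine ⟨J, hJ, ?_⟩
    have : m p (m Y J) ≤ m p X ⊔ G := by
      rw [← q.assoc, sup_comm]
      exact (q.mono le_sup_right le_rfl).trans h
    exact (q.r.ptb p hp _ _ _ this).trans (sup_le le_rfl hKX)

lemma Fn_inf {K L : Λ} (hK : RI m K) (hL : RI m L) (h1 : Fn m C K ⊤) (h2 : Fn m C L ⊤) : Fn m C (K ⊓ L) ⊤ := by
  refine q.Fn_trans s (q.RI_inf hK hL) hK inf_le_left le_top ?_ h1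
  obtain ⟨N, hf⟩ := h2
  refine ⟨N, fun n hn => hf n ?_⟩
  refine (HC_map (A' := L) (fun X => X ⊔ L) (q.RI_inf hK hL) hn (fun X hX _ _ => q.RI_sup hX hL) ?_ ?_ le_sup_right).mono le_top q.RI_top
  · intro X Y _ _ _ h _
    exact sup_le_sup_right h _
  · rintro X Y hX hY hKX hXY hYt ⟨J, hJ, h⟩
    refine ⟨J, hJ, ?_⟩
    have : m Y J ≤ (X ⊔ L) ⊓ K := le_inf ((q.mono le_sup_left le_rfl).trans h) ((q.mono hYt le_rfl).trans (q.RI_mul hK _))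
    rw [sup_inf_assoc_of_le _ (hXY.trans hYt), inf_comm] at this
    exact this.trans (sup_le le_rfl hKX)

lemma DCb_mul {A D : Λ} (hA : TI m A) (hD : TI m D) (hd : DCb m C D ⊤) : DCb m C (m A D) A := by
  have hf := q.Fn_of_DCb s hD q.TI_top le_top hd
  have hAD : RI m (m A D) := q.RI_mul' _ hD.1
  refine DCb_of_Fn hA.1 ?_
  obtain ⟨K, ⟨hK, h1, h2, h3⟩, hmax⟩ := q.r.acc {K | RI m K ∧ m A D ≤ K ∧ K ≤ A ∧ Fn m C (m A D) K}
    ⟨m A D, hAD, le_rfl, q.RI_mul hA.1 _, q.Fn_of_rl s (q.rl_of_le s hAD le_rfl)⟩ (fun x hx => hx.1)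
  by_cases hAK : A ≤ K
  · rwa [le_antisymm h2 hAK] at h3
  exfalso
  obtain ⟨p, hp, hpA, hpK⟩ := q.pt_ex _ _ hAK
  have hR : RI m (K ⊔ m p ⊤) := q.RI_sup hK (q.RI_mul' _ q.RI_top)
  have := hmax (K ⊔ m p ⊤) ⟨hR, h1.trans le_sup_left,
    sup_le h2 ((q.mono hpA le_rfl).trans hA.1), q.Fn_trans s hAD hK h1 le_sup_left h3
      (q.Fn_res s hp hD.1 hK ((q.mono hpA le_rfl).trans h1) hf)⟩ le_sup_left
  exact hpK ((q.r.le_top p).trans (le_sup_right.trans this))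

lemma DCb_res {A G : Λ} (hA : TI m A) (hG : TI m G) (hGA : G ≤ A) (hd : DCb m C G A) :
    DCb m C (res m A G) ⊤ := by
  have hf := q.Fn_of_DCb s hG hA hGA hd
  refine DCb_of_Fn q.RI_top ?_
  obtain ⟨K, ⟨hK, h1, h2, h3⟩, hmax⟩ := q.l.acc {K | m ⊤ K ≤ K ∧ G ≤ K ∧ K ≤ A ∧ Fn m C (res m K G) ⊤}
    ⟨G, hG.2, le_rfl, hGA, q.Fn_of_rl s (q.rl_of_le s q.RI_top (q.le_res.2 hG.1))⟩ (fun x hx => hx.1)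
  by_cases hAK : A ≤ K
  · rwa [le_antisymm h2 hAK] at h3
  exfalso
  obtain ⟨p, hp, hpA, hpK⟩ := q.pt_ex _ _ hAK
  have := hmax (K ⊔ m ⊤ p) ⟨(q.mul_sup _ _ _).trans (sup_le_sup hK (by rw [← q.assoc]; exact q.mono le_top le_rfl)),
    h1.trans le_sup_left, sup_le h2 ((q.mono le_rfl hpA).trans hA.2), by
      refine Fn_right (q.RI_res hG.1) ?_ (q.Fn_inf s (q.RI_res hG.1) (q.RI_res hG.1) h3
        (q.Fn_res' s hp hA.1 hG.1 hGA hpA hf))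
      rw [q.le_res]
      refine (q.sup_mul _ _ _).trans (sup_le ?_ ?_)
      · exact (q.mono le_rfl inf_le_left).trans (q.r.res_le _ _)
      · rw [q.assoc]
        exact (q.mono le_rfl ((q.mono le_rfl inf_le_right).trans (q.r.res_le _ _))).trans hG.2⟩ le_sup_left
  exact hpK ((q.le_top_l p).trans (le_sup_right.trans this))

lemma DCb_symr {A D : Λ} (hA : TI m A) (hD : TI m D) (hd : DCb m C D ⊤) :
    ∃ D', TI m D' ∧ DCb m C D' ⊤ ∧ m A D' ≤ m D A := by
  have h1 : DCb m C (m D A) A :=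
    DCb_flip q.flip s.flip (q.flip.DCb_mul s.flip hA.fl hD.fl (DCb_flip q s hd))
  exact ⟨res m A (m D A), q.TI_res hA.1 (q.TI_mul hD hA).1,
    q.DCb_res s hA (q.TI_mul hD hA) (q.LI_mul hA _) h1, q.r.res_le _ _⟩

lemma SC_DCb : SC m {D | TI m D ∧ DCb m C D ⊤} where
  ideal J h := h.1
  top := ⟨q.TI_top, DCb_of_Fn q.RI_top (q.Fn_of_rl s (q.rl_of_le s q.RI_top le_rfl))⟩
  mul := by
    rintro J ⟨hJ, hJd⟩ K ⟨hK, hKd⟩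
    have hJK := q.TI_mul hJ hK
    refine ⟨hJK, DCb_of_Fn q.RI_top ?_⟩
    have hle : m J K ≤ J := q.RI_mul hJ.1 _
    exact q.Fn_trans s hJK.1 hJ.1 hle le_top (q.Fn_of_DCb s hJK hJ hle (q.DCb_mul s hJ hK hKd))
      (q.Fn_of_DCb s hJ q.TI_top le_top hJd)
  up := by
    rintro J ⟨hJ, hJd⟩ K hK hJK
    refine ⟨hK, fun ⟨H, hH⟩ => hJd ⟨H, fun i => ?_⟩⟩
    obtain ⟨h1, h2, h3⟩ := hH i
    exact ⟨h1, hJK.trans h2, h3⟩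
  symr := by
    rintro A hA D ⟨hD, hd⟩
    obtain ⟨D', h1, h2, h3⟩ := q.DCb_symr s hA hD hd
    exact ⟨D', ⟨h1, h2⟩, h3⟩
  syml := by
    rintro A hA D ⟨hD, hd⟩
    obtain ⟨D', h1, h2, h3⟩ := q.flip.DCb_symr s.flip hA.fl hD.fl (DCb_flip q s hd)
    exact ⟨D', ⟨h1.unfl, DCb_flip q.flip s.flip h2⟩, h3⟩

omit s in
lemma exists_SC {I : Λ} (hI : TI m I) (hne : I ≠ ⊤) : ∃ C, SC m C ∧ I ∉ C ∧ Fn m C I ⊤ := by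
  have h0 : ({⊤} : Set Λ) ∈ {C | SC m C ∧ I ∉ C} := by
    refine ⟨⟨?_, rfl, ?_, ?_, ?_, ?_⟩, fun h => hne h⟩
    · rintro J rfl; exact q.TI_top
    · rintro J rfl K rfl; exact top_le_iff.1 (q.r.le_top _)
    · rintro J rfl K hK h; exact top_le_iff.1 h
    · rintro A hA J rfl; exact ⟨⊤, rfl, hA.1.trans (q.le_top_l A)⟩
    · rintro A hA J rfl; exact ⟨⊤, rfl, hA.2.trans (q.r.le_top A)⟩
  obtain ⟨C, -, hCm⟩ := zorn_subset_nonempty {C | SC m C ∧ I ∉ C} (by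
    intro c hc hch ⟨C0, hC0⟩
    refine ⟨⋃₀ c, ⟨⟨?_, ?_, ?_, ?_, ?_, ?_⟩, ?_⟩, fun s hs => Set.subset_sUnion_of_mem hs⟩
    · rintro J ⟨S, hS, hJ⟩; exact (hc hS).1.ideal J hJ
    · exact ⟨C0, hC0, (hc hC0).1.top⟩
    · rintro J ⟨S, hS, hJ⟩ K ⟨T, hT, hK⟩
      rcases hch.total hS hT with h | h
      · exact ⟨T, hT, (hc hT).1.mul J (h hJ) K hK⟩
      · exact ⟨S, hS, (hc hS).1.mul J hJ K (h hK)⟩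
    · rintro J ⟨S, hS, hJ⟩ K hK h; exact ⟨S, hS, (hc hS).1.up J hJ K hK h⟩
    · rintro A hA J ⟨S, hS, hJ⟩
      obtain ⟨J', h1, h2⟩ := (hc hS).1.symr A hA J hJ
      exact ⟨J', ⟨S, hS, h1⟩, h2⟩
    · rintro A hA J ⟨S, hS, hJ⟩
      obtain ⟨J', h1, h2⟩ := (hc hS).1.syml A hA J hJ
      exact ⟨J', ⟨S, hS, h1⟩, h2⟩
    · rintro ⟨S, hS, hJ⟩; exact (hc hS).2 hJ) _ h0
  obtain ⟨⟨s, hIC⟩, hmax⟩ := hCm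
  refine ⟨C, s, hIC, ?_⟩
  obtain ⟨X, ⟨hX, hXC⟩, hXm⟩ := q.r.acc {X | TI m X ∧ X ∉ C} ⟨I, hI, hIC⟩ (fun x hx => hx.1.1)
  have hbig : ∀ E, TI m E → ¬ E ≤ X → X ⊔ E ∈ C := by
    intro E hE hEX
    by_contra h
    exact hEX (le_sup_right.trans (hXm (X ⊔ E) ⟨q.TI_sup hX hE, h⟩ le_sup_left))
  have hXp : PrI m X := by
    refine ⟨hX, fun h => hXC (h ▸ s.top), ?_⟩
    intro A B hA hB hAB
    by_contra! hc
    refine hXC (s.up _ (s.mul _ (hbig A hA hc.1) _ (hbig B hB hc.2)) X hX ?_)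
    refine (q.sup_mul _ _ _).trans (sup_le (q.RI_mul hX.1 _) ((q.mul_sup _ _ _).trans (sup_le (q.LI_mul hX _) hAB)))
  have hFX : Fn m C X ⊤ := by
    refine q.Fn_prime s hX q.TI_top le_top hXp hX.2 ?_
    intro E hE hEX
    refine ⟨X ⊔ E, hbig E hE hEX, ?_⟩
    exact (q.mul_sup _ _ _).trans (sup_le_sup hX.2 le_rfl)
  by_contra hcon
  have hle : C ⊆ {D | TI m D ∧ DCb m C D ⊤} := by
    intro J hJ
    have hJ' := s.ideal J hJ
    exact ⟨hJ', DCb_of_Fn q.RI_top (q.Fn_of_rl s ⟨J, hJ, hJ'.2⟩)⟩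
  have := hmax (y := {D | TI m D ∧ DCb m C D ⊤}) ⟨q.SC_DCb s, fun h => hcon (q.Fn_of_DCb s hI q.TI_top le_top h.2)⟩ hle
  exact hXC (this ⟨hX, DCb_of_Fn q.RI_top hFX⟩)

omit s in
lemma foldr_append_le (l1 l2 : List Λ) :
    (l1 ++ l2).foldr m ⊤ ≤ m (l1.foldr m ⊤) (l2.foldr m ⊤) := by
  induction l1 with
  | nil => exact q.le_top_l _
  | cons a l ih =>
    simp only [List.cons_append, List.foldr_cons]
    rw [q.assoc]
    exact q.mono le_rfl ih

omit s in
lemma TI_foldr (l : List Λ) (h : ∀ P ∈ l, TI m P) : TI m (l.foldr m ⊤) := by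
  induction l with
  | nil => exact q.TI_top
  | cons a l ih =>
    exact q.TI_mul (h a (by simp)) (ih fun P hP => h P (by simp [hP]))

omit s in
lemma foldr_prime {Q : Λ} (hQ : PrI m Q) (l : List Λ) (h : ∀ P ∈ l, TI m P) (hl : l.foldr m ⊤ ≤ Q) :
    ∃ P ∈ l, P ≤ Q := by
  induction l with
  | nil => exact absurd (top_le_iff.1 hl) hQ.2.1
  | cons a l ih =>
    have h' : ∀ P ∈ l, TI m P := fun P hP => h P (by simp [hP])
    rcases hQ.2.2 a _ (h a (by simp)) (q.TI_foldr l h') hl with h1 | h1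
    · exact ⟨a, by simp, h1⟩
    · obtain ⟨P, hP, h2⟩ := ih h' h1
      exact ⟨P, by simp [hP], h2⟩

omit s in
lemma exists_primes (I : Λ) (hI : TI m I) :
    ∃ l : List Λ, (∀ P ∈ l, PrI m P ∧ I ≤ P) ∧ l.foldr m ⊤ ≤ I := by
  by_contra hcon
  obtain ⟨X, ⟨hX, hXn⟩, hmax⟩ := q.r.acc {X | TI m X ∧ ¬ ∃ l : List Λ, (∀ P ∈ l, PrI m P ∧ X ≤ P) ∧ l.foldr m ⊤ ≤ X}
    ⟨I, hI, hcon⟩ (fun x hx => hx.1.1)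
  have hbig : ∀ E, TI m E → ¬ E ≤ X → ∃ l : List Λ, (∀ P ∈ l, PrI m P ∧ X ⊔ E ≤ P) ∧ l.foldr m ⊤ ≤ X ⊔ E := by
    intro E hE hEX
    by_contra h
    exact hEX (le_sup_right.trans (hmax (X ⊔ E) ⟨q.TI_sup hX hE, h⟩ le_sup_left))
  refine hXn ⟨[X], ?_, hX.1⟩
  intro P hP
  rw [List.mem_singleton] at hP
  subst hP
  refine ⟨⟨hX, ?_, ?_⟩, le_rfl⟩
  · intro h; exact hXn ⟨[], by simp, by simp [h]⟩
  · intro A B hA hB hAB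
    by_contra! hc
    obtain ⟨l1, h1, h1'⟩ := hbig A hA hc.1
    obtain ⟨l2, h2, h2'⟩ := hbig B hB hc.2
    refine hXn ⟨l1 ++ l2, ?_, ?_⟩
    · intro Q hQ
      rcases List.mem_append.1 hQ with h | h
      · exact ⟨(h1 Q h).1, le_sup_left.trans (h1 Q h).2⟩
      · exact ⟨(h2 Q h).1, le_sup_left.trans (h2 Q h).2⟩
    · refine (q.foldr_append_le l1 l2).trans ((q.mono h1' h2').trans ?_)
      exact (q.sup_mul _ _ _).trans (sup_le (q.RI_mul hX.1 _) ((q.mul_sup _ _ _).trans (sup_le (q.LI_mul hX _) hAB)))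

def _root_.MinP (m : Λ → Λ → Λ) (I P : Λ) : Prop :=
  PrI m P ∧ I ≤ P ∧ ∀ Q, PrI m Q → I ≤ Q → Q ≤ P → Q = P

omit s in
lemma exists_minprime {I Q : Λ} (hI : TI m I) (hQ : PrI m Q) (hIQ : I ≤ Q) : ∃ P, MinP m I P ∧ P ≤ Q := by
  obtain ⟨l, hl, hl'⟩ := q.exists_primes I hI
  have hfin : {P | P ∈ l ∧ P ≤ Q}.Finite := (List.finite_toSet l).subset (fun P hP => hP.1)
  obtain ⟨P0, hP0, hP0Q⟩ := q.foldr_prime hQ l (fun P hP => (hl P hP).1.1) (hl'.trans hIQ)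
  obtain ⟨P, hP⟩ := hfin.exists_minimal ⟨P0, hP0, hP0Q⟩
  refine ⟨P, ⟨(hl P hP.1.1).1, (hl P hP.1.1).2, ?_⟩, hP.1.2⟩
  intro Q' hQ' hIQ' hQP
  obtain ⟨P1, hP1, hP1Q⟩ := q.foldr_prime hQ' l (fun P hP => (hl P hP).1.1) (hl'.trans hIQ')
  have := hP.2 ⟨hP1, (hP1Q.trans hQP).trans hP.1.2⟩ (hP1Q.trans hQP)
  exact le_antisymm hQP (this.trans hP1Q)

omit s in
lemma foldr_map_le (f : Λ → Λ) (l : List Λ) (h : ∀ P ∈ l, f P ≤ P) : (l.map f).foldr m ⊤ ≤ l.foldr m ⊤ := by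
  induction l with
  | nil => exact le_rfl
  | cons a l ih =>
    exact q.mono (h a (by simp)) (ih fun P hP => h P (by simp [hP]))

omit s in
lemma exists_minprimes (I : Λ) (hI : TI m I) :
    ∃ l : List Λ, (∀ P ∈ l, MinP m I P) ∧ l.foldr m ⊤ ≤ I := by
  obtain ⟨l, hl, hl'⟩ := q.exists_primes I hI
  have : ∀ P, ∃ P', P ∈ l → MinP m I P' ∧ P' ≤ P := by
    intro P
    by_cases hP : P ∈ l
    · obtain ⟨P', h⟩ := q.exists_minprime hI (hl P hP).1 (hl P hP).2
      exact ⟨P', fun _ => h⟩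
    · exact ⟨P, fun h => absurd h hP⟩
  choose f hf using this
  refine ⟨l.map f, ?_, (q.foldr_map_le f l fun P hP => (hf P hP).2).trans hl'⟩
  intro P hP
  obtain ⟨P', h, rfl⟩ := List.mem_map.1 hP
  exact (hf P' h).1

omit s in
lemma HC_shift {β A B : Λ} {n} (hβ : β ∈ pt) (hreg : ∀ Z X, m β Z ≤ m β X → Z ≤ X) (hA : RI m A) (hB : RI m B) :
    HC m C (m β A) (m β B) n ↔ HC m C A B n := by
  constructor
  · intro h
    refine (HC_map (A' := A) (res m β) (q.RI_mul' _ hA) h (fun X hX _ _ => q.RI_res hX) ?_ ?_ (q.le_res.2 le_rfl)).mono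
      (hreg _ _ (q.r.res_le _ _)) hB
    · intro X Y _ _ _ h _
      rw [q.le_res]
      exact (q.r.res_le β X).trans h
    · rintro X Y hX hY hKX hXY hYt ⟨J, hJ, h⟩
      refine ⟨J, hJ, ?_⟩
      obtain ⟨y, hy, rfl⟩ := q.r.ptr β hβ Y B hYt
      rw [q.assoc, ← q.le_res]
      exact (q.mono (q.le_res.2 le_rfl) le_rfl).trans h
  · intro h
    refine HC_map (m β) hA h (fun X hX _ _ => q.RI_mul' _ hX) ?_ ?_ le_rfl
    · intro X Y _ _ _ h _
      exact q.mono le_rfl h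
    · rintro X Y hX hY hKX hXY hYt ⟨J, hJ, h⟩
      refine ⟨J, hJ, hreg _ _ ?_⟩
      rwa [← q.assoc]

omit s in
lemma HC_iso {K L : Λ} {n} (hK : RI m K) (hL : RI m L) : HC m C (K ⊓ L) K n ↔ HC m C L (K ⊔ L) n := by
  constructor
  · intro hn
    refine (HC_map (A' := L) (fun X => X ⊔ L) (q.RI_inf hK hL) hn (fun X hX _ _ => q.RI_sup hX hL) ?_ ?_ le_sup_right)
    · intro X Y _ _ _ h _
      exact sup_le_sup_right h _
    · rintro X Y hX hY hKX hXY hYt ⟨J, hJ, h⟩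
      refine ⟨J, hJ, ?_⟩
      have : m Y J ≤ (X ⊔ L) ⊓ K := le_inf ((q.mono le_sup_left le_rfl).trans h) ((q.mono hYt le_rfl).trans (q.RI_mul hK _))
      rw [sup_inf_assoc_of_le _ (hXY.trans hYt), inf_comm] at this
      exact this.trans (sup_le le_rfl hKX)
  · intro hn
    refine (HC_map (A' := K ⊓ L) (fun X => K ⊓ X) hL hn (fun X hX _ _ => q.RI_inf hK hX) ?_ ?_ le_rfl).mono inf_le_left hK
    · intro X Y _ _ _ h _
      exact inf_le_inf_left _ h
    · rintro X Y hX hY hKX hXY hYt ⟨J, hJ, h⟩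
      refine ⟨J, hJ, ?_⟩
      have hYe : Y ≤ L ⊔ K ⊓ Y := by
        rw [← sup_inf_assoc_of_le _ (hKX.trans hXY), sup_comm]
        exact le_inf hYt le_rfl
      refine (q.mono hYe le_rfl).trans ((q.sup_mul _ _ _).trans (sup_le ((q.RI_mul hL _).trans hKX) ?_))
      exact h.trans inf_le_right

omit s q in
lemma exists_len {A B : Λ} (hB : RI m B) (hAB : A ≤ B) (h : Fn m C A B) : ∃ n, IsLen m C A B n := by
  classical
  obtain ⟨N, hN⟩ := h
  have h0 : HC m C A B 0 := HC.base.mono hAB hB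
  refine ⟨Nat.findGreatest (HC m C A B) N, Nat.findGreatest_spec (P := HC m C A B) (Nat.zero_le N) h0, fun k hk => ?_⟩
  exact Nat.le_findGreatest (hN k hk) hk

omit s q in
lemma len_unique {A B : Λ} {n k} (h : IsLen m C A B n) (h' : IsLen m C A B k) : n = k :=
  le_antisymm (h'.2 _ h.1) (h.2 _ h'.1)

lemma len_add {A B D : Λ} {n k} (hA : RI m A) (hB : RI m B) (hAB : A ≤ B) (hBD : B ≤ D)
    (h : IsLen m C A B n) (h' : IsLen m C B D k) : IsLen m C A D (n + k) := by
  refine ⟨h.1.trans h'.1, fun j hj => ?_⟩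
  obtain ⟨p, r, h1, h2, h3⟩ := q.HC_split' s hA hB hAB hBD hj
  have := h.2 _ h2
  have := h'.2 _ h3
  omega

lemma len_key {β γ : Λ} (hβ : β ∈ pt) (hβr : ∀ Z X, m β Z ≤ m β X → Z ≤ X)
    (hγ : γ ∈ pt) (hγr : ∀ Z X, m γ Z ≤ m γ X → Z ≤ X) (hcom : ∀ x, m γ x = m x γ)
    (hF : Fn m C (m β ⊤) ⊤) :
    ∃ d, IsLen m C (m β ⊤ ⊔ m γ ⊤) ⊤ d ∧ IsLen m C (m γ ⊤) (res m β (m γ ⊤)) d := by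
  have hT : RI m (⊤ : Λ) := q.RI_top
  have hb : RI m (m β ⊤) := q.RI_mul' _ hT
  have hg : RI m (m γ ⊤) := q.RI_mul' _ hT
  have hbg : RI m (m β ⊤ ⊔ m γ ⊤) := q.RI_sup hb hg
  have hE : RI m (m γ ⊤ ⊓ m β ⊤) := q.RI_inf hg hb
  have hsw : m γ (m β ⊤) = m β (m γ ⊤) := by
    rw [← q.assoc, hcom β, q.assoc]
  have hEe : m γ ⊤ ⊓ m β ⊤ = m β (res m β (m γ ⊤)) := by
    refine le_antisymm ?_ (le_inf (q.r.res_le _ _) (q.mono le_rfl le_top))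
    obtain ⟨x, hx, hxe⟩ := q.r.ptr β hβ (m γ ⊤ ⊓ m β ⊤) ⊤ inf_le_right
    rw [hxe]
    exact q.mono le_rfl (q.le_res.2 (hxe ▸ inf_le_left))
  have hlow : m γ (m β ⊤) ≤ m γ ⊤ ⊓ m β ⊤ :=
    le_inf (q.mono le_rfl le_top) (hsw ▸ q.mono le_rfl le_top)
  obtain ⟨u, hu⟩ := exists_len hbg le_sup_left (Fn_left hT le_top hF)
  obtain ⟨d, hd⟩ := exists_len hT le_top (Fn_right hbg le_sup_left hF)
  have h1 := q.len_add s hb hbg le_sup_left le_top hu hd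
  have h2 : IsLen m C (m γ (m β ⊤)) (m γ ⊤) (u + d) :=
    ⟨(q.HC_shift hγ hγr hb hT).2 h1.1, fun k hk => h1.2 k ((q.HC_shift hγ hγr hb hT).1 hk)⟩
  have hF2 : Fn m C (m γ (m β ⊤)) (m γ ⊤) := ⟨_, h2.2⟩
  have hu' : IsLen m C (m γ ⊤ ⊓ m β ⊤) (m γ ⊤) u := by
    rw [sup_comm] at hu
    exact ⟨(q.HC_iso hg hb).2 hu.1, fun k hk => hu.2 k ((q.HC_iso hg hb).1 hk)⟩
  obtain ⟨w, hw⟩ := exists_len hE hlow (Fn_left hg inf_le_left hF2)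
  have h3 := q.len_add s (q.RI_mul' _ hb) hE hlow inf_le_left hw hu'
  have h4 := len_unique h2 h3
  have h5 : w = d := by omega
  subst h5
  refine ⟨w, hd, ?_⟩
  rw [hsw, hEe] at hw
  have hr : RI m (res m β (m γ ⊤)) := q.RI_res hg
  exact ⟨(q.HC_shift hβ hβr hg hr).1 hw.1, fun k hk => hw.2 k ((q.HC_shift hβ hβr hg hr).2 hk)⟩

omit s in
theorem main_abs (e : ℕ → Λ) (hept : ∀ n, e n ∈ pt) (hereg : ∀ n Z X, m (e n) Z ≤ m (e n) X → Z ≤ X)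
    (he0 : m (e 0) ⊤ = ⊤) (hes : ∀ n x, m (e (n+1)) x = m (e 1) (m (e n) x))
    (hes' : ∀ n x, m (e (n+1)) x = m (e n) (m (e 1) x))
    (I : Λ) (hI : TI m I) (hIa : I ≤ m (e 1) ⊤) (hImax : ∀ T, TI m T → T ≤ m (e 1) ⊤ → T ≤ I)
    (hItop : I ≠ ⊤) (hI0 : I ≠ ⊥) (hbot : PrI m (⊥ : Λ))
    (hcen : ∀ T, TI m T → T ≠ ⊥ → ∃ γ ∈ pt, γ ≤ T ∧ (∀ x, m γ x = m x γ) ∧ ∀ Z X, m γ Z ≤ m γ X → Z ≤ X) :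
    ∃ P, PrI m P ∧ I ≤ P ∧ P ≠ ⊥ ∧ ∀ Q, PrI m Q → Q ≤ P → Q ≠ ⊥ → Q = P := by
  by_contra hcon
  have hno : ∀ P, ∃ Q, MinP m I P → PrI m Q ∧ Q ≤ P ∧ Q ≠ ⊥ ∧ Q ≠ P := by
    intro P
    by_cases hP : MinP m I P
    · by_contra hc
      refine hcon ⟨P, hP.1, hP.2.1, ?_, ?_⟩
      · rintro rfl; exact hI0 (le_bot_iff.1 hP.2.1)
      · intro Q h1 h2 h3
        by_contra h4
        exact hc ⟨Q, fun _ => ⟨h1, h2, h3, h4⟩⟩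
    · exact ⟨P, fun h => absurd h hP⟩
  choose f hf using hno
  obtain ⟨l, hl, hlI⟩ := q.exists_minprimes I hI
  have hfT : ∀ Q ∈ l.map f, TI m Q := by
    intro Q hQ
    obtain ⟨P, hP, rfl⟩ := List.mem_map.1 hQ
    exact (hf P (hl P hP)).1.1
  have hlT : ∀ Q ∈ l, TI m Q := fun Q hQ => (hl Q hQ).1.1
  obtain ⟨γ, hγ, hγT, hcom, hγr⟩ := hcen ((l.map f).foldr m ⊤) (q.TI_foldr _ hfT) (by
    intro h
    obtain ⟨Q, hQ, hQ0⟩ := q.foldr_prime hbot _ hfT h.le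
    obtain ⟨P, hP, rfl⟩ := List.mem_map.1 hQ
    exact (hf P (hl P hP)).2.2.1 (le_bot_iff.1 hQ0))
  have hfold : ∀ l' : List Λ, (∀ Q ∈ l', TI m Q) → ∀ Q ∈ l', l'.foldr m ⊤ ≤ Q := by
    intro l'
    induction l' with
    | nil => simp
    | cons a l' ih =>
      intro h Q hQ
      have h' : ∀ Q ∈ l', TI m Q := fun Q hQ => h Q (by simp [hQ])
      rcases List.mem_cons.1 hQ with rfl | hQ
      · exact q.RI_mul (h Q (by simp)).1 _
      · exact (q.LI_mul (q.TI_foldr l' h') a).trans (ih h' Q hQ)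
  have hγQ : ∀ P ∈ l, γ ≤ f P := fun P hP => hγT.trans (hfold _ hfT _ (List.mem_map_of_mem hP))
  have hγP : ∀ P ∈ l, γ ≤ P := fun P hP => (hγQ P hP).trans (hf P (hl P hP)).2.1
  have hg : TI m (m γ ⊤) := by
    refine ⟨q.RI_mul' _ q.RI_top, ?_⟩
    rw [← q.assoc, ← hcom, q.assoc]
    exact q.mono le_rfl le_top
  have hgle : ∀ X, TI m X → γ ≤ X → m γ ⊤ ≤ X := fun X hX h => (q.mono h le_rfl).trans hX.1
  obtain ⟨l', hl', hl'g⟩ := q.exists_minprimes (m γ ⊤) hg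
  have hl'I : ∀ Q ∈ l', ¬ I ≤ Q := by
    intro Q hQ hIQ
    obtain ⟨P, hP, hPQ⟩ := q.foldr_prime (hl' Q hQ).1 l hlT (hlI.trans hIQ)
    obtain ⟨h1, h2, h3, h4⟩ := hf P (hl P hP)
    have := (hl' Q hQ).2.2 (f P) h1 (hgle _ h1.1 (hγQ P hP)) (h2.trans hPQ)
    exact h4 (le_antisymm h2 (this ▸ hPQ))
  obtain ⟨C, s, hIC, hFI⟩ := q.exists_SC hI hItop
  have ha : RI m (m (e 1) ⊤) := q.RI_mul' _ q.RI_top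
  have hen : ∀ n, RI m (m (e n) ⊤) := fun n => q.RI_mul' _ q.RI_top
  -- finite length
  have hF1 : Fn m C (m (e 1) ⊤) ⊤ := Fn_right ha hIa hFI
  have hle : ∀ n, m (e (n+1)) ⊤ ≤ m (e n) ⊤ := fun n => by rw [hes']; exact q.mono le_rfl le_top
  have hF : ∀ n, Fn m C (m (e n) ⊤) ⊤ := by
    intro n
    induction n with
    | zero => rw [he0]; exact q.Fn_of_rl s (q.rl_of_le s q.RI_top le_rfl)
    | succ n ih =>
      refine q.Fn_trans s (hen _) (hen n) (hle n) le_top ?_ ih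
      rw [hes']
      obtain ⟨N, hN⟩ := hF1
      exact ⟨N, fun k hk => hN k ((q.HC_shift (hept n) (hereg n) ha q.RI_top).1 hk)⟩
  -- stabilization
  have hgα : ∀ x, m γ (m (e 1) x) = m (e 1) (m γ x) := by
    intro x; rw [← q.assoc, hcom (e 1), q.assoc]
  have hgen : ∀ n x, m γ (m (e n) x) = m (e n) (m γ x) := by
    intro n x; rw [← q.assoc, hcom (e n), q.assoc]
  obtain ⟨k, hk⟩ : ∃ k, res m (e (k+1)) (m γ ⊤) = res m (e k) (m γ ⊤) := by
    obtain ⟨_, ⟨k, rfl⟩, hmax⟩ := q.r.acc (Set.range fun k => res m (e k) (m γ ⊤)) ⟨_, 0, rfl⟩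
      (by rintro _ ⟨k, rfl⟩; exact q.RI_res hg.1)
    have hle' : res m (e k) (m γ ⊤) ≤ res m (e (k+1)) (m γ ⊤) := by
      rw [q.le_res, hes]
      refine (q.mono le_rfl (q.r.res_le _ _)).trans ?_
      rw [← hgα]
      exact q.mono le_rfl le_top
    exact ⟨k, le_antisymm (hmax _ ⟨k+1, rfl⟩ hle') hle'⟩
  obtain ⟨d, hd, hd'⟩ := q.len_key s (hept k) (hereg k) hγ hγr hcom (hF k)
  obtain ⟨d1, hd1, hd1'⟩ := q.len_key s (hept (k+1)) (hereg (k+1)) hγ hγr hcom (hF (k+1))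
  rw [hk] at hd1'
  obtain rfl := len_unique hd' hd1'
  have hR : ∀ n, RI m (m (e n) ⊤ ⊔ m γ ⊤) := fun n => q.RI_sup (hen n) hg.1
  have hle2 : m (e (k+1)) ⊤ ⊔ m γ ⊤ ≤ m (e k) ⊤ ⊔ m γ ⊤ := sup_le_sup_right (hle k) _
  have hrl : rl m C (m (e k) ⊤ ⊔ m γ ⊤) (m (e (k+1)) ⊤ ⊔ m γ ⊤) := by
    by_contra h
    have h1 : HC m C (m (e (k+1)) ⊤ ⊔ m γ ⊤) (m (e k) ⊤ ⊔ m γ ⊤) 1 := HC.base.step hle2 (hR k) h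
    have := hd1.2 _ (h1.trans hd.1)
    omega
  obtain ⟨J, hJ, hJle⟩ := hrl
  have hJY : J ≤ m (e 1) ⊤ ⊔ res m (e k) (m γ ⊤) := by
    refine q.r.ptb (e k) (hept k) _ _ _ ?_
    rw [← hes']
    exact (q.mono ((q.r.le_top _).trans le_sup_left) le_rfl).trans hJle
  -- Y ≤ Q
  obtain ⟨Ik, hIk, hIkle, hIkp⟩ : ∃ Ik, TI m Ik ∧ Ik ≤ m (e k) ⊤ ∧ ∀ Q, PrI m Q → Ik ≤ Q → I ≤ Q := by
    clear hJY hJ hJle hle2 hd hd' hd1 hd1' hk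
    induction k with
    | zero => exact ⟨⊤, q.TI_top, he0.ge, fun Q hQ h => absurd (top_le_iff.1 h) hQ.2.1⟩
    | succ n ih =>
      obtain ⟨K, h1, h2, h3⟩ := ih
      refine ⟨m I K, q.TI_mul hI h1, ?_, ?_⟩
      · rw [hes]
        refine (q.mono hIa le_rfl).trans ?_
        rw [q.assoc]
        exact q.mono le_rfl (h1.2.trans h2)
      · intro Q hQ h
        exact (hQ.2.2 I K hI h1 h).elim id (h3 Q hQ)
  have hYI : m (res m (e k) (m γ ⊤)) Ik ≤ m γ ⊤ := by
    refine hereg k _ _ ?_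
    obtain ⟨x, -, hx⟩ := q.r.ptr γ hγ _ _ (q.r.res_le (e k) (m γ ⊤))
    rw [← q.assoc, hx, q.assoc, ← hgen]
    exact q.mono le_rfl ((q.LI_mul hIk x).trans hIkle)
  have hYQ : ∀ Q ∈ l', res m (e k) (m γ ⊤) ≤ Q := by
    intro Q hQ
    have hQp := (hl' Q hQ).1
    have hYr : RI m (res m (e k) (m γ ⊤)) := q.RI_res hg.1
    rcases hQp.2.2 (m ⊤ (res m (e k) (m γ ⊤))) Ik ⟨q.RI_mul' _ hYr, by rw [← q.assoc]; exact q.mono le_top le_rfl⟩ hIk (by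
      rw [q.assoc]
      exact ((q.mono le_rfl hYI).trans hg.2).trans (hl' Q hQ).2.1) with h | h
    · exact (q.le_top_l _).trans h
    · exact absurd (hIkp Q hQp h) (hl'I Q hQ)
  have hJQ : ∀ Q ∈ l', J ≤ m (e 1) ⊤ ⊔ Q := fun Q hQ => hJY.trans (sup_le_sup_left (hYQ Q hQ) _)
  have haR : ∀ x, m (m (e 1) ⊤) x ≤ m (e 1) ⊤ := fun x => q.RI_mul ha x
  obtain ⟨J1, hJ1, hJ1le⟩ : ∃ J1 ∈ C, J1 ≤ m (e 1) ⊤ ⊔ l'.foldr m ⊤ := by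
    have hl'T : ∀ Q ∈ l', TI m Q := fun Q hQ => (hl' Q hQ).1.1
    clear hl' hl'g hl'I hYQ
    induction l' with
    | nil => exact ⟨⊤, s.top, le_sup_right⟩
    | cons Q l' ih =>
      have hT' : ∀ Q ∈ l', TI m Q := fun Q hQ => hl'T Q (by simp [hQ])
      obtain ⟨J1, hJ1, h1⟩ := ih (fun Q hQ => hJQ Q (by simp [hQ])) hT'
      obtain ⟨J', hJ', h2⟩ := s.symr _ (q.TI_foldr l' hT') J hJ
      refine ⟨m J1 J', s.mul _ hJ1 _ hJ', ?_⟩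
      refine (q.mono h1 le_rfl).trans ((q.sup_mul _ _ _).trans (sup_le ((haR _).trans le_sup_left) (h2.trans ?_)))
      exact (q.mono (hJQ Q (by simp)) le_rfl).trans ((q.sup_mul _ _ _).trans (sup_le_sup (haR _) le_rfl))
  have hJ1g : J1 ≤ m (e 1) ⊤ ⊔ m γ ⊤ := hJ1le.trans (sup_le_sup_left hl'g _)
  -- Nakayama
  obtain ⟨J2, hJ2, hJ2le⟩ : ∃ J2 ∈ C, J2 ≤ m (e 1) ⊤ ⊔ l.foldr m ⊤ := by
    clear hl hlI hfT hγT hγQ hl'I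
    induction l with
    | nil => exact ⟨⊤, s.top, le_sup_right⟩
    | cons P l ih =>
      obtain ⟨J2, hJ2, h⟩ := ih (fun Q hQ => hlT Q (by simp [hQ])) (fun Q hQ => hγP Q (by simp [hQ]))
      refine ⟨m J1 J2, s.mul _ hJ1 _ hJ2, ?_⟩
      refine (q.mono hJ1g le_rfl).trans ((q.sup_mul _ _ _).trans (sup_le ((haR _).trans le_sup_left) ?_))
      rw [q.assoc]
      refine (q.mono le_rfl ((q.LI_mul (s.ideal _ hJ2) _).trans h)).trans ((q.mul_sup _ _ _).trans (sup_le_sup ?_ ?_))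
      · rw [hgα]; exact q.mono le_rfl le_top
      · exact q.mono (hγP P (by simp)) le_rfl
  exact hIC (s.up J2 hJ2 I hI (hImax J2 (s.ideal _ hJ2) (hJ2le.trans (sup_le le_rfl (hlI.trans hIa)))))

end IQ
end AbstractPart

section RingPart
variable {R : Type*} [Ring R]

def mm (x y : Submodule ℤ R) : Submodule ℤ R := x * y

def ptR (R : Type*) [Ring R] : Set (Submodule ℤ R) := Set.range (fun b : R => Submodule.span ℤ {b})

lemma mulmono' {a b c d : Submodule ℤ R} (h : a ≤ b) (h' : c ≤ d) : a * c ≤ b * d :=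
  Submodule.mul_le.2 fun _ hx _ hy => Submodule.mul_mem_mul (h hx) (h' hy)

lemma mm_le {x y z : Submodule ℤ R} : mm x y ≤ z ↔ ∀ a ∈ x, ∀ b ∈ y, a * b ∈ z := Submodule.mul_le

lemma mem_mm_single {b : R} {D : Submodule ℤ R} {y : R} :
    y ∈ mm (Submodule.span ℤ {b}) D ↔ ∃ d ∈ D, b * d = y := by
  unfold mm
  constructor
  · intro h
    refine Submodule.mul_induction_on h ?_ ?_
    · intro u hu d hd
      obtain ⟨k, rfl⟩ := Submodule.mem_span_singleton.1 hu
      exact ⟨k • d, D.smul_mem _ hd, by rw [mul_smul_comm, smul_mul_assoc]⟩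
    · rintro _ _ ⟨d, hd, rfl⟩ ⟨d', hd', rfl⟩
      exact ⟨d + d', D.add_mem hd hd', mul_add _ _ _⟩
  · rintro ⟨d, hd, rfl⟩
    exact Submodule.mul_mem_mul (Submodule.mem_span_singleton_self b) hd

lemma mem_mm_single' {b : R} {D : Submodule ℤ R} {y : R} :
    y ∈ mm D (Submodule.span ℤ {b}) ↔ ∃ d ∈ D, d * b = y := by
  unfold mm
  constructor
  · intro h
    refine Submodule.mul_induction_on h ?_ ?_
    · intro d hd u hu
      obtain ⟨k, rfl⟩ := Submodule.mem_span_singleton.1 hu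
      exact ⟨k • d, D.smul_mem _ hd, by rw [mul_smul_comm, smul_mul_assoc]⟩
    · rintro _ _ ⟨d, hd, rfl⟩ ⟨d', hd', rfl⟩
      exact ⟨d + d', D.add_mem hd hd', add_mul _ _ _⟩
  · rintro ⟨d, hd, rfl⟩
    exact Submodule.mul_mem_mul hd (Submodule.mem_span_singleton_self b)

/-- additive subgroups as submodules -/
def mkS (I : Set R) (h0 : (0 : R) ∈ I) (ha : ∀ x ∈ I, ∀ y ∈ I, x + y ∈ I) (hn : ∀ x ∈ I, -x ∈ I) :
    Submodule ℤ R :=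
  AddSubgroup.toIntSubmodule
    { carrier := I, zero_mem' := h0, add_mem' := fun {x y} hx hy => ha x hx y hy,
      neg_mem' := fun {x} hx => hn x hx }

lemma mem_mkS {I : Set R} {h0 ha hn} {x : R} : x ∈ mkS I h0 ha hn ↔ x ∈ I := Iff.rfl

lemma RI_iff {N : Submodule ℤ R} : RI mm N ↔ ∀ x ∈ N, ∀ r : R, x * r ∈ N := by
  unfold RI; rw [mm_le]; simp
lemma LI_iff {N : Submodule ℤ R} : RI (fl mm) N ↔ ∀ x ∈ N, ∀ r : R, r * x ∈ N := by
  unfold RI fl; rw [mm_le]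
  exact ⟨fun h x hx r => h r trivial x hx, fun h r _ x hx => h x hx r⟩
lemma TI_iff {N : Submodule ℤ R} : TI mm N ↔ (∀ x ∈ N, ∀ r : R, x * r ∈ N) ∧ ∀ x ∈ N, ∀ r : R, r * x ∈ N :=
  and_congr RI_iff LI_iff

lemma RI_set {N : Submodule ℤ R} (h : RI mm N) : IsRightIdealSet R (N : Set R) :=
  ⟨N.zero_mem, fun _ hx _ hy => N.add_mem hx hy, fun _ hx => N.neg_mem hx, RI_iff.1 h⟩
lemma LI_set {N : Submodule ℤ R} (h : RI (fl mm) N) : IsLeftIdealSet R (N : Set R) :=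
  ⟨N.zero_mem, fun _ hx _ hy => N.add_mem hx hy, fun _ hx => N.neg_mem hx, LI_iff.1 h⟩
lemma TI_set {N : Submodule ℤ R} (h : TI mm N) : IsIdealSet R (N : Set R) := ⟨RI_set h.1, LI_set h.2⟩

lemma set_RI {I : Set R} (h : IsRightIdealSet R I) : ∃ N : Submodule ℤ R, (N : Set R) = I ∧ RI mm N :=
  ⟨mkS I h.1 h.2.1 h.2.2.1, rfl, RI_iff.2 h.2.2.2⟩
lemma set_LI {I : Set R} (h : IsLeftIdealSet R I) : ∃ N : Submodule ℤ R, (N : Set R) = I ∧ RI (fl mm) N :=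
  ⟨mkS I h.1 h.2.1 h.2.2.1, rfl, LI_iff.2 h.2.2.2⟩
lemma set_TI {I : Set R} (h : IsIdealSet R I) : ∃ N : Submodule ℤ R, (N : Set R) = I ∧ TI mm N :=
  ⟨mkS I h.1.1 h.1.2.1 h.1.2.2.1, rfl, TI_iff.2 ⟨h.1.2.2.2, h.2.2.2.2⟩⟩

/-- ideal generated by an element -/
def gen (x : R) : Submodule ℤ R := ⊤ * Submodule.span ℤ {x} * ⊤
lemma gen_TI (x : R) : TI mm (gen x) := by
  unfold TI mm gen
  constructor
  · rw [mul_assoc]; exact mulmono' le_rfl le_top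
  · rw [← mul_assoc, ← mul_assoc]
    exact mulmono' (mulmono' le_top le_rfl) le_rfl
lemma mem_gen (x : R) : x ∈ gen x := by
  have := Submodule.mul_mem_mul (Submodule.mul_mem_mul (Submodule.mem_top : (1 : R) ∈ (⊤ : Submodule ℤ R))
    (Submodule.mem_span_singleton_self (R := ℤ) x)) (Submodule.mem_top : (1 : R) ∈ (⊤ : Submodule ℤ R))
  unfold gen; simpa using this

lemma PrI_set {V : Submodule ℤ R} (h : PrI mm V) : IsPrimeIdealSet R (V : Set R) := by
  refine ⟨TI_set h.1, fun he => h.2.1 ?_, ?_⟩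
  · exact SetLike.coe_injective (by simpa using he)
  · intro a b hab
    obtain ⟨hr, hl⟩ := TI_iff.1 h.1
    have key : mm (gen a) (gen b) ≤ V := by
      have e1 : mm (gen a) (gen b) = ⊤ * ((Submodule.span ℤ {a} * (⊤ * ⊤)) * Submodule.span ℤ {b}) * ⊤ := by
        unfold mm gen; simp only [mul_assoc]
      rw [e1]
      have e2 : (Submodule.span ℤ {a} * (⊤ * ⊤)) * Submodule.span ℤ {b} ≤ V := by
        intro y hy
        obtain ⟨d, hd, rfl⟩ := mem_mm_single'.1 hy
        obtain ⟨d', _, rfl⟩ := mem_mm_single.1 hd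
        exact hab d'
      refine Submodule.mul_le.2 fun u hu v _ => hr u ?_ v
      exact (Submodule.mul_le.2 fun s _ w hw => hl w (e2 hw) s : _ ≤ V) hu
    rcases h.2.2 _ _ (gen_TI a) (gen_TI b) key with h1 | h1
    · exact Or.inl (h1 (mem_gen a))
    · exact Or.inr (h1 (mem_gen b))

lemma set_PrI {V : Submodule ℤ R} (h : IsPrimeIdealSet R (V : Set R)) : PrI mm V := by
  refine ⟨TI_iff.2 ⟨h.1.1.2.2.2, h.1.2.2.2.2⟩, fun he => h.2.1 (by simp [he]), ?_⟩
  intro A B hA hB hAB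
  by_contra hc
  push Not at hc
  obtain ⟨x, hx, hxV⟩ := SetLike.not_le_iff_exists.1 hc.1
  obtain ⟨y, hy, hyV⟩ := SetLike.not_le_iff_exists.1 hc.2
  rcases h.2.2 x y (fun r => hAB (Submodule.mul_mem_mul ((TI_iff.1 hA).1 x hx r) hy)) with h1 | h1
  · exact hxV h1
  · exact hyV h1

lemma PrI_unfl {V : Submodule ℤ R} (h : PrI (fl mm) V) : PrI mm V :=
  ⟨⟨h.1.2, h.1.1⟩, h.2.1, fun A B hA hB hAB => (h.2.2 B A ⟨hB.2, hB.1⟩ ⟨hA.2, hA.1⟩ hAB).symm⟩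

lemma mem_res {p G : Submodule ℤ R} {x : R} : x ∈ res mm p G ↔ ∀ b ∈ p, b * x ∈ G := by
  constructor
  · have : res mm p G ≤ mkS {x | ∀ b ∈ p, b * x ∈ G} (by simp)
        (fun x hx y hy b hb => by rw [mul_add]; exact G.add_mem (hx b hb) (hy b hb))
        (fun x hx b hb => by rw [mul_neg]; exact G.neg_mem (hx b hb)) := by
      refine sSup_le fun y hy z hz => ?_
      rw [mem_mkS]
      exact fun b hb => mm_le.1 hy b hb z hz
    exact fun h => mem_mkS.1 (this h)
  · intro h
    have : Submodule.span ℤ {x} ≤ res mm p G := by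
      refine le_sSup (mm_le.2 fun b hb y hy => ?_)
      obtain ⟨k, rfl⟩ := Submodule.mem_span_singleton.1 hy
      rw [mul_smul_comm]; exact G.smul_mem _ (h b hb)
    exact this (Submodule.mem_span_singleton_self x)

lemma mem_res' {p G : Submodule ℤ R} {x : R} : x ∈ res (fl mm) p G ↔ ∀ b ∈ p, x * b ∈ G := by
  constructor
  · have : res (fl mm) p G ≤ mkS {x | ∀ b ∈ p, x * b ∈ G} (by simp)
        (fun x hx y hy b hb => by rw [add_mul]; exact G.add_mem (hx b hb) (hy b hb))
        (fun x hx b hb => by rw [neg_mul]; exact G.neg_mem (hx b hb)) := by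
      refine sSup_le fun y hy z hz => ?_
      rw [mem_mkS]
      exact fun b hb => mm_le.1 hy z hz b hb
    exact fun h => mem_mkS.1 (this h)
  · intro h
    have : Submodule.span ℤ {x} ≤ res (fl mm) p G := by
      refine le_sSup (mm_le.2 fun y hy b hb => ?_)
      obtain ⟨k, rfl⟩ := Submodule.mem_span_singleton.1 hy
      rw [smul_mul_assoc]; exact G.smul_mem _ (h b hb)
    exact this (Submodule.mem_span_singleton_self x)

lemma accR [IsNoetherian Rᵐᵒᵖ R] (s : Set (Submodule ℤ R)) (hs : s.Nonempty) (h : ∀ x ∈ s, RI mm x) :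
    ∃ x ∈ s, ∀ y ∈ s, x ≤ y → y ≤ x := by
  have hwf : WellFounded ((· > ·) : Submodule Rᵐᵒᵖ R → Submodule Rᵐᵒᵖ R → Prop) := wellFounded_gt
  let t : Set (Submodule Rᵐᵒᵖ R) := {N | ∃ x ∈ s, (x : Set R) = N}
  have ht : ∀ x ∈ s, ∃ N ∈ t, (x : Set R) = N := fun x hx =>
    ⟨{ carrier := x, zero_mem' := x.zero_mem, add_mem' := fun ha hb => x.add_mem ha hb,
       smul_mem' := fun c y hy => RI_iff.1 (h x hx) y hy c.unop }, ⟨x, hx, rfl⟩, rfl⟩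
  obtain ⟨x0, hx0⟩ := hs
  obtain ⟨N0, hN0, _⟩ := ht x0 hx0
  obtain ⟨N, ⟨x, hx, hxN⟩, hmin⟩ := hwf.has_min t ⟨N0, hN0⟩
  refine ⟨x, hx, fun y hy hxy => ?_⟩
  obtain ⟨M, hM, hyM⟩ := ht y hy
  have hNM : N ≤ M := by
    rw [← SetLike.coe_subset_coe, ← hxN, ← hyM]; exact hxy
  have hMN : M ≤ N := by
    by_contra hc
    exact hmin M hM (lt_of_le_not_ge hNM hc)
  rw [← SetLike.coe_subset_coe, hxN, hyM]; exact hMN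

lemma accL [IsNoetherian R R] (s : Set (Submodule ℤ R)) (hs : s.Nonempty) (h : ∀ x ∈ s, RI (fl mm) x) :
    ∃ x ∈ s, ∀ y ∈ s, x ≤ y → y ≤ x := by
  have hwf : WellFounded ((· > ·) : Submodule R R → Submodule R R → Prop) := wellFounded_gt
  let t : Set (Submodule R R) := {N | ∃ x ∈ s, (x : Set R) = N}
  have ht : ∀ x ∈ s, ∃ N ∈ t, (x : Set R) = N := fun x hx =>
    ⟨{ carrier := x, zero_mem' := x.zero_mem, add_mem' := fun ha hb => x.add_mem ha hb,
       smul_mem' := fun c y hy => LI_iff.1 (h x hx) y hy c }, ⟨x, hx, rfl⟩, rfl⟩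
  obtain ⟨x0, hx0⟩ := hs
  obtain ⟨N0, hN0, _⟩ := ht x0 hx0
  obtain ⟨N, ⟨x, hx, hxN⟩, hmin⟩ := hwf.has_min t ⟨N0, hN0⟩
  refine ⟨x, hx, fun y hy hxy => ?_⟩
  obtain ⟨M, hM, hyM⟩ := ht y hy
  have hNM : N ≤ M := by
    rw [← SetLike.coe_subset_coe, ← hxN, ← hyM]; exact hxy
  have hMN : M ≤ N := by
    by_contra hc
    exact hmin M hM (lt_of_le_not_ge hNM hc)
  rw [← SetLike.coe_subset_coe, hxN, hyM]; exact hMN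

lemma bddR (hb : IsFullyBounded R) (V : Submodule ℤ R) (hV : PrI mm V) (K : Submodule ℤ R) (hK : RI mm K)
    (hVK : V ≤ K) (hess : ∀ D, RI mm D → V ≤ D → ¬ D ≤ V → ¬ (K ⊓ D ≤ V)) :
    ∃ T, TI mm T ∧ ¬ T ≤ V ∧ T ≤ K := by
  obtain ⟨T, hT, _, ⟨t, ht, htV⟩, hTK⟩ := (hb V (PrI_set hV)).1 K (RI_set hK) hVK (by
    intro J hJ hVJ ⟨y, hy, hyV⟩
    obtain ⟨D, rfl, hD⟩ := set_RI hJ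
    obtain ⟨x, hx, hxV⟩ := SetLike.not_le_iff_exists.1 (hess D hD hVJ fun h => hyV (h hy))
    exact ⟨x, hx.1, hx.2, hxV⟩)
  obtain ⟨T, rfl, hT'⟩ := set_TI hT
  exact ⟨T, hT', fun h => htV (h ht), hTK⟩

lemma bddL (hb : IsFullyBounded R) (V : Submodule ℤ R) (hV : PrI (fl mm) V) (K : Submodule ℤ R)
    (hK : RI (fl mm) K)
    (hVK : V ≤ K) (hess : ∀ D, RI (fl mm) D → V ≤ D → ¬ D ≤ V → ¬ (K ⊓ D ≤ V)) :
    ∃ T, TI (fl mm) T ∧ ¬ T ≤ V ∧ T ≤ K := by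
  obtain ⟨T, hT, _, ⟨t, ht, htV⟩, hTK⟩ := (hb V (PrI_set (PrI_unfl hV))).2 K (LI_set hK) hVK (by
    intro J hJ hVJ ⟨y, hy, hyV⟩
    obtain ⟨D, rfl, hD⟩ := set_LI hJ
    obtain ⟨x, hx, hxV⟩ := SetLike.not_le_iff_exists.1 (hess D hD hVJ fun h => hyV (h hy))
    exact ⟨x, hx.1, hx.2, hxV⟩)
  obtain ⟨T, rfl, hT'⟩ := set_TI hT
  exact ⟨T, hT'.fl, fun h => htV (h ht), hTK⟩

lemma IQ_ring (hfbn : IsFBN R) : IQ (mm (R := R)) (ptR R) := by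
  obtain ⟨hb, hl, hr⟩ := hfbn
  refine ⟨fun a b c => mul_assoc a b c, fun h1 h2 => mulmono' h1 h2, ?_, ?_, ?_⟩
  · intro x y h
    obtain ⟨b, hb, hby⟩ := SetLike.not_le_iff_exists.1 h
    exact ⟨_, ⟨b, rfl⟩, by simpa using hb, by simpa using hby⟩
  · refine ⟨fun a b c => (Submodule.mul_sup a b c).le, ?_, ?_, ?_, ?_, accR, bddR hb⟩
    · intro x b hb
      unfold mm; simpa using Submodule.mul_mem_mul hb (Submodule.mem_top : (1 : R) ∈ (⊤ : Submodule ℤ R))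
    · intro p G
      exact mm_le.2 fun b hb x hx => mem_res.1 hx b hb
    · rintro _ ⟨b, rfl⟩ y D h
      refine ⟨D ⊓ res mm (Submodule.span ℤ {b}) y, inf_le_left, le_antisymm ?_ ?_⟩
      · intro u hu
        obtain ⟨d, hd, rfl⟩ := mem_mm_single.1 (h hu)
        refine mem_mm_single.2 ⟨d, ⟨hd, mem_res.2 fun b' hb' => ?_⟩, rfl⟩
        obtain ⟨k, rfl⟩ := Submodule.mem_span_singleton.1 hb'
        rw [smul_mul_assoc]; exact y.smul_mem _ hu
      · exact mm_le.2 fun b' hb' x hx => mem_res.1 hx.2 b' hb'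
    · rintro _ ⟨b, rfl⟩ Z X G h z hz
      obtain ⟨u, hu, g, hg, hug⟩ := Submodule.mem_sup.1
        (h (mem_mm_single.2 ⟨z, hz, rfl⟩))
      obtain ⟨x, hx, rfl⟩ := mem_mm_single.1 hu
      refine Submodule.mem_sup.2 ⟨x, hx, z - x, mem_res.2 fun b' hb' => ?_, by abel⟩
      obtain ⟨k, rfl⟩ := Submodule.mem_span_singleton.1 hb'
      rw [smul_mul_assoc]; refine G.smul_mem _ ?_
      rwa [mul_sub, ← hug, add_sub_cancel_left]
  · refine ⟨fun a b c => (Submodule.sup_mul b c a).le, ?_, ?_, ?_, ?_, accL, bddL hb⟩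
    · intro x b hb
      change b ∈ mm ⊤ x
      unfold mm; simpa using Submodule.mul_mem_mul (Submodule.mem_top : (1 : R) ∈ (⊤ : Submodule ℤ R)) hb
    · intro p G
      exact mm_le.2 fun x hx b hb => mem_res'.1 hx b hb
    · rintro _ ⟨b, rfl⟩ y D h
      refine ⟨D ⊓ res (fl mm) (Submodule.span ℤ {b}) y, inf_le_left, le_antisymm ?_ ?_⟩
      · intro u hu
        obtain ⟨d, hd, rfl⟩ := mem_mm_single'.1 (h hu)
        refine mem_mm_single'.2 ⟨d, ⟨hd, mem_res'.2 fun b' hb' => ?_⟩, rfl⟩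
        obtain ⟨k, rfl⟩ := Submodule.mem_span_singleton.1 hb'
        rw [mul_smul_comm]; exact y.smul_mem _ hu
      · exact mm_le.2 fun x hx b' hb' => mem_res'.1 hx.2 b' hb'
    · rintro _ ⟨b, rfl⟩ Z X G h z hz
      obtain ⟨u, hu, g, hg, hug⟩ := Submodule.mem_sup.1
        (h (mem_mm_single'.2 ⟨z, hz, rfl⟩))
      obtain ⟨x, hx, rfl⟩ := mem_mm_single'.1 hu
      refine Submodule.mem_sup.2 ⟨x, hx, z - x, mem_res'.2 fun b' hb' => ?_, by abel⟩
      obtain ⟨k, rfl⟩ := Submodule.mem_span_singleton.1 hb'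
      rw [mul_smul_comm]; refine G.smul_mem _ ?_
      rwa [sub_mul, ← hug, add_sub_cancel_left]

/-- `aR` is essential -/
lemma aR_ess [IsNoetherian Rᵐᵒᵖ R] (a : R) (ha : ∀ x y : R, a * x = a * y → x = y)
    (J : Submodule ℤ R) (hJ : RI mm J) (h : mm (Submodule.span ℤ {a}) ⊤ ⊓ J ≤ ⊥) : J ≤ ⊥ := by
  let p : Submodule ℤ R := Submodule.span ℤ {a}
  let K : ℕ → Submodule ℤ R := fun n => Nat.rec J (fun _ X => J ⊔ mm p X) n
  have K1 : ∀ n, K (n+1) = J ⊔ mm p (K n) := fun n => rfl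
  have hK : ∀ n, RI mm (K n) := by
    intro n
    induction n with
    | zero => exact hJ
    | succ n ih =>
      rw [K1]
      unfold RI mm
      rw [Submodule.sup_mul, mul_assoc]
      exact sup_le_sup hJ (mulmono' le_rfl ih)
  have hmono : ∀ n, K n ≤ K (n+1) := by
    intro n
    induction n with
    | zero => exact le_sup_left
    | succ n ih =>
      rw [K1, K1 (n+1)]
      exact sup_le_sup le_rfl (mulmono' le_rfl ih)
  have back : ∀ n, K (n+2) ≤ K (n+1) → K (n+1) ≤ K n := by
    intro n hn z hz
    have h1 : a * z ∈ K (n+2) := by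
      rw [K1 (n+1)]; exact Submodule.mem_sup_right (mem_mm_single.2 ⟨z, hz, rfl⟩)
    have h2 := hn h1
    rw [K1] at h2
    obtain ⟨j, hj, u, hu, hju⟩ := Submodule.mem_sup.1 h2
    obtain ⟨x, hx, rfl⟩ := mem_mm_single.1 hu
    have h3 : j ∈ mm p ⊤ ⊓ J := ⟨mem_mm_single.2 ⟨z - x, trivial, by rw [mul_sub, ← hju]; abel⟩, hj⟩
    have h4 : j = 0 := by simpa using h h3
    rw [h4, zero_add] at hju
    rwa [← ha _ _ hju]
  obtain ⟨_, ⟨n, rfl⟩, hmax⟩ := accR (Set.range K) ⟨_, 0, rfl⟩ (by rintro _ ⟨n, rfl⟩; exact hK n)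
  have hn : K (n+1) ≤ K n := hmax _ ⟨n+1, rfl⟩ (hmono n)
  have h0 : ∀ n, K (n+1) ≤ K n → K 1 ≤ K 0 := by
    intro n
    induction n with
    | zero => exact id
    | succ n ih => exact fun h => ih (back n h)
  intro z hz
  have h1 : a * z ∈ K 1 := by
    change _ ∈ J ⊔ mm p (K 0); exact Submodule.mem_sup_right (mem_mm_single.2 ⟨z, hz, rfl⟩)
  have h2 : a * z ∈ J := h0 n hn h1
  have h3 : a * z = 0 := by
    simpa using h ⟨mem_mm_single.2 ⟨z, trivial, rfl⟩, h2⟩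
  have : z = 0 := ha _ _ (by rw [h3, mul_zero])
  simp [this]

lemma reg_le {c : R} (hc : ∀ x y : R, c * x = c * y → x = y) (Z X : Submodule ℤ R)
    (h : mm (Submodule.span ℤ {c}) Z ≤ mm (Submodule.span ℤ {c}) X) : Z ≤ X := by
  intro z hz
  obtain ⟨x, hx, hxz⟩ := mem_mm_single.1 (h (mem_mm_single.2 ⟨z, hz, rfl⟩))
  rwa [← hc _ _ hxz]

end RingPart

/-- Let `R` be a prime FBN ring in which every nonzero two-sided
ideal contains a nonzero central element.  Then for every cancellative nonunit
`a ∈ R` there is a height-one prime two-sided ideal `P` of `R` containing the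
annihilator `{r : ∀ s, s r ∈ aR}` of the right module `R/aR`. -/
theorem exists_heightOne_prime_of_FBN {R : Type*} [Ring R]
    (hprime : IsPrimeRing R) (hfbn : IsFBN R)
    (hcen : ∀ I : Set R, IsIdealSet R I → (∃ x ∈ I, x ≠ 0) →
      ∃ z ∈ I, z ≠ 0 ∧ ∀ r : R, z * r = r * z)
    (a : R) (ha : IsCancellative a) (hna : ¬ IsUnit a) :
    ∃ P : Set R, IsPrimeIdealSet R P ∧ P ≠ {0} ∧
      (∀ Q : Set R, IsPrimeIdealSet R Q → Q ⊂ P → Q = {0}) ∧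
      {r : R | ∀ s : R, ∃ t : R, s * r = a * t} ⊆ P := by
  have := hfbn.2.2
  let q := IQ_ring hfbn
  let e : ℕ → Submodule ℤ R := fun n => Submodule.span ℤ {a ^ n}
  have e1 : e 1 = Submodule.span ℤ {a} := by simp [e]
  have mem_e1 : ∀ y : R, y ∈ mm (e 1) ⊤ ↔ ∃ t, y = a * t := by
    intro y
    rw [e1, mem_mm_single]
    simp [eq_comm]
  let I : Submodule ℤ R := mkS {r : R | ∀ s : R, ∃ t : R, s * r = a * t}
    (fun s => ⟨0, by simp⟩)
    (fun x hx y hy s => by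
      obtain ⟨t, ht⟩ := hx s
      obtain ⟨t', ht'⟩ := hy s
      exact ⟨t + t', by rw [mul_add, mul_add, ht, ht']⟩)
    (fun x hx s => by
      obtain ⟨t, ht⟩ := hx s
      exact ⟨-t, by rw [mul_neg, mul_neg, ht]⟩)
  have mem_I : ∀ r, r ∈ I ↔ ∀ s : R, ∃ t : R, s * r = a * t := fun r => Iff.rfl
  have hIa : I ≤ mm (e 1) ⊤ := by
    intro r hr
    obtain ⟨t, ht⟩ := (mem_I r).1 hr 1
    exact (mem_e1 r).2 ⟨t, by simpa using ht⟩
  have hImax : ∀ T, TI mm T → T ≤ mm (e 1) ⊤ → T ≤ I := by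
    intro T hT hTa r hr
    exact (mem_I r).2 fun s => (mem_e1 _).1 (hTa ((TI_iff.1 hT).2 r hr s))
  have hbot : PrI mm (⊥ : Submodule ℤ R) := set_PrI (by simpa [IsPrimeRing] using hprime)
  have apow : ∀ n, ∀ x y : R, a ^ n * x = a ^ n * y → x = y := by
    intro n
    induction n with
    | zero => simp
    | succ n ih =>
      intro x y h
      rw [pow_succ, mul_assoc, mul_assoc] at h
      exact ha.1 _ _ (ih _ _ h)
  have hee : ∀ i j : ℕ, mm (e i) (e j) = e (i + j) := by
    intro i j
    simp [mm, e, Submodule.span_mul_span, pow_add]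
  obtain ⟨P, hP, hIP, hP0, hPm⟩ := q.main_abs e (fun n => ⟨a ^ n, rfl⟩)
    (fun n => reg_le (apow n))
    (by
      refine top_le_iff.1 fun x _ => mem_mm_single.2 ⟨x, trivial, by simp⟩)
    (fun n x => by rw [← q.assoc, hee, add_comm])
    (fun n x => by rw [← q.assoc, hee])
    I
    (TI_iff.2 ⟨fun x hx r s => by
        obtain ⟨t, ht⟩ := hx s
        exact ⟨t * r, by rw [← mul_assoc, ht, mul_assoc]⟩,
      fun x hx r s => by
        obtain ⟨t, ht⟩ := hx (s * r)
        exact ⟨t, by rw [← mul_assoc, ht]⟩⟩)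
    hIa hImax
    (by
      intro h
      have h1 : (1 : R) ∈ I := by rw [h]; trivial
      obtain ⟨t, ht⟩ := (mem_e1 _).1 (hIa h1)
      refine hna ⟨⟨a, t, ht.symm, ?_⟩, rfl⟩
      exact ha.1 _ _ (by rw [← mul_assoc, ← ht, one_mul, mul_one]))
    (by
      obtain ⟨T, hT, hT0, hTa⟩ := bddR hfbn.1 ⊥ hbot (mm (e 1) ⊤)
        (by unfold RI; rw [q.assoc]; exact q.mono le_rfl le_top) bot_le
        (fun D hD _ hD0 hc => hD0 (aR_ess a ha.1 D hD (by rwa [← e1])))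
      intro h
      exact hT0 (h ▸ hImax T hT hTa))
    hbot
    (by
      intro T hT hT0
      obtain ⟨x, hx, hx0⟩ := T.ne_bot_iff.1 hT0
      obtain ⟨z, hz, hz0, hzc⟩ := hcen T (TI_set hT) ⟨x, hx, hx0⟩
      refine ⟨_, ⟨z, rfl⟩, by simpa using hz, ?_, ?_⟩
      · intro x
        ext y
        simp only [mem_mm_single, mem_mm_single', hzc]
      · refine reg_le fun u v huv => ?_
        rcases hprime.2.2 z (u - v) (fun r => by
          rw [hzc, mul_assoc, mul_sub, huv, sub_self, mul_zero]; rfl) with h | h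
        · exact absurd h hz0
        · exact sub_eq_zero.1 h)
  refine ⟨P, PrI_set hP, ?_, ?_, hIP⟩
  · intro h
    exact hP0 (SetLike.coe_injective (by simpa using h))
  · intro Q hQ hQP
    obtain ⟨N, rfl, _⟩ := set_TI hQ.1
    by_contra hN
    have := hPm N (set_PrI hQ) hQP.1 (by rintro rfl; simp at hN)
    rw [this] at hQP
    exact hQP.2 le_rfl
end

section
/- Let R be a prime FBN ring and suppose that every nonzero two-sided ideal of R contains a nonzero central element. Then R is a BF-ring. -/
universe u
open Ordinal

noncomputable def bfNadd (a b : Ordinal.{u}) : Ordinal.{u} :=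
  max (⨆ x : Set.Iio a, Order.succ (bfNadd x.1 b)) (⨆ x : Set.Iio b, Order.succ (bfNadd a x.1))
termination_by (a, b)
decreasing_by
  · exact Prod.Lex.left _ _ x.2
  · exact Prod.Lex.right _ x.2

lemma bfNadd_lt_left {a a' : Ordinal.{u}} (b : Ordinal.{u}) (h : a' < a) :
    bfNadd a' b < bfNadd a b := by
  conv_rhs => rw [bfNadd]
  refine lt_of_lt_of_le (Order.lt_succ _) (le_max_of_le_left ?_)
  exact Ordinal.le_iSup (fun x : Set.Iio a => Order.succ (bfNadd x.1 b)) ⟨a', h⟩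

lemma bfNadd_lt_right (a : Ordinal.{u}) {b b' : Ordinal.{u}} (h : b' < b) :
    bfNadd a b' < bfNadd a b := by
  conv_rhs => rw [bfNadd]
  refine lt_of_lt_of_le (Order.lt_succ _) (le_max_of_le_right ?_)
  exact Ordinal.le_iSup (fun x : Set.Iio b => Order.succ (bfNadd a x.1)) ⟨b', h⟩

lemma bfNadd_le {a b c : Ordinal.{u}} (h1 : ∀ a' < a, bfNadd a' b < c)
    (h2 : ∀ b' < b, bfNadd a b' < c) : bfNadd a b ≤ c := by
  rw [bfNadd]
  refine max_le (Ordinal.iSup_le fun x => Order.succ_le_of_lt (h1 _ x.2))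
    (Ordinal.iSup_le fun x => Order.succ_le_of_lt (h2 _ x.2))

lemma bfNadd_mono {a b a' b' : Ordinal.{u}} (h1 : a' ≤ a) (h2 : b' ≤ b) :
    bfNadd a' b' ≤ bfNadd a b := by
  have : bfNadd a' b' ≤ bfNadd a b' := by
    rcases h1.eq_or_lt with rfl | h
    · exact le_rfl
    · exact (bfNadd_lt_left _ h).le
  refine this.trans ?_
  rcases h2.eq_or_lt with rfl | h
  · exact le_rfl
  · exact (bfNadd_lt_right _ h).le

lemma bfNadd_lt_opow (β : Ordinal.{u}) :
    ∀ a b : Ordinal.{u}, a < ω ^ β → b < ω ^ β → bfNadd a b < ω ^ β := by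
  induction β using WellFoundedLT.induction with
  | ind β ih =>
  intro a b ha hb
  by_cases h0 : β = 0
  · subst h0
    simp only [opow_zero, Order.lt_one_iff] at ha hb ⊢
    subst ha hb
    refine le_antisymm (bfNadd_le ?_ ?_) (zero_le) <;> intro x hx <;>
      exact absurd hx (not_lt.2 (zero_le))
  obtain ⟨γ1, hγ1, n1, hn1⟩ := (lt_omega0_opow h0).1 ha
  obtain ⟨γ2, hγ2, n2, hn2⟩ := (lt_omega0_opow h0).1 hb
  obtain ⟨γ, hγ, hle1, hle2⟩ : ∃ γ < β, γ1 ≤ γ ∧ γ2 ≤ γ :=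
    ⟨max γ1 γ2, max_lt hγ1 hγ2, le_max_left _ _, le_max_right _ _⟩
  have P := ih γ hγ
  set W : Ordinal.{u} := ω ^ γ with hW
  have hWpos : 0 < W := opow_pos _ omega0_pos
  have ha' : a < W * n1 := hn1.trans_le (by gcongr; exact opow_le_opow_right omega0_pos hle1)
  have hb' : b < W * n2 := hn2.trans_le (by gcongr; exact opow_le_opow_right omega0_pos hle2)
  have key : ∀ a b : Ordinal.{u}, ∀ i j : ℕ, ∀ p q : Ordinal.{u}, p < W → q < W →
      a = W * i + p → b = W * j + q → bfNadd a b ≤ W * (i + j : ℕ) + bfNadd p q := by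
    have dec : ∀ a' : Ordinal.{u}, ∀ i : ℕ, ∀ p, p < W → a' < W * i + p →
        ∃ i' : ℕ, ∃ p' < W, a' = W * i' + p' ∧ (i' < i ∨ (i' = i ∧ p' < p)) := by
      intro a' i p hp h
      have h1 : a' / W < (i + 1 : ℕ) := by
        rw [← Ordinal.lt_mul_iff_div_lt hWpos.ne']
        refine h.trans_le ?_
        push_cast
        rw [mul_add_one]
        gcongr
      obtain ⟨i', hi'⟩ := lt_omega0.1 (h1.trans (natCast_lt_omega0 _))
      refine ⟨i', a' % W, mod_lt _ hWpos.ne', ?_, ?_⟩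
      · rw [← hi', div_add_mod]
      · rw [hi'] at h1
        have h2 : i' < i + 1 := by exact_mod_cast h1
        rcases (Nat.lt_succ_iff.1 h2).lt_or_eq with h3 | h3
        · exact Or.inl h3
        · refine Or.inr ⟨h3, ?_⟩
          rw [← div_add_mod a' W, hi', h3] at h
          exact lt_of_add_lt_add_left h
    have aux : ∀ m n : ℕ, m < n → ∀ r s : Ordinal.{u}, r < W → W * m + r < W * n + s := by
      intro m n hmn r s hr
      calc W * m + r < W * m + W := by gcongr
        _ = W * (m + 1 : ℕ) := by push_cast; rw [mul_add_one]
        _ ≤ W * n := by gcongr; exact hmn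
        _ ≤ _ := le_self_add
    intro a
    induction a using WellFoundedLT.induction with
    | ind a iha =>
    intro b
    induction b using WellFoundedLT.induction with
    | ind b ihb =>
    intro i j p q hp hq hae hbe
    refine bfNadd_le ?_ ?_
    · intro a' ha'
      obtain ⟨i', p', hp', he, hc⟩ := dec a' i p hp (hae ▸ ha')
      refine (iha a' ha' b i' j p' q hp' hq he hbe).trans_lt ?_
      rcases hc with hc | ⟨rfl, hc⟩
      · exact aux _ _ (by omega) _ _ (P _ _ hp' hq)
      · have := bfNadd_lt_left q hc
        gcongr
    · intro b' hb'
      obtain ⟨j', q', hq', he, hc⟩ := dec b' j q hq (hbe ▸ hb')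
      refine (ihb b' hb' i j' p q' hp hq' hae he).trans_lt ?_
      rcases hc with hc | ⟨rfl, hc⟩
      · exact aux _ _ (by omega) _ _ (P _ _ hp hq')
      · have := bfNadd_lt_right p hc
        gcongr
  have hfin : bfNadd (W * n1) (W * n2) < ω ^ β := by
    refine (key _ _ n1 n2 0 0 hWpos hWpos (by simp) (by simp)).trans_lt ?_
    have : bfNadd (0 : Ordinal.{u}) 0 < W := P _ _ hWpos hWpos
    calc W * (n1 + n2 : ℕ) + bfNadd 0 0 < W * (n1 + n2 : ℕ) + W := by gcongr
      _ = W * (n1 + n2 + 1 : ℕ) := by push_cast; rw [mul_add_one]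
      _ < ω ^ β := by
        rw [hW]
        refine (lt_omega0_opow h0).2 ⟨γ, hγ, n1 + n2 + 2, ?_⟩
        rw [mul_lt_mul_iff_right₀ hWpos]
        exact_mod_cast Nat.lt_succ_self _
  exact (bfNadd_mono ha'.le hb'.le).trans_lt hfin

section lat
variable {L : Type u} [Lattice L] [WellFoundedGT L]

def bfRel (b : L) (x y : L) : Prop := y < x ∧ x ≤ b

instance bfRel_wf (b : L) : IsWellFounded L (bfRel b) :=
  ⟨Subrelation.wf (r := fun x y : L => x > y) (fun h => h.1) wellFounded_gt⟩

noncomputable def bfRk (b x : L) : Ordinal.{u} := IsWellFounded.rank (bfRel b) x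

lemma bfRk_lt {b x y : L} (h : x < y) (hy : y ≤ b) : bfRk b y < bfRk b x :=
  IsWellFounded.rank_lt_of_rel (r := bfRel b) ⟨h, hy⟩

lemma bfRk_le {b x : L} {c : Ordinal.{u}} (h : ∀ y, x < y → y ≤ b → bfRk b y < c) :
    bfRk b x ≤ c := by
  rw [bfRk, IsWellFounded.rank_eq]
  exact Ordinal.iSup_le fun y => Order.succ_le_of_lt (h y.1 y.2.1 y.2.2)

lemma bfRk_exists {b x : L} {c : Ordinal.{u}} (h : c < bfRk b x) :
    ∃ y, x < y ∧ y ≤ b ∧ c ≤ bfRk b y := by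
  by_contra! hc
  exact absurd (bfRk_le hc) (not_le.2 h)

lemma bfRk_anti {b x y : L} (h : x ≤ y) : bfRk b y ≤ bfRk b x :=
  bfRk_le fun _ h1 h2 => bfRk_lt (h.trans_lt h1) h2

lemma bfRk_mono {b b' : L} (h : b ≤ b') (x : L) : bfRk b x ≤ bfRk b' x := by
  induction x using WellFoundedGT.induction with
  | ind x ih =>
  exact bfRk_le fun y h1 h2 => (ih y h1).trans_lt (bfRk_lt h1 (h2.trans h))

lemma bfRk_self (b : L) : bfRk b b = 0 :=
  le_antisymm (bfRk_le fun _ h1 h2 => absurd (h1.trans_le h2) (lt_irrefl _)) zero_le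

lemma bfRk_sup [IsModularLattice L] (b c x : L) :
    bfRk (b ⊔ c) x ≤ bfNadd (bfRk b (x ⊓ b)) (bfRk c ((x ⊔ b) ⊓ c)) := by
  induction x using WellFoundedGT.induction with
  | ind x ih =>
  refine bfRk_le fun y h1 h2 => (ih y h1).trans_lt ?_
  have i1 : x ⊓ b ≤ y ⊓ b := inf_le_inf_right _ h1.le
  have i2 : (x ⊔ b) ⊓ c ≤ (y ⊔ b) ⊓ c := inf_le_inf_right _ (sup_le_sup_right h1.le _)
  rcases i1.lt_or_eq with i | i
  · exact (bfNadd_lt_left _ (bfRk_lt i inf_le_right)).trans_le (bfNadd_mono le_rfl (bfRk_anti i2))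
  · rcases i2.lt_or_eq with j | j
    · exact (bfNadd_lt_right _ (bfRk_lt j inf_le_right)).trans_le
        (bfNadd_mono (bfRk_anti i1) le_rfl)
    · exfalso
      have e : ∀ t : L, t ≤ b ⊔ c → b ⊔ ((t ⊔ b) ⊓ c) = t ⊔ b := by
        intro t ht
        have h3 : b ≤ t ⊔ b := le_sup_right
        rw [inf_comm, ← sup_inf_assoc_of_le c h3]
        exact inf_eq_right.2 (sup_le ht le_sup_left)
      have e2 : x ⊔ b = y ⊔ b := by
        rw [← e x (h1.le.trans h2), ← e y h2, j]
      exact h1.ne (eq_of_le_of_inf_le_of_sup_le h1.le i.ge e2.ge)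

/-- a uniform bound for everything below `ω ^ β`. -/
lemma bfRk_bound [IsModularLattice L] (z : L) (β : Ordinal.{u}) :
    ∃ o < ω ^ β, ∀ b : L, z ≤ b → bfRk b z < ω ^ β → bfRk b z ≤ o := by
  obtain ⟨T, ⟨hT1, hT2⟩, hT⟩ := WellFounded.has_min (wellFounded_gt (α := L))
    {b | z ≤ b ∧ bfRk b z < ω ^ β}
    ⟨z, le_rfl, by rw [bfRk_self]; exact opow_pos _ omega0_pos⟩
  refine ⟨_, hT2, fun b hb1 hb2 => bfRk_mono ?_ z⟩
  by_contra hbT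
  refine hT (b ⊔ T) ⟨hb1.trans le_sup_left, ?_⟩ (right_lt_sup.2 hbT)
  refine (bfRk_sup b T z).trans_lt (bfNadd_lt_opow β _ _ ?_ ?_)
  · rwa [inf_eq_left.2 hb1]
  · exact (bfRk_anti (le_inf le_sup_left hT1)).trans_lt hT2

end lat

section ring
variable {R : Type u} [Ring R]

/-- left multiplication as an endomorphism of the right module. -/
def bfMul (a : R) : R →ₗ[Rᵐᵒᵖ] R where
  toFun x := a * x
  map_add' := mul_add a
  map_smul' r x := by simp [mul_assoc]

lemma bfMul_apply (a x : R) : bfMul a x = a * x := rfl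

lemma bfMul_comp (a b : R) : bfMul (a * b) = (bfMul a).comp (bfMul b) := by
  ext; simp [bfMul_apply]

def BfReg (a : R) : Prop := Function.Injective (bfMul a)

lemma BfReg.mul {a b : R} (ha : BfReg a) (hb : BfReg b) : BfReg (a * b) := by
  unfold BfReg
  rw [bfMul_comp]
  exact ha.comp hb

/-- the right ideal `aR` -/
def bfI (a : R) : Submodule Rᵐᵒᵖ R := LinearMap.range (bfMul a)

lemma bfI_mul (a b : R) : bfI (a * b) = (bfI b).map (bfMul a) := by
  rw [bfI, bfMul_comp, LinearMap.range_comp, bfI]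

variable [IsNoetherian Rᵐᵒᵖ R]

lemma bfRk_map {a : R} (ha : BfReg a) (X : Submodule Rᵐᵒᵖ R) :
    bfRk (bfI a) (X.map (bfMul a)) = bfRk ⊤ X := by
  have hs : StrictMono (Submodule.map (bfMul a)) := Submodule.map_strictMono_of_injective ha
  induction X using WellFoundedGT.induction with
  | ind X ih =>
  refine le_antisymm (bfRk_le fun y h1 h2 => ?_) (bfRk_le fun Y h1 _ => ?_)
  · have e : (y.comap (bfMul a)).map (bfMul a) = y := Submodule.map_comap_eq_of_le h2
    rw [← e] at h1 ⊢
    have h3 : X < y.comap (bfMul a) := by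
      refine lt_of_le_of_ne ((Submodule.map_le_map_iff_of_injective ha _ _).1 h1.le) fun he => ?_
      exact h1.ne (congrArg _ he)
    rw [ih _ h3]
    exact bfRk_lt h3 le_top
  · rw [← ih Y h1]
    exact bfRk_lt (hs h1) (LinearMap.map_le_range)

lemma bfRk_add {a : R} (ha : BfReg a) (X : Submodule Rᵐᵒᵖ R) :
    bfRk ⊤ (bfI a) + bfRk ⊤ X ≤ bfRk ⊤ (X.map (bfMul a)) := by
  have hs : StrictMono (Submodule.map (bfMul a)) := Submodule.map_strictMono_of_injective ha
  induction X using WellFoundedGT.induction with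
  | ind X ih =>
  by_contra! hc
  have h1 : bfRk ⊤ (bfI a) ≤ bfRk ⊤ (X.map (bfMul a)) := bfRk_anti LinearMap.map_le_range
  obtain ⟨d, hd⟩ := exists_add_of_le h1
  rw [hd] at hc
  obtain ⟨Y, hY1, -, hY⟩ := bfRk_exists (lt_of_add_lt_add_left hc)
  have h2 := (ih Y hY1).trans_lt (bfRk_lt (hs hY1) le_top)
  rw [hd] at h2
  exact absurd hY (not_le.2 (lt_of_add_lt_add_left h2))

noncomputable def bfRho (a : R) : Ordinal.{u} := bfRk ⊤ (bfI a)

lemma bfRho_mul {a : R} (ha : BfReg a) (b : R) : bfRho a + bfRho b ≤ bfRho (a * b) := by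
  rw [bfRho, bfRho, bfRho, bfI_mul]
  exact bfRk_add ha _

/-- `w` divides the central element `z`. -/
def BfD (z w : R) : Prop := ∃ b, b * w = z ∧ w * b = z

lemma BfD.left {z x y : R} (hz : ∀ r, z * r = r * z) (hx : BfReg x) (h : BfD z (x * y)) :
    BfD z x := by
  obtain ⟨b, h1, h2⟩ := h
  refine ⟨y * b, hx ?_, by rw [← mul_assoc, h2]⟩
  change x * (y * b * x) = x * z
  rw [← hz, ← h2]; simp only [mul_assoc]

lemma BfD.right {z x y : R} (hz : ∀ r, z * r = r * z) (hx : BfReg x) (h : BfD z (x * y)) :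
    BfD z y := by
  obtain ⟨b, h1, h2⟩ := h
  refine ⟨b * x, by rw [mul_assoc, h1], hx ?_⟩
  change x * (y * (b * x)) = x * z
  rw [← hz, ← h2]; simp only [mul_assoc]

lemma bfRho_bound {z : R} (hzr : BfReg z) (β : Ordinal.{u}) :
    ∃ o < ω ^ β, ∀ w : R, BfD z w → bfRho w < ω ^ β → bfRho w ≤ o := by
  obtain ⟨o, ho, h⟩ := bfRk_bound (bfI z) β
  refine ⟨o, ho, ?_⟩
  rintro w ⟨b, h1, h2⟩ hw
  have hb : BfReg b := by
    intro x y hxy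
    apply hzr
    change b * x = b * y at hxy
    change z * x = z * y
    rw [← h2, mul_assoc, hxy, mul_assoc]
  have e : bfRk (bfI b) (bfI z) = bfRho w := by
    rw [← h1, bfI_mul, bfRk_map hb, bfRho]
  rw [← e] at hw ⊢
  refine h _ ?_ hw
  rw [← h1, bfI_mul]
  exact LinearMap.map_le_range

lemma bfReg_prod {l : List R} (h : ∀ u ∈ l, BfReg u) : BfReg l.prod := by
  induction l with
  | nil => intro x y h; simpa [bfMul_apply] using h
  | cons a l ih =>
    rw [List.prod_cons]
    exact (h a (by simp)).mul (ih fun u hu => h u (by simp [hu]))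

lemma bf_split {C : Ordinal.{u}} (hC : 0 < C) (l : List R) :
    bfRho l.prod < C ∨
      ∃ p u s, l = p ++ u :: s ∧ bfRho p.prod < C ∧ C ≤ bfRho (p.prod * u) := by
  induction l using List.reverseRecOn with
  | nil =>
    left
    have : bfI (1 : R) = ⊤ := by
      rw [eq_top_iff]; rintro x -; exact ⟨x, by simp [bfMul_apply]⟩
    rw [List.prod_nil, bfRho, this, bfRk_self]; exact hC
  | append_singleton l a ih =>
    rcases ih with h | ⟨p, u, s, rfl, h1, h2⟩
    · by_cases h' : bfRho (l.prod * a) < C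
      · left; simpa using h'
      · right; exact ⟨l, a, [], rfl, h, not_lt.1 h'⟩
    · right; exact ⟨p, u, s ++ [a], by simp, h1, h2⟩

lemma bf_main {z : R} (hz : ∀ r, z * r = r * z) (hzr : BfReg z) (β : Ordinal.{u}) :
    ∃ B : ℕ, ∀ l : List R, (∀ u ∈ l, BfReg u ∧ bfRho u ≠ 0) → BfD z l.prod →
      bfRho l.prod < ω ^ β → l.length ≤ B := by
  induction β using WellFoundedLT.induction with
  | ind β ih =>
  by_cases h0 : β = 0
  · subst h0
    refine ⟨0, fun l hl _ h => ?_⟩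
    rw [opow_zero, Order.lt_one_iff] at h
    cases l with
    | nil => simp
    | cons a l =>
      exfalso
      rw [List.prod_cons] at h
      have := bfRho_mul (hl a (by simp)).1 l.prod
      rw [h] at this
      exact (hl a (by simp)).2 (le_antisymm (le_self_add.trans this) zero_le)
  obtain ⟨o, ho, hob⟩ := bfRho_bound hzr β
  obtain ⟨γ, hγ, n, hn⟩ := (lt_omega0_opow h0).1 ho
  obtain ⟨B, hB⟩ := ih γ hγ
  have key : ∀ m : ℕ, ∀ l : List R, (∀ u ∈ l, BfReg u ∧ bfRho u ≠ 0) → BfD z l.prod →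
      bfRho l.prod < ω ^ γ * m → l.length ≤ m * (B + 1) := by
    intro m
    induction m with
    | zero => intro l _ _ h; simp at h
    | succ m ihm =>
      intro l hl hD h
      rcases bf_split (opow_pos γ omega0_pos) l with h1 | ⟨p, u, s, rfl, h1, h2⟩
      · have := hB l hl hD h1
        rw [add_mul]; omega
      · have hpr : BfReg p.prod := bfReg_prod fun x hx => (hl x (by simp [hx])).1
        have hu := (hl u (by simp)).1
        have e : (p ++ u :: s).prod = (p.prod * u) * s.prod := by simp [mul_assoc]
        rw [e] at hD h
        have l1 : p.length ≤ B := hB p (fun x hx => hl x (by simp [hx]))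
          ((hD.left hz (hpr.mul hu)).left hz hpr) h1
        have l2 : s.length ≤ m * (B + 1) := by
          refine ihm s (fun x hx => hl x (by simp [hx])) (hD.right hz (hpr.mul hu)) ?_
          have h3 := (bfRho_mul (hpr.mul hu) s.prod).trans_lt h
          have h4 : ω ^ γ + bfRho s.prod < ω ^ γ + ω ^ γ * m := by
            refine lt_of_le_of_lt ?_ (h3.trans_eq ?_)
            · gcongr
            · rw [add_comm, Nat.cast_add, Nat.cast_one, mul_one_add]
          exact lt_of_add_lt_add_left h4
        simp only [List.length_append, List.length_cons, add_mul]
        omega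
  exact ⟨n * (B + 1), fun l hl hD h => key n l hl hD ((hob _ hD h).trans_lt hn)⟩

lemma bf_essential {a : R} (ha : BfReg a) (J : Submodule Rᵐᵒᵖ R) (hJ : J ≠ ⊥) :
    bfI a ⊓ J ≠ ⊥ := by
  intro h
  let f : Submodule Rᵐᵒᵖ R → Submodule Rᵐᵒᵖ R := fun X => X.map (bfMul a) ⊔ J
  have hf : StrictMono f := by
    intro X Y hXY
    have h1 : X.map (bfMul a) < Y.map (bfMul a) := Submodule.map_strictMono_of_injective ha hXY
    refine lt_of_le_of_ne (sup_le_sup_right h1.le _) fun he => h1.ne ?_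
    have hd : ∀ Z : Submodule Rᵐᵒᵖ R, Z.map (bfMul a) ⊓ J = ⊥ := fun Z =>
      le_bot_iff.1 (h ▸ inf_le_inf_right J LinearMap.map_le_range)
    exact eq_of_le_of_inf_le_of_sup_le h1.le (by rw [hd, hd]) (le_of_eq he.symm)
  have h0 : ⊥ < f ⊥ := by
    simp only [f, Submodule.map_bot, bot_sup_eq]; exact bot_lt_iff_ne_bot.2 hJ
  have hm : StrictMono fun n : ℕ => f^[n] ⊥ := hf.strictMono_iterate_of_lt_map h0
  exact not_strictMono_of_wellFoundedGT _ hm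

lemma bfRho_ne_zero {a : R} (ha : BfReg a) (hu : ¬ IsUnit a) : bfRho a ≠ 0 := by
  intro h
  have ht : bfI a = ⊤ := by
    by_contra hne
    have := bfRk_lt (lt_top_iff_ne_top.2 hne) le_rfl
    rw [← bfRho, h] at this
    exact absurd this (not_lt.2 zero_le)
  obtain ⟨b, hb⟩ : (1 : R) ∈ bfI a := ht ▸ Submodule.mem_top
  change a * b = 1 at hb
  refine hu ⟨⟨a, b, hb, ha ?_⟩, rfl⟩
  change a * (b * a) = a * 1
  rw [← mul_assoc, hb, one_mul, mul_one]

end ring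

/-- Bounded nonunit factorizations give a BF-monoid. -/
lemma isBF_of_bound {H : Type u} [Monoid H]
    (h : ∀ a : H, ∃ B : ℕ, ∀ l : List H, (∀ x ∈ l, ¬ IsUnit x) → l.prod = a → l.length ≤ B) :
    IsBFMonoid H := by
  classical
  constructor
  · intro a ha
    obtain ⟨B, hB⟩ := h a
    let S : ℕ → Prop := fun k => ∃ l : List H, (∀ x ∈ l, ¬ IsUnit x) ∧ l.prod = a ∧ l.length = k
    have hS1 : S 1 := ⟨[a], by simpa using ha, by simp, rfl⟩
    have hb1 : 1 ≤ B := by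
      obtain ⟨l, h1, h2, h3⟩ := hS1
      exact h3 ▸ hB l h1 h2
    obtain ⟨l, h1, h2, h3⟩ : S (Nat.findGreatest S B) := Nat.findGreatest_spec hb1 hS1
    refine ⟨l, fun x hx => ⟨h1 x hx, fun c d hcd => ?_⟩, h2⟩
    by_contra! hn
    obtain ⟨s, t, rfl⟩ := List.append_of_mem hx
    have hl : ∀ y ∈ s ++ c :: d :: t, ¬ IsUnit y := by
      intro y hy
      simp only [List.mem_append, List.mem_cons] at hy
      rcases hy with hy | rfl | rfl | hy
      · exact h1 y (by simp [hy])
      · exact hn.1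
      · exact hn.2
      · exact h1 y (by simp [hy])
    have hp : (s ++ c :: d :: t).prod = a := by
      rw [← h2, hcd]; simp [mul_assoc]
    have hlen := hB _ hl hp
    have := Nat.le_findGreatest (P := S) hlen ⟨_, hl, hp, rfl⟩
    rw [← h3] at this
    simp at this
  · intro a
    obtain ⟨B, hB⟩ := h a
    refine (Set.finite_Iic B).subset ?_
    rintro k ⟨l, h1, h2, rfl⟩
    exact hB l (fun x hx => (h1 x hx).not_isUnit) h2

/-- A prime FBN ring in which every nonzero two-sided ideal
contains a nonzero central element is a BF-ring. -/
theorem isBFRing_of_FBN {R : Type*} [Ring R]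
    (hprime : IsPrimeRing R) (hfbn : IsFBN R)
    (hcen : ∀ I : Set R, IsIdealSet R I → (∃ x ∈ I, x ≠ 0) →
      ∃ z ∈ I, z ≠ 0 ∧ ∀ r : R, z * r = r * z) :
    IsBFRing R := by
  obtain ⟨hfb, -, hnoeth⟩ := hfbn
  obtain ⟨⟨hR0, hL0⟩, hne, hpr⟩ := id hprime
  have : IsNoetherian Rᵐᵒᵖ R := hnoeth
  apply isBF_of_bound
  rintro ⟨a, ha⟩
  have reg : ∀ c : R, IsCancellative c → BfReg c := fun c hc x y hxy => hc.1 x y hxy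
  have har := reg a ha
  obtain ⟨T, hT1, -, ⟨t, htT, ht0⟩, hT2⟩ := (hfb _ hprime).1 (bfI a : Set R)
    ⟨zero_mem _, fun x hx y hy => add_mem hx hy, fun x hx => neg_mem hx,
      fun x hx r => (bfI a).smul_mem (MulOpposite.op r) hx⟩
    (by rintro x rfl; exact zero_mem _)
    (by
      rintro J ⟨hJ0, hJa, hJn, hJm⟩ - ⟨y, hyJ, hy0⟩
      let J' : Submodule Rᵐᵒᵖ R :=
        { carrier := J
          zero_mem' := hJ0
          add_mem' := fun {x y} hx hy => hJa x hx y hy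
          smul_mem' := fun r x hx => hJm x hx r.unop }
      have hJ' : J' ≠ ⊥ := fun h => hy0 (by
        have : y ∈ J' := hyJ
        rw [h] at this
        simpa using this)
      obtain ⟨x, hx, hx0⟩ := Submodule.exists_mem_ne_zero_of_ne_bot (bf_essential har J' hJ')
      exact ⟨x, hx.1, hx.2, hx0⟩)
  obtain ⟨z, hzT, hz0, hz⟩ := hcen T hT1 ⟨t, htT, ht0⟩
  have hzr : BfReg z := by
    rw [BfReg, injective_iff_map_eq_zero]
    intro c hc
    change z * c = 0 at hc
    refine (hpr z c fun r => ?_).resolve_left hz0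
    change z * r * c = 0
    rw [hz r, mul_assoc, hc, mul_zero]
  obtain ⟨b, hb⟩ := hT2 hzT
  change a * b = z at hb
  have hD : BfD z a := by
    refine ⟨b, har ?_, hb⟩
    change a * (b * a) = a * z
    rw [← mul_assoc, hb, hz]
  obtain ⟨B, hB⟩ := bf_main hz hzr (Order.succ (bfRho a))
  refine ⟨B, fun l hl hla => ?_⟩
  have hp : (l.map (cancellativeSubmonoid R).subtype).prod = a := by
    rw [← map_list_prod, hla]; rfl
  have := hB (l.map (cancellativeSubmonoid R).subtype) ?_ (by rwa [hp]) ?_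
  · simpa using this
  · intro u hu
    obtain ⟨x, hx, rfl⟩ := List.mem_map.1 hu
    have hxr : BfReg (x : R) := reg _ x.2
    refine ⟨hxr, bfRho_ne_zero hxr fun hun => hl x hx ?_⟩
    obtain ⟨v, hv⟩ := hun
    change (v : R) = (x : R) at hv
    have h1 : (x : R) * ↑v⁻¹ = 1 := by rw [← hv]; simp
    have h2 : ↑v⁻¹ * (x : R) = 1 := by rw [← hv]; simp
    have hvc : IsCancellative (↑v⁻¹ : R) :=
      ⟨fun p q h => v⁻¹.mul_right_inj.1 h, fun p q h => v⁻¹.mul_left_inj.1 h⟩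
    exact ⟨⟨x, ⟨↑v⁻¹, hvc⟩, Subtype.ext h1, Subtype.ext h2⟩, rfl⟩
  · rw [hp]
    exact (Order.lt_succ _).trans_le (right_le_opow _ one_lt_omega0)
end

section
/- Let K be a field, R a K-algebra, and V ⊆ R a finite-dimensional K-subspace with 1 ∈ V such that there exist real constants c_1, c_2 > 0 with c_1 n² ≤ dim_K V^n ≤ c_2 n² for all n ≥ 1, where V^n denotes the K-span of all products of n elements of V. Then for every k ≥ 0 there exists a constant C > 0 such that dim_K V^n − dim_K V^{n−k} ≤ C n for infinitely many n ≥ k. -/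
/-- Let `R` be an algebra over a field `K` and `V ⊆ R` a
finite-dimensional subspace containing `1` with `c₁ n² ≤ dim V^n ≤ c₂ n²` for all
`n ≥ 1`.  Then for every `k ≥ 0` there is a constant `C > 0` such that
`dim V^n − dim V^{n−k} ≤ C n` for infinitely many `n ≥ k`. -/
theorem quadraticGrowth_linear_gap {K R : Type*} [Field K] [Ring R] [Algebra K R]
    (V : Submodule K R) (hV1 : (1 : R) ∈ V) (hVfin : FiniteDimensional K V)
    (c₁ c₂ : ℝ) (hc₁ : 0 < c₁) (hc₂ : 0 < c₂)
    (hgrowth : ∀ n : ℕ, 1 ≤ n →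
      c₁ * (n : ℝ) ^ 2 ≤ (Module.finrank K ↥(V ^ n) : ℝ) ∧
      (Module.finrank K ↥(V ^ n) : ℝ) ≤ c₂ * (n : ℝ) ^ 2) :
    ∀ k : ℕ, ∃ C : ℝ, 0 < C ∧
      {n : ℕ | k ≤ n ∧
        (Module.finrank K ↥(V ^ n) : ℝ) - (Module.finrank K ↥(V ^ (n - k)) : ℝ) ≤
          C * (n : ℝ)}.Infinite := by
  intro k
  rcases Nat.eq_zero_or_pos k with rfl | hk
  · refine ⟨1, one_pos, Set.infinite_of_forall_exists_gt fun a => ⟨a + 1, ?_, Nat.lt_succ_self a⟩⟩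
    simp only [Set.mem_setOf_eq, Nat.sub_zero, sub_self]
    exact ⟨Nat.zero_le _, by positivity⟩
  have hkR : (1 : ℝ) ≤ k := by exact_mod_cast hk
  refine ⟨4 * c₂ * k, by positivity, Set.infinite_of_forall_exists_gt fun a => ?_⟩
  by_contra! hcon
  obtain ⟨f, hf⟩ : ∃ f : ℕ → ℝ, ∀ n, f n = (Module.finrank K ↥(V ^ n) : ℝ) := ⟨_, fun _ => rfl⟩
  simp only [← hf, Set.mem_setOf_eq] at hcon hgrowth
  have hf0 : ∀ n, 0 ≤ f n := fun n => by rw [hf]; positivity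
  obtain ⟨N, hN⟩ : ∃ N, N = a + k + 1 := ⟨_, rfl⟩
  have step : ∀ n, N ≤ n → 4 * c₂ * k * n < f n - f (n - k) := by
    intro n hn
    by_contra! h
    have := hcon n ⟨by omega, h⟩
    omega
  have key : ∀ m : ℕ, 2 * c₂ * (k : ℝ) ^ 2 * (m : ℝ) ^ 2 ≤ f (N + m * k) := by
    intro m
    induction m with
    | zero => simpa using hf0 N
    | succ m ih =>
      have h := step (N + (m + 1) * k) (by omega)
      have e : N + (m + 1) * k - k = N + m * k := by
        rw [Nat.add_mul]; omega
      rw [e] at h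
      push_cast at h ⊢
      have h1 : 0 ≤ c₂ * k * (N : ℝ) := by positivity
      have h2 : 0 ≤ c₂ * (k : ℝ) ^ 2 := by positivity
      nlinarith
  have h1 := key (3 * N)
  have h2 := (hgrowth (N + 3 * N * k) (by omega)).2
  have hNR : (1 : ℝ) ≤ N := by exact_mod_cast (by omega : 1 ≤ N)
  push_cast at h1 h2
  have h3 := h1.trans h2
  have h4 : (N + 3 * N * k : ℝ) ≤ 4 * (N * k) := by nlinarith
  have h5 : (N + 3 * N * k : ℝ) ^ 2 ≤ (4 * (N * k)) ^ 2 :=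
    pow_le_pow_left₀ (by positivity) h4 2
  have h6 := mul_le_mul_of_nonneg_left h5 hc₂.le
  have h7 : 0 < c₂ * ((N : ℝ) * k) ^ 2 := by positivity
  nlinarith
end
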